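/- For every set C of 6 distinct real numbers, the number of Möbius-equivalence classes (under real Möbius changes of the independent variable) of rational functions over ℝ that are generic of degree 4 with critical value set C equals 20. -/

import Mathlib

open Polynomial

/-- The Wronskian `W = p′q − pq′` of a rational function `f = p/q` (with `p = f.num`,
`q = f.denom` coprime). -/
noncomputable def wronskian' (f : RatFunc ℝ) : Polynomial ℝ :=
  derivative f.num * f.denom - f.num * derivative f.denom

/-- Two rational functions over `ℝ` are Möbius-equivalent if `g = p(L)/q(L)` in `ℝ(X)`
for some `L = (aX+b)/(cX+d)` with real `a, b, c, d`, `ad − bc ≠ 0`, where `f = p/q`. -/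
def MobiusEquiv (f g : RatFunc ℝ) : Prop :=
  ∃ a b c d : ℝ, a * d - b * c ≠ 0 ∧
    ∃ L : RatFunc ℝ,
      L = algebraMap (Polynomial ℝ) (RatFunc ℝ) (C a * X + C b) /
          algebraMap (Polynomial ℝ) (RatFunc ℝ) (C c * X + C d) ∧
      g = Polynomial.aeval L f.num / Polynomial.aeval L f.denom

/-- A rational function `f = p/q` over `ℝ` is generic of degree `n` with critical value
set `C` (a set of `2n−2` distinct reals): `deg f = n`, `deg W = 2n−2`, `q(z) ≠ 0` for
every complex root `z` of `W`, and `{p(z)/q(z) : z ∈ ℂ, W(z) = 0} = C`. -/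
def GenericDegR (n : ℕ) (Cv : Set ℝ) (f : RatFunc ℝ) : Prop :=
  max f.num.natDegree f.denom.natDegree = n ∧
  (wronskian' f).natDegree = 2 * n - 2 ∧
  (∀ z : ℂ, Polynomial.aeval z (wronskian' f) = 0 → Polynomial.aeval z f.denom ≠ 0) ∧
  {w : ℂ | ∃ z : ℂ, Polynomial.aeval z (wronskian' f) = 0 ∧
      Polynomial.aeval z f.num / Polynomial.aeval z f.denom = w} = Complex.ofReal '' Cv

/-- The Wronskian `p′q − pq′` of a pair of polynomials. -/
noncomputable def wr (p q : ℝ[X]) : ℝ[X] := derivative p * q - p * derivative q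

/-- The degree-`n` homogeneous substitution `X ↦ (aX+b)/(cX+d)`, with denominators cleared. -/
noncomputable def mobSubst (n : ℕ) (a b c d : ℝ) (p : ℝ[X]) : ℝ[X] :=
  ∑ k ∈ Finset.range (n + 1), C (p.coeff k) * ((C a * X + C b) ^ k * (C c * X + C d) ^ (n - k))

theorem natDegree_mobSubst_le (n : ℕ) (a b c d : ℝ) (p : ℝ[X]) :
    (mobSubst n a b c d p).natDegree ≤ n := by
  refine natDegree_sum_le_of_forall_le _ _ fun k hk => ?_
  have hk' : k ≤ n := Nat.lt_succ_iff.1 (Finset.mem_range.1 hk)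
  refine (natDegree_C_mul_le _ _).trans (natDegree_mul_le.trans ?_)
  have h1 : ((C a * X + C b : ℝ[X]) ^ k).natDegree ≤ k * 1 :=
    natDegree_pow_le_of_le k (natDegree_linear_le)
  have h2 : ((C c * X + C d : ℝ[X]) ^ (n - k)).natDegree ≤ (n - k) * 1 :=
    natDegree_pow_le_of_le _ (natDegree_linear_le)
  omega

theorem eval_mobSubst {n : ℕ} {a b c d : ℝ} {p : ℝ[X]} (hp : p.natDegree ≤ n) {y : ℝ}
    (hy : c * y + d ≠ 0) :
    (mobSubst n a b c d p).eval y = (c * y + d) ^ n * p.eval ((a * y + b) / (c * y + d)) := by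
  rw [eval_eq_sum_range' (Nat.lt_succ_of_le hp), mobSubst, eval_finsetSum, Finset.mul_sum]
  refine Finset.sum_congr rfl fun k hk => ?_
  have hk' : k ≤ n := Nat.lt_succ_iff.1 (Finset.mem_range.1 hk)
  obtain ⟨m, rfl⟩ := Nat.exists_eq_add_of_le hk'
  simp only [eval_mul, eval_C, eval_pow, eval_add, eval_X, Nat.add_sub_cancel_left]
  generalize c * y + d = u at hy
  rw [div_pow, pow_add]
  field_simp

theorem eval_mobSubst_pole {n : ℕ} {a b c d : ℝ} (p : ℝ[X]) {y : ℝ} (hy : c * y + d = 0) :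
    (mobSubst n a b c d p).eval y = p.coeff n * (a * y + b) ^ n := by
  rw [mobSubst, eval_finsetSum, Finset.sum_eq_single n]
  · simp
  · intro k hk hkn
    have : n - k ≠ 0 := by have := Finset.mem_range.1 hk; omega
    simp [hy, this]
  · simp

theorem finite_linear_eq_zero {a b c d : ℝ} (h : a * d - b * c ≠ 0) :
    {y : ℝ | c * y + d = 0}.Finite := by
  refine Set.Subsingleton.finite fun y hy z hz => ?_
  simp only [Set.mem_ofPred_eq] at hy hz
  by_cases hc : c = 0
  · subst hc; exfalso; apply h; have : d = 0 := by linarith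
    simp [this]
  · exact mul_left_cancel₀ hc (by linarith)

theorem eq_of_eval_eq_off_finite {p q : ℝ[X]} {s : Set ℝ} (hs : s.Finite)
    (h : ∀ y, y ∉ s → p.eval y = q.eval y) : p = q :=
  eq_of_infinite_eval_eq p q (hs.infinite_compl.mono fun y hy => h y hy)

theorem natDegree_wr_le {n : ℕ} {p q : ℝ[X]} (hp : p.natDegree ≤ n + 1) (hq : q.natDegree ≤ n + 1) :
    (wr p q).natDegree ≤ 2 * n := by
  rw [natDegree_le_iff_coeff_eq_zero]
  intro k hk
  have hd : ∀ r : ℝ[X], r.natDegree ≤ n + 1 → (derivative r).natDegree ≤ n := fun r hr =>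
    (natDegree_derivative_le r).trans (by omega)
  rcases Nat.lt_or_ge (2 * n + 1) k with h | h
  · rw [wr, coeff_sub, coeff_eq_zero_of_natDegree_lt, coeff_eq_zero_of_natDegree_lt, sub_zero]
    · exact lt_of_le_of_lt (natDegree_mul_le.trans (add_le_add hp (hd q hq))) (by omega)
    · exact lt_of_le_of_lt (natDegree_mul_le.trans (add_le_add (hd p hp) hq)) (by omega)
  · obtain rfl : k = n + (n + 1) := by omega
    rw [wr, coeff_sub, coeff_mul_add_eq_of_natDegree_le (hd p hp) hq, add_comm n (n + 1),
      coeff_mul_add_eq_of_natDegree_le hp (hd q hq), coeff_derivative, coeff_derivative]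
    ring

theorem eval_wr (p q : ℝ[X]) (x : ℝ) :
    (wr p q).eval x = (derivative p).eval x * q.eval x - p.eval x * (derivative q).eval x := by
  simp [wr]

theorem eval_derivative_eq {p : ℝ[X]} {f : ℝ → ℝ} {f' y : ℝ} (hf : HasDerivAt f f' y)
    (h : ∀ᶠ z in nhds y, p.eval z = f z) : (derivative p).eval y = f' :=
  (p.hasDerivAt y).unique (hf.congr_of_eventuallyEq h)

theorem hasDerivAt_moebius {a b c d y : ℝ} (hy : c * y + d ≠ 0) :
    HasDerivAt (fun y => (a * y + b) / (c * y + d)) ((a * d - b * c) / (c * y + d) ^ 2) y := by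
  have h1 : HasDerivAt (fun y : ℝ => a * y + b) a y := by
    simpa using ((hasDerivAt_id y).const_mul a).add_const b
  have h2 : HasDerivAt (fun y : ℝ => c * y + d) c y := by
    simpa using ((hasDerivAt_id y).const_mul c).add_const d
  exact (h1.div h2 hy).congr_deriv (by ring)

theorem eventually_linear_ne_zero {c d y : ℝ} (hy : c * y + d ≠ 0) :
    ∀ᶠ z in nhds y, c * z + d ≠ 0 :=
  (by fun_prop : Continuous fun z : ℝ => c * z + d).continuousAt.eventually_ne hy

theorem eval_derivative_mobSubst {n : ℕ} {a b c d : ℝ} {p : ℝ[X]} (hp : p.natDegree ≤ n) {y : ℝ}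
    (hy : c * y + d ≠ 0) :
    (derivative (mobSubst n a b c d p)).eval y =
      n * (c * y + d) ^ (n - 1) * c * p.eval ((a * y + b) / (c * y + d)) +
      (c * y + d) ^ n * ((derivative p).eval ((a * y + b) / (c * y + d)) *
        ((a * d - b * c) / (c * y + d) ^ 2)) := by
  have h2 : HasDerivAt (fun y : ℝ => c * y + d) c y := by
    simpa using ((hasDerivAt_id y).const_mul c).add_const d
  refine eval_derivative_eq
    ((h2.pow n).mul ((p.hasDerivAt _).comp y (hasDerivAt_moebius (a := a) (b := b) hy))) ?_
  filter_upwards [eventually_linear_ne_zero hy] with z hz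
  simp [eval_mobSubst hp hz]

theorem eval_wr_mobSubst {a b c d : ℝ} {p q : ℝ[X]} (hp : p.natDegree ≤ 4) (hq : q.natDegree ≤ 4)
    {y : ℝ} (hy : c * y + d ≠ 0) :
    (wr (mobSubst 4 a b c d p) (mobSubst 4 a b c d q)).eval y =
      (a * d - b * c) * (c * y + d) ^ 6 * (wr p q).eval ((a * y + b) / (c * y + d)) := by
  rw [eval_wr, eval_wr, eval_derivative_mobSubst hp hy, eval_derivative_mobSubst hq hy,
    eval_mobSubst hp hy, eval_mobSubst hq hy]
  field_simp
  ring

theorem wr_mobSubst {a b c d : ℝ} (hdet : a * d - b * c ≠ 0) {p q : ℝ[X]} (hp : p.natDegree ≤ 4)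
    (hq : q.natDegree ≤ 4) :
    wr (mobSubst 4 a b c d p) (mobSubst 4 a b c d q) =
      C (a * d - b * c) * mobSubst 6 a b c d (wr p q) := by
  refine eq_of_eval_eq_off_finite (finite_linear_eq_zero hdet) fun y hy => ?_
  rw [eval_wr_mobSubst hp hq hy, eval_mul, eval_C, eval_mobSubst (natDegree_wr_le hp hq) hy]
  ring

/-- A pair `(p, q)` of polynomials of degree at most `4` whose Wronskian has the six real
roots `x 0 < ⋯ < x 5` and leading coefficient `κ`, the quotient `p / q` taking the value `v i`
at `x i`. -/
structure Marked (p q : ℝ[X]) (x v : Fin 6 → ℝ) (κ : ℝ) : Prop where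
  degp : p.natDegree ≤ 4
  degq : q.natDegree ≤ 4
  mono : StrictMono x
  kap : κ ≠ 0
  wr_eq : wr p q = C κ * ∏ i, (X - C (x i))
  val : ∀ i, p.eval (x i) = v i * q.eval (x i)
  ne : ∀ i, q.eval (x i) ≠ 0

/-- The `i`-th of the six open arcs into which the points `x 0 < ⋯ < x 5` cut the projective
line; the point at infinity is left out of the last one. -/
def arc (x : Fin 6 → ℝ) (i : Fin 6) : Set ℝ :=
  {z | if i = 5 then x 5 < z ∨ z < x 0 else x i < z ∧ z < x (i + 1)}

/-- Whether the Wronskian is positive on the `i`-th arc, `e` telling its sign on the last one. -/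
def up (i : Fin 6) (e : Bool) : Bool := if i.val % 2 = 1 then e else !e

/-- The real sign attached to a Boolean. -/
def sg (b : Bool) : ℝ := if b then 1 else -1

/-- The point `y` lies above exactly those `c j` with `j ≤ g`. -/
def InGap (c : Fin 6 → ℝ) (g : Fin 6) (y : ℝ) : Prop :=
  ∀ j, if j ≤ g then c j < y else y < c j

/-- The arc of values going up from the `m`-th to the `n`-th one, possibly through infinity,
covers the `g`-th gap. -/
def coversUp (m n g : Fin 6) : Bool :=
  (decide (m ≤ g) && decide (g < n)) || (decide (n < m) && (decide (m ≤ g) || decide (g < n)))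

/-- The image of the `i`-th arc covers the `g`-th gap. -/
def covers (l : Fin 6 → Fin 6) (e : Bool) (i g : Fin 6) : Bool :=
  if up i e then coversUp (l i) (l (i + 1)) g else coversUp (l (i + 1)) (l i) g

/-- The arcs whose images cover the `g`-th gap. -/
def coverSet (l : Fin 6 → Fin 6) (e : Bool) (g : Fin 6) : Finset (Fin 6) :=
  Finset.univ.filter fun i => covers l e i g = true

theorem eq_of_mem_arc {x : Fin 6 → ℝ} (hx : StrictMono x) {i j : Fin 6} {z : ℝ}
    (hi : z ∈ arc x i) (hj : z ∈ arc x j) : i = j := by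
  have h01 := hx (show (0 : Fin 6) < 1 by decide)
  have h12 := hx (show (1 : Fin 6) < 2 by decide)
  have h23 := hx (show (2 : Fin 6) < 3 by decide)
  have h34 := hx (show (3 : Fin 6) < 4 by decide)
  have h45 := hx (show (4 : Fin 6) < 5 by decide)
  fin_cases i <;> fin_cases j <;> simp [arc] at hi hj ⊢ <;> grind

theorem sg_mul_wr_pos {p q : ℝ[X]} {x v : Fin 6 → ℝ} {κ : ℝ} (h : Marked p q x v κ) {e : Bool}
    (he : 0 < κ ↔ e = true) {i : Fin 6} {z : ℝ} (hz : z ∈ arc x i) :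
    0 < sg (up i e) * (wr p q).eval z := by
  have h01 := h.mono (show (0 : Fin 6) < 1 by decide)
  have h12 := h.mono (show (1 : Fin 6) < 2 by decide)
  have h23 := h.mono (show (2 : Fin 6) < 3 by decide)
  have h34 := h.mono (show (3 : Fin 6) < 4 by decide)
  have h45 := h.mono (show (4 : Fin 6) < 5 by decide)
  have key : 0 < sg e * κ := by
    cases e
    · have : κ < 0 := lt_of_le_of_ne (not_lt.1 (by simp [he])) h.kap
      simpa [sg] using this
    · simpa [sg] using he.2 rfl
  have hu : sg (up i e) = (if i.val % 2 = 1 then 1 else -1) * sg e := by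
    cases e <;> by_cases hi : i.val % 2 = 1 <;> simp [up, sg, hi]
  rw [hu, h.wr_eq]
  simp only [eval_mul, eval_C, eval_sub, eval_X, Fin.prod_univ_six]
  suffices 0 < (if i.val % 2 = 1 then (1 : ℝ) else -1) *
      ((z - x 0) * (z - x 1) * (z - x 2) * (z - x 3) * (z - x 4) * (z - x 5)) by
    have := mul_pos key this
    linarith
  have main : ∀ a0 a1 a2 a3 a4 a5 : ℝ, 0 < a0 → 0 < a1 → 0 < a2 → 0 < a3 → 0 < a4 → 0 < a5 →
      0 < a0 * a1 * a2 * a3 * a4 * a5 := fun a0 a1 a2 a3 a4 a5 _ _ _ _ _ _ => by positivity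
  fin_cases i <;> simp [arc] at hz ⊢
  · have := main (z - x 0) (x 1 - z) (x 2 - z) (x 3 - z) (x 4 - z) (x 5 - z) (by linarith)
      (by linarith) (by linarith) (by linarith) (by linarith) (by linarith)
    linarith
  · have := main (z - x 0) (z - x 1) (x 2 - z) (x 3 - z) (x 4 - z) (x 5 - z) (by linarith)
      (by linarith) (by linarith) (by linarith) (by linarith) (by linarith)
    linarith
  · have := main (z - x 0) (z - x 1) (z - x 2) (x 3 - z) (x 4 - z) (x 5 - z) (by linarith)
      (by linarith) (by linarith) (by linarith) (by linarith) (by linarith)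
    linarith
  · have := main (z - x 0) (z - x 1) (z - x 2) (z - x 3) (x 4 - z) (x 5 - z) (by linarith)
      (by linarith) (by linarith) (by linarith) (by linarith) (by linarith)
    linarith
  · have := main (z - x 0) (z - x 1) (z - x 2) (z - x 3) (z - x 4) (x 5 - z) (by linarith)
      (by linarith) (by linarith) (by linarith) (by linarith) (by linarith)
    linarith
  · rcases hz with hz | hz
    · exact main (z - x 0) (z - x 1) (z - x 2) (z - x 3) (z - x 4) (z - x 5) (by linarith)
        (by linarith) (by linarith) (by linarith) (by linarith) (by linarith)
    · have := main (x 0 - z) (x 1 - z) (x 2 - z) (x 3 - z) (x 4 - z) (x 5 - z) (by linarith)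
        (by linarith) (by linarith) (by linarith) (by linarith) (by linarith)
      linarith

theorem hasDerivAt_div_sub {p q : ℝ[X]} {s y z : ℝ} (hz : p.eval z ≠ y * q.eval z) :
    HasDerivAt (fun z => s * q.eval z / (p.eval z - y * q.eval z))
      (-(s * (wr p q).eval z) / (p.eval z - y * q.eval z) ^ 2) z := by
  refine (((q.hasDerivAt z).const_mul s).div
    ((p.hasDerivAt z).sub ((q.hasDerivAt z).const_mul y)) (sub_ne_zero.2 hz)).congr_deriv ?_
  rw [eval_wr]
  simp only [Pi.sub_apply]
  ring

theorem strictAntiOn_div_sub {p q : ℝ[X]} {s y : ℝ} {t : Set ℝ} (ht : Convex ℝ t)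
    (hW : ∀ z ∈ interior t, 0 < s * (wr p q).eval z) (hR : ∀ z ∈ t, p.eval z ≠ y * q.eval z) :
    StrictAntiOn (fun z => s * q.eval z / (p.eval z - y * q.eval z)) t := by
  refine strictAntiOn_of_deriv_neg ht
    (fun z hz => (hasDerivAt_div_sub (hR z hz)).continuousAt.continuousWithinAt) fun z hz => ?_
  have hz' := hR z (interior_subset hz)
  rw [(hasDerivAt_div_sub hz').deriv]
  have := hW z hz
  have := sub_ne_zero.2 hz'
  exact div_neg_of_neg_of_pos (by linarith) (by positivity)

theorem div_sub_eq {p q : ℝ[X]} {s y a va : ℝ} (ha : p.eval a = va * q.eval a)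
    (hq : q.eval a ≠ 0) : s * q.eval a / (p.eval a - y * q.eval a) = s * (va - y)⁻¹ := by
  rw [ha, ← sub_mul, mul_div_mul_right _ _ hq, div_eq_mul_inv]

theorem exists_root_between {p q : ℝ[X]} {a b va vb y s : ℝ} (hab : a < b)
    (hW : ∀ z ∈ Set.Ioo a b, 0 < s * (wr p q).eval z) (ha : p.eval a = va * q.eval a)
    (hb : p.eval b = vb * q.eval b) (hqa : q.eval a ≠ 0) (hqb : q.eval b ≠ 0) (hva : va ≠ y)
    (hvb : vb ≠ y) (h : s * (va - y)⁻¹ ≤ s * (vb - y)⁻¹) :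
    ∃ z ∈ Set.Ioo a b, p.eval z = y * q.eval z := by
  by_contra! hcon
  have hR : ∀ z ∈ Set.Icc a b, p.eval z ≠ y * q.eval z := by
    intro z hz
    rcases eq_or_lt_of_le hz.1 with rfl | h1
    · rw [ha]; exact fun h => hva (mul_right_cancel₀ hqa h)
    rcases eq_or_lt_of_le hz.2 with rfl | h2
    · rw [hb]; exact fun h => hvb (mul_right_cancel₀ hqb h)
    exact hcon z ⟨h1, h2⟩
  have := strictAntiOn_div_sub (convex_Icc a b) (by rwa [interior_Icc]) hR
    (Set.left_mem_Icc.2 hab.le) (Set.right_mem_Icc.2 hab.le) hab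
  simp only [div_sub_eq ha hqa, div_sub_eq hb hqb] at this
  linarith

theorem tendsto_div_coeff {n : ℕ} {q r : ℝ[X]} (hq : q.natDegree ≤ n) (hr : r.natDegree ≤ n)
    (h : r.coeff n ≠ 0) :
    Filter.Tendsto (fun z => q.eval z / r.eval z) Filter.atTop
        (nhds (q.coeff n / r.coeff n)) ∧
      Filter.Tendsto (fun z => q.eval z / r.eval z) Filter.atBot
        (nhds (q.coeff n / r.coeff n)) := by
  have hrn : r.natDegree = n := le_antisymm hr (le_natDegree_of_ne_zero h)
  have hr0 : r ≠ 0 := fun h0 => h (by simp [h0])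
  have hdr : r.degree = n := by rw [degree_eq_natDegree hr0, hrn]
  by_cases hc : q.coeff n = 0
  · have hlt : q.degree < r.degree := by
      rw [hdr]
      exact lt_of_le_of_ne (degree_le_of_natDegree_le hq) fun hd =>
        coeff_ne_zero_of_eq_degree hd hc
    rw [hc, zero_div]
    exact ⟨div_tendsto_atTop_zero_of_degree_lt _ _ hlt, div_tendsto_atBot_zero_of_degree_lt _ _ hlt⟩
  · have hqn : q.natDegree = n := le_antisymm hq (le_natDegree_of_ne_zero hc)
    have hq0 : q ≠ 0 := fun h0 => hc (by simp [h0])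
    have hdq : q.degree = n := by rw [degree_eq_natDegree hq0, hqn]
    have h1 := div_tendsto_atTop_leadingCoeff_div_of_degree_eq q r (hdq.trans hdr.symm)
    have h2 := div_tendsto_atBot_leadingCoeff_div_of_degree_eq q r (hdq.trans hdr.symm)
    rw [leadingCoeff, leadingCoeff, hqn, hrn] at h1 h2
    exact ⟨h1, h2⟩

theorem exists_root_outer {p q : ℝ[X]} {a b va vb y s : ℝ} (hp : p.natDegree ≤ 4)
    (hq : q.natDegree ≤ 4) (hab : b < a)
    (hWa : ∀ z ∈ Set.Ioi a, 0 < s * (wr p q).eval z)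
    (hWb : ∀ z ∈ Set.Iio b, 0 < s * (wr p q).eval z) (ha : p.eval a = va * q.eval a)
    (hb : p.eval b = vb * q.eval b) (hqa : q.eval a ≠ 0) (hqb : q.eval b ≠ 0) (hva : va ≠ y)
    (hvb : vb ≠ y) (h : s * (va - y)⁻¹ ≤ s * (vb - y)⁻¹) (hy : p.coeff 4 ≠ y * q.coeff 4) :
    ∃ z, (a < z ∨ z < b) ∧ p.eval z = y * q.eval z := by
  by_contra! hcon
  have hRa : ∀ z ∈ Set.Ici a, p.eval z ≠ y * q.eval z := by
    intro z hz
    rcases eq_or_lt_of_le (Set.mem_Ici.1 hz) with rfl | h1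
    · rw [ha]; exact fun h => hva (mul_right_cancel₀ hqa h)
    exact hcon z (Or.inl h1)
  have hRb : ∀ z ∈ Set.Iic b, p.eval z ≠ y * q.eval z := by
    intro z hz
    rcases eq_or_lt_of_le (Set.mem_Iic.1 hz) with rfl | h1
    · rw [hb]; exact fun h => hvb (mul_right_cancel₀ hqb h)
    exact hcon z (Or.inr h1)
  have hanti_a := strictAntiOn_div_sub (convex_Ici a) (by rwa [interior_Ici]) hRa
  have hanti_b := strictAntiOn_div_sub (convex_Iic b) (by rwa [interior_Iic]) hRb
  have hd : (p - C y * q).natDegree ≤ 4 :=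
    natDegree_sub_le_of_le hp ((natDegree_C_mul_le _ _).trans hq)
  have hc : (p - C y * q).coeff 4 ≠ 0 := by
    rw [coeff_sub, coeff_C_mul]; exact sub_ne_zero.2 hy
  have hds : (C s * q).natDegree ≤ 4 := (natDegree_C_mul_le _ _).trans hq
  obtain ⟨t1, t2⟩ := tendsto_div_coeff hds hd hc
  simp only [eval_sub, eval_mul, eval_C] at t1 t2
  have l1 : _ ≤ s * q.eval (a + 1) / (p.eval (a + 1) - y * q.eval (a + 1)) :=
    le_of_tendsto t1 <| (Filter.eventually_ge_atTop (a + 1)).mono fun z hz =>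
      hanti_a.antitoneOn (by simp) (by simp; linarith) hz
  have l2 : s * q.eval (b - 1) / (p.eval (b - 1) - y * q.eval (b - 1)) ≤ _ :=
    ge_of_tendsto t2 <| (Filter.eventually_le_atBot (b - 1)).mono fun z hz =>
      hanti_b.antitoneOn (by simp; linarith) (by simp) hz
  have l3 := hanti_a (Set.self_mem_Ici) (by simp : a + 1 ∈ Set.Ici a) (by linarith)
  have l4 := hanti_b (by simp : b - 1 ∈ Set.Iic b) (Set.self_mem_Iic) (by linarith)
  simp only [div_sub_eq ha hqa, div_sub_eq hb hqb] at l3 l4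
  linarith

theorem card_le_of_roots {ι : Type*} {r : ℝ[X]} {n : ℕ} (hr : r ≠ 0) (hd : r.natDegree ≤ n)
    (s : Finset ι) (f : ι → ℝ) (hf : Set.InjOn f s) (hroot : ∀ i ∈ s, r.eval (f i) = 0) :
    s.card ≤ n := by
  classical
  rw [← Finset.card_image_of_injOn hf]
  refine (Finset.card_le_card (t := r.roots.toFinset) fun z hz => ?_).trans
    ((Multiset.toFinset_card_le _).trans ((card_roots' r).trans hd))
  obtain ⟨i, hi, rfl⟩ := Finset.mem_image.1 hz
  simpa [hr] using hroot i hi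

theorem inv_sub_le_of_coversUp {c : Fin 6 → ℝ} {m n g : Fin 6} {y : ℝ}
    (hy : InGap c g y) (hc : StrictMono c) (h : coversUp m n g = true) :
    (c m - y)⁻¹ ≤ (c n - y)⁻¹ := by
  have hm := hy m
  have hn := hy n
  simp only [coversUp, Bool.or_eq_true, Bool.and_eq_true, decide_eq_true_eq] at h
  rcases h with ⟨h1, h2⟩ | ⟨h1, h2 | h2⟩
  · rw [if_pos h1] at hm
    rw [if_neg (not_le.2 h2)] at hn
    exact (inv_lt_zero.2 (by linarith)).le.trans (inv_pos.2 (by linarith)).le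
  · have := hc h1
    rw [if_pos h2] at hm
    exact (inv_le_inv_of_neg (by linarith) (by linarith)).2 (by linarith)
  · have := hc h1
    rw [if_neg (not_le.2 h2)] at hn
    exact (inv_le_inv₀ (by linarith) (by linarith)).2 (by linarith)

theorem InGap.ne {c : Fin 6 → ℝ} {g : Fin 6} {y : ℝ} (hy : InGap c g y) (j : Fin 6) :
    c j ≠ y := by
  have := hy j
  split_ifs at this
  · exact this.ne
  · exact this.ne'

theorem sg_mul_inv_le {c : Fin 6 → ℝ} {l : Fin 6 → Fin 6} {e : Bool} {i g : Fin 6} {y : ℝ}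
    (hy : InGap c g y) (hc : StrictMono c) (h : covers l e i g = true) :
    sg (up i e) * (c (l i) - y)⁻¹ ≤ sg (up i e) * (c (l (i + 1)) - y)⁻¹ := by
  unfold covers at h
  unfold sg
  split_ifs at h ⊢ with hu
  · simpa using inv_sub_le_of_coversUp hy hc h
  · simpa using inv_sub_le_of_coversUp hy hc h

theorem mem_arc_of_ne_five {x : Fin 6 → ℝ} {i : Fin 6} (hi : i ≠ 5) {z : ℝ} :
    z ∈ arc x i ↔ x i < z ∧ z < x (i + 1) := by
  simp [arc, hi]

theorem mem_arc_five {x : Fin 6 → ℝ} {z : ℝ} : z ∈ arc x 5 ↔ x 5 < z ∨ z < x 0 := by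
  simp [arc]

theorem lt_add_one_of_ne_five {i : Fin 6} (hi : i ≠ 5) : i < i + 1 := by
  revert hi; revert i; decide

theorem add_one_le_of_not_le {g j : Fin 6} (hg : g ≠ 5) (hj : ¬ j ≤ g) : g + 1 ≤ j := by
  revert hg hj; revert g j; decide

/-- In an arc whose image covers the gap containing `y`, the value `y` is taken; the arc may
be shrunk to any subarc with the same boundary behaviour. -/
theorem exists_root_arc {p q : ℝ[X]} {x c : Fin 6 → ℝ} {l : Fin 6 → Fin 6} {κ : ℝ} {e : Bool}
    (h : Marked p q x (c ∘ l) κ) (he : 0 < κ ↔ e = true) (hc : StrictMono c) {i g : Fin 6}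
    {y : ℝ} (hy : InGap c g y) (hy4 : p.coeff 4 ≠ y * q.coeff 4) (hi : covers l e i g = true) :
    ∃ z ∈ arc x i, p.eval z = y * q.eval z := by
  by_cases h5 : i = 5
  · subst h5
    obtain ⟨z, hz, hz'⟩ := exists_root_outer h.degp h.degq
      (h.mono (show (0 : Fin 6) < 5 by decide))
      (fun z hz => sg_mul_wr_pos h he (mem_arc_five.2 (Or.inl hz)))
      (fun z hz => sg_mul_wr_pos h he (mem_arc_five.2 (Or.inr hz)))
      (h.val 5) (h.val 0) (h.ne 5) (h.ne 0) (hy.ne _) (hy.ne _) (sg_mul_inv_le hy hc hi) hy4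
    exact ⟨z, mem_arc_five.2 hz, hz'⟩
  · obtain ⟨z, hz, hz'⟩ := exists_root_between (h.mono (lt_add_one_of_ne_five h5))
      (fun z hz => sg_mul_wr_pos h he ((mem_arc_of_ne_five h5).2 hz))
      (h.val i) (h.val _) (h.ne i) (h.ne _) (hy.ne _) (hy.ne _) (sg_mul_inv_le hy hc hi)
    exact ⟨z, (mem_arc_of_ne_five h5).2 hz, hz'⟩

theorem Marked.wr_coeff {p q : ℝ[X]} {x v : Fin 6 → ℝ} {κ : ℝ} (h : Marked p q x v κ) :
    (wr p q).coeff 6 = κ := by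
  have h1 : (∏ i, (X - C (x i))).natDegree = 6 := by
    rw [natDegree_prod_of_monic _ _ fun i _ => monic_X_sub_C _]; simp
  have h2 : (∏ i, (X - C (x i))).Monic := monic_prod_of_monic _ _ fun i _ => monic_X_sub_C _
  have h3 : (∏ i, (X - C (x i))).coeff 6 = 1 := by simpa only [h1] using h2.coeff_natDegree
  rw [h.wr_eq, coeff_C_mul, h3, mul_one]

theorem Marked.coeff_ne {p q : ℝ[X]} {x v : Fin 6 → ℝ} {κ : ℝ} (h : Marked p q x v κ) :
    ¬ (p.coeff 4 = 0 ∧ q.coeff 4 = 0) := by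
  rintro ⟨h1, h2⟩
  have hd : ∀ r : ℝ[X], r.natDegree ≤ 4 → r.coeff 4 = 0 → r.natDegree ≤ 2 + 1 := fun r hr h0 => by
    rcases hr.lt_or_eq with h | h
    · omega
    · have : r.leadingCoeff = 0 := by rw [leadingCoeff, h, h0]
      simp [leadingCoeff_eq_zero.1 this]
  have := natDegree_wr_le (hd p h.degp h1) (hd q h.degq h2)
  exact h.kap (by rw [← h.wr_coeff, coeff_eq_zero_of_natDegree_lt (by omega)])

theorem exists_inGap {c : Fin 6 → ℝ} (hc : StrictMono c) (g : Fin 6) {a b : ℝ}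
    (hab : ¬ (a = 0 ∧ b = 0)) : ∃ y, InGap c g y ∧ a ≠ y * b := by
  have main : ∃ u v, u < v ∧ InGap c g u ∧ InGap c g v := by
    by_cases h5 : g = 5
    · subst h5
      have : ∀ j, c j ≤ c 5 := fun j => hc.monotone (Fin.le_last j)
      have h5 : ∀ j : Fin 6, j ≤ 5 := fun j => Fin.le_last j
      refine ⟨c 5 + 1, c 5 + 2, by linarith, fun j => ?_, fun j => ?_⟩ <;>
        · rw [if_pos (h5 j)]; linarith [this j]
    · have hlt := hc (lt_add_one_of_ne_five h5)
      have key : ∀ u, c g < u → u < c (g + 1) → InGap c g u := by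
        intro u h1 h2 j
        split_ifs with hj
        · exact (hc.monotone hj).trans_lt h1
        · exact h2.trans_le (hc.monotone (add_one_le_of_not_le h5 hj))
      exact ⟨(2 * c g + c (g + 1)) / 3, (c g + 2 * c (g + 1)) / 3, by linarith,
        key _ (by linarith) (by linarith), key _ (by linarith) (by linarith)⟩
  obtain ⟨u, v, huv, hu, hv⟩ := main
  by_cases h1 : a = u * b
  · refine ⟨v, hv, fun h2 => hab ?_⟩
    have hb : b = 0 := by
      have : (v - u) * b = 0 := by linarith
      rcases mul_eq_zero.1 this with h | h
      · linarith
      · exact h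
    exact ⟨by simp [h1, hb], hb⟩
  · exact ⟨u, hu, h1⟩

theorem coverSet_card_le {p q : ℝ[X]} {x c : Fin 6 → ℝ} {l : Fin 6 → Fin 6} {κ : ℝ} {e : Bool}
    (h : Marked p q x (c ∘ l) κ) (he : 0 < κ ↔ e = true) (hc : StrictMono c) (g : Fin 6) :
    (coverSet l e g).card ≤ 4 := by
  obtain ⟨y, hy, hy4⟩ := exists_inGap hc g h.coeff_ne
  have hroot : ∀ i : Fin 6, ∃ z, i ∈ coverSet l e g → z ∈ arc x i ∧ p.eval z = y * q.eval z := by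
    intro i
    by_cases hi : i ∈ coverSet l e g
    · obtain ⟨z, h1, h2⟩ := exists_root_arc h he hc hy hy4 (Finset.mem_filter.1 hi).2
      exact ⟨z, fun _ => ⟨h1, h2⟩⟩
    · exact ⟨0, fun h => absurd h hi⟩
  choose r hr using hroot
  refine card_le_of_roots (r := p - C y * q) (fun h0 => hy4 ?_)
    (natDegree_sub_le_of_le h.degp ((natDegree_C_mul_le _ _).trans h.degq)) _ r
    (fun i hi j hj hij => ?_) fun i hi => ?_
  · have := congrArg (fun s => coeff s 4) h0
    simpa [sub_eq_zero] using this
  · have := (hr j hj).1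
    rw [← hij] at this
    exact eq_of_mem_arc h.mono (hr i hi).1 this
  · simp [(hr i hi).2]

/-- If the covers of some gap already account for four preimages, there is no room for an extra
one in any arc. -/
theorem no_extra_root {p q : ℝ[X]} {x c : Fin 6 → ℝ} {l : Fin 6 → Fin 6} {κ : ℝ} {e : Bool}
    (h : Marked p q x (c ∘ l) κ) (he : 0 < κ ↔ e = true) (hc : StrictMono c) {g : Fin 6}
    (hg : (coverSet l e g).card = 4) {y : ℝ} (hy : InGap c g y) (hy4 : p.coeff 4 ≠ y * q.coeff 4)
    {j : Fin 6} {z : ℝ} (hz : z ∈ arc x j) (hzy : p.eval z = y * q.eval z)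
    (hj : covers l e j g = true → ∃ w ∈ arc x j, w ≠ z ∧ p.eval w = y * q.eval w) : False := by
  have hroot : ∀ i : Fin 6, ∃ w, i ∈ coverSet l e g →
      w ∈ arc x i ∧ p.eval w = y * q.eval w ∧ w ≠ z := by
    intro i
    by_cases hi : i ∈ coverSet l e g
    · by_cases hij : i = j
      · subst hij
        obtain ⟨w, h1, h2, h3⟩ := hj (Finset.mem_filter.1 hi).2
        exact ⟨w, fun _ => ⟨h1, h3, h2⟩⟩
      · obtain ⟨w, h1, h2⟩ := exists_root_arc h he hc hy hy4 (Finset.mem_filter.1 hi).2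
        exact ⟨w, fun _ => ⟨h1, h2, fun hwz => hij (eq_of_mem_arc h.mono h1 (hwz ▸ hz))⟩⟩
    · exact ⟨0, fun h => absurd h hi⟩
  choose r hr using hroot
  have := card_le_of_roots (r := p - C y * q) (n := 4) (fun h0 => hy4 ?_)
    (natDegree_sub_le_of_le h.degp ((natDegree_C_mul_le _ _).trans h.degq))
    (Finset.insertNone (coverSet l e g)) (fun o => o.elim z r) ?_ ?_
  · rw [Finset.card_insertNone, hg] at this
    omega
  · have := congrArg (fun s => coeff s 4) h0
    simpa [sub_eq_zero] using this
  · rintro (_ | i) hi (_ | k) hk hik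
    · rfl
    · exact absurd hik.symm (hr k (by simpa using hk)).2.2
    · exact absurd hik (hr i (by simpa using hi)).2.2
    · have h1 := hr i (by simpa using hi)
      have h2 := hr k (by simpa using hk)
      simp only [Option.elim_some] at hik
      rw [← hik] at h2
      rw [eq_of_mem_arc h.mono h1.1 h2.1]
  · rintro (_ | i) hi
    · simp [hzy]
    · simp [(hr i (by simpa using hi)).2.1]

theorem Marked.q_ne_zero_of_eq {p q : ℝ[X]} {x v : Fin 6 → ℝ} {κ : ℝ} (h : Marked p q x v κ)
    {e : Bool} (he : 0 < κ ↔ e = true) {i : Fin 6} {z w : ℝ} (hz : z ∈ arc x i)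
    (hw : p.eval z = w * q.eval z) : q.eval z ≠ 0 := by
  intro h0
  have := sg_mul_wr_pos h he hz
  rw [eval_wr, hw, h0] at this
  simp at this

/-- After a critical point the critical value is not taken again before the next one. -/
theorem no_return_right {p q : ℝ[X]} {x c : Fin 6 → ℝ} {l : Fin 6 → Fin 6} {κ : ℝ} {e : Bool}
    (h : Marked p q x (c ∘ l) κ) (he : 0 < κ ↔ e = true) (hc : StrictMono c) {g : Fin 6}
    (hg : (coverSet l e g).card = 4) {j : Fin 6} {z : ℝ} (hz : z ∈ arc x j) (hzj : x j < z) :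
    p.eval z ≠ c (l j) * q.eval z := by
  intro hzv
  have hqz := h.q_ne_zero_of_eq he hz hzv
  obtain ⟨y, hy, hy4⟩ := exists_inGap hc g h.coeff_ne
  have hsub : ∀ w, x j < w → w < z → w ∈ arc x j := by
    intro w h1 h2
    by_cases h5 : j = 5
    · subst h5; exact mem_arc_five.2 (Or.inl h1)
    · rw [mem_arc_of_ne_five h5] at hz ⊢
      exact ⟨h1, h2.trans hz.2⟩
  obtain ⟨r, hr, hry⟩ := exists_root_between hzj
    (fun w hw => sg_mul_wr_pos h he (hsub w hw.1 hw.2)) (h.val j) hzv (h.ne j) hqz (hy.ne _)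
    (hy.ne _) le_rfl
  refine no_extra_root h he hc hg hy hy4 (hsub r hr.1 hr.2) hry fun hcov => ?_
  by_cases h5 : j = 5
  · subst h5
    have h05 := h.mono (show (0 : Fin 6) < 5 by decide)
    obtain ⟨w, hw, hwy⟩ := exists_root_outer h.degp h.degq (h05.trans hzj)
      (fun w hw => sg_mul_wr_pos h he (mem_arc_five.2 (Or.inl (hzj.trans hw))))
      (fun w hw => sg_mul_wr_pos h he (mem_arc_five.2 (Or.inr hw)))
      hzv (h.val 0) hqz (h.ne 0) (hy.ne _) (hy.ne _) (sg_mul_inv_le hy hc hcov) hy4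
    refine ⟨w, mem_arc_five.2 (hw.imp_left hzj.trans), ?_, hwy⟩
    rintro rfl
    rcases hw with hw | hw
    · exact absurd hr.2 (not_lt.2 hw.le)
    · exact absurd (hr.1.trans hw) (not_lt.2 h05.le)
  · have hz' := (mem_arc_of_ne_five h5).1 hz
    have hsub' : ∀ w, z < w → w < x (j + 1) → w ∈ arc x j := fun w h1 h2 =>
      (mem_arc_of_ne_five h5).2 ⟨hzj.trans h1, h2⟩
    obtain ⟨w, hw, hwy⟩ := exists_root_between hz'.2
      (fun w hw => sg_mul_wr_pos h he (hsub' w hw.1 hw.2)) hzv (h.val (j + 1)) hqz (h.ne _)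
      (hy.ne _) (hy.ne _) (sg_mul_inv_le hy hc hcov)
    exact ⟨w, hsub' w hw.1 hw.2, (hr.2.trans hw.1).ne', hwy⟩

/-- Before a critical point the critical value is not taken after the previous one. -/
theorem no_return_left {p q : ℝ[X]} {x c : Fin 6 → ℝ} {l : Fin 6 → Fin 6} {κ : ℝ} {e : Bool}
    (h : Marked p q x (c ∘ l) κ) (he : 0 < κ ↔ e = true) (hc : StrictMono c) {g : Fin 6}
    (hg : (coverSet l e g).card = 4) {j : Fin 6} (h5 : j ≠ 5) {z : ℝ} (hz : z ∈ arc x j) :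
    p.eval z ≠ c (l (j + 1)) * q.eval z := by
  intro hzv
  have hqz := h.q_ne_zero_of_eq he hz hzv
  obtain ⟨y, hy, hy4⟩ := exists_inGap hc g h.coeff_ne
  have hz' := (mem_arc_of_ne_five h5).1 hz
  have hsub : ∀ w, z < w → w < x (j + 1) → w ∈ arc x j := fun w h1 h2 =>
    (mem_arc_of_ne_five h5).2 ⟨hz'.1.trans h1, h2⟩
  have hsub' : ∀ w, x j < w → w < z → w ∈ arc x j := fun w h1 h2 =>
    (mem_arc_of_ne_five h5).2 ⟨h1, h2.trans hz'.2⟩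
  obtain ⟨r, hr, hry⟩ := exists_root_between hz'.2
    (fun w hw => sg_mul_wr_pos h he (hsub w hw.1 hw.2)) hzv (h.val (j + 1)) hqz (h.ne _) (hy.ne _)
    (hy.ne _) le_rfl
  refine no_extra_root h he hc hg hy hy4 (hsub r hr.1 hr.2) hry fun hcov => ?_
  obtain ⟨w, hw, hwy⟩ := exists_root_between hz'.1
    (fun w hw => sg_mul_wr_pos h he (hsub' w hw.1 hw.2)) (h.val j) hzv (h.ne _) hqz
    (hy.ne _) (hy.ne _) (sg_mul_inv_le hy hc hcov)
  exact ⟨w, hsub' w hw.1 hw.2, (hw.2.trans hr.1).ne, hwy⟩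

theorem eq_C_mul_prod_of_roots {n : ℕ} {w : ℝ[X]} (hw : w.natDegree ≤ n) {x : Fin n → ℝ}
    (hx : Function.Injective x) (h : ∀ i, w.eval (x i) = 0) :
    w = C (w.coeff n) * ∏ i, (X - C (x i)) := by
  rcases Nat.eq_zero_or_pos n with rfl | hn
  · simpa using eq_C_of_natDegree_le_zero hw
  have h1 : (∏ i, (X - C (x i))).natDegree = n := by
    rw [natDegree_prod_of_monic _ _ fun i _ => monic_X_sub_C _]; simp
  have h2 : (∏ i, (X - C (x i))).Monic := monic_prod_of_monic _ _ fun i _ => monic_X_sub_C _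
  have h3 : (∏ i, (X - C (x i))).coeff n = 1 := by simpa only [h1] using h2.coeff_natDegree
  by_contra hne
  have hd : (w - C (w.coeff n) * ∏ i, (X - C (x i))).natDegree ≤ n - 1 := by
    rw [natDegree_le_iff_coeff_eq_zero]
    intro k hk
    rcases Nat.lt_or_ge n k with h6 | h6
    · exact coeff_eq_zero_of_natDegree_lt (lt_of_le_of_lt
        (natDegree_sub_le_of_le hw ((natDegree_C_mul_le _ _).trans h1.le)) (by omega))
    · obtain rfl : k = n := by omega
      rw [coeff_sub, coeff_C_mul, h3]; ring
  have := card_le_of_roots (sub_ne_zero.2 hne) hd Finset.univ x hx.injOn fun i _ => by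
    rw [eval_sub, h, eval_mul, eval_prod, Finset.prod_eq_zero (Finset.mem_univ i) (by simp)]
    simp
  rw [Finset.card_univ, Fintype.card_fin] at this
  omega

theorem eval_derivative_C_mul_prod {x : Fin 6 → ℝ} {κ : ℝ} (i : Fin 6) :
    (derivative (C κ * ∏ i, (X - C (x i)))).eval (x i) =
      κ * ∏ j ∈ Finset.univ.erase i, (x i - x j) := by
  have := Lagrange.eval_nodal_derivative_eval_node_eq (v := x) (Finset.mem_univ i)
  rw [derivative_C_mul, eval_mul, eval_C, ← Lagrange.nodal_eq, this, Lagrange.eval_nodal]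

theorem prod_erase_sub_sign {x : Fin 6 → ℝ} (hx : StrictMono x) (i : Fin 6) :
    0 < (-1) ^ (i.val + 1) * ∏ j ∈ Finset.univ.erase i, (x i - x j) := by
  have h01 := hx (show (0 : Fin 6) < 1 by decide)
  have h12 := hx (show (1 : Fin 6) < 2 by decide)
  have h23 := hx (show (2 : Fin 6) < 3 by decide)
  have h34 := hx (show (3 : Fin 6) < 4 by decide)
  have h45 := hx (show (4 : Fin 6) < 5 by decide)
  have main : ∀ a0 a1 a2 a3 a4 : ℝ, 0 < a0 → 0 < a1 → 0 < a2 → 0 < a3 → 0 < a4 →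
      0 < a0 * a1 * a2 * a3 * a4 := fun a0 a1 a2 a3 a4 _ _ _ _ _ => by positivity
  fin_cases i
  · have hE : Finset.univ.erase (0 : Fin 6) = {1, 2, 3, 4, 5} := by decide
    have := main (x 1 - x 0) (x 2 - x 0) (x 3 - x 0) (x 4 - x 0) (x 5 - x 0) (by linarith)
      (by linarith) (by linarith) (by linarith) (by linarith)
    simp [hE]; linarith
  · have hE : Finset.univ.erase (1 : Fin 6) = {0, 2, 3, 4, 5} := by decide
    have := main (x 1 - x 0) (x 2 - x 1) (x 3 - x 1) (x 4 - x 1) (x 5 - x 1) (by linarith)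
      (by linarith) (by linarith) (by linarith) (by linarith)
    simp [hE]; linarith
  · have hE : Finset.univ.erase (2 : Fin 6) = {0, 1, 3, 4, 5} := by decide
    have := main (x 2 - x 0) (x 2 - x 1) (x 3 - x 2) (x 4 - x 2) (x 5 - x 2) (by linarith)
      (by linarith) (by linarith) (by linarith) (by linarith)
    simp [hE]; linarith
  · have hE : Finset.univ.erase (3 : Fin 6) = {0, 1, 2, 4, 5} := by decide
    have := main (x 3 - x 0) (x 3 - x 1) (x 3 - x 2) (x 4 - x 3) (x 5 - x 3) (by linarith)
      (by linarith) (by linarith) (by linarith) (by linarith)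
    simp [hE]; linarith
  · have hE : Finset.univ.erase (4 : Fin 6) = {0, 1, 2, 3, 5} := by decide
    have := main (x 4 - x 0) (x 4 - x 1) (x 4 - x 2) (x 4 - x 3) (x 5 - x 4) (by linarith)
      (by linarith) (by linarith) (by linarith) (by linarith)
    simp [hE]; linarith
  · have hE : Finset.univ.erase (5 : Fin 6) = {0, 1, 2, 3, 4} := by decide
    have := main (x 5 - x 0) (x 5 - x 1) (x 5 - x 2) (x 5 - x 3) (x 5 - x 4) (by linarith)
      (by linarith) (by linarith) (by linarith) (by linarith)
    simp [hE]; linarith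

/-- Transport of a marked pair by a Möbius change of the variable which permutes the marks. -/
theorem Marked.mobSubst {p q : ℝ[X]} {x v : Fin 6 → ℝ} {κ : ℝ} (h : Marked p q x v κ)
    {a b c d : ℝ} (hdet : a * d - b * c ≠ 0) {y : Fin 6 → ℝ} (hy : StrictMono y)
    (σ : Fin 6 → Fin 6) (hcd : ∀ i, c * y i + d ≠ 0)
    (hyx : ∀ i, a * y i + b = x (σ i) * (c * y i + d)) :
    ∃ κ', Marked (mobSubst 4 a b c d p) (mobSubst 4 a b c d q) y (v ∘ σ) κ' ∧
      ∀ i, 0 < κ' * κ * (-1) ^ (i.val + (σ i).val) := by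
  have hN : ∀ i, (a * y i + b) / (c * y i + d) = x (σ i) := fun i => by
    rw [hyx, mul_div_cancel_right₀ _ (hcd i)]
  set W := wr (_root_.mobSubst 4 a b c d p) (_root_.mobSubst 4 a b c d q) with hW
  have hroot : ∀ i, W.eval (y i) = 0 := fun i => by
    rw [hW, eval_wr_mobSubst h.degp h.degq (hcd i), hN, h.wr_eq, eval_mul, eval_prod,
      Finset.prod_eq_zero (Finset.mem_univ (σ i)) (by simp)]
    simp
  have hWeq : W = C (W.coeff 6) * ∏ i, (X - C (y i)) :=
    eq_C_mul_prod_of_roots (natDegree_wr_le (n := 3) (natDegree_mobSubst_le 4 a b c d p)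
    (natDegree_mobSubst_le 4 a b c d q)) hy.injective hroot
  have hsign : ∀ i, 0 < W.coeff 6 * κ * (-1) ^ (i.val + (σ i).val) := by
    intro i
    have h1 : (derivative W).eval (y i) = (a * d - b * c) ^ 2 * (c * y i + d) ^ 4 *
        (derivative (wr p q)).eval (x (σ i)) := by
      have h2 : HasDerivAt (fun y : ℝ => c * y + d) c (y i) := by
        simpa using ((hasDerivAt_id (y i)).const_mul c).add_const d
      have h3 := ((h2.pow 6).const_mul (a * d - b * c)).mul
        (((wr p q).hasDerivAt _).comp (y i) (hasDerivAt_moebius (a := a) (b := b) (hcd i)))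
      rw [eval_derivative_eq h3]
      · have h0 : (wr p q).eval (x (σ i)) = 0 := by
          rw [h.wr_eq, eval_mul, eval_prod,
            Finset.prod_eq_zero (Finset.mem_univ (σ i)) (by simp), mul_zero]
        simp only [Function.comp_apply, hN, h0]
        have := hcd i
        simp
        field_simp
      · filter_upwards [eventually_linear_ne_zero (hcd i)] with z hz
        rw [hW, eval_wr_mobSubst h.degp h.degq hz]
        simp
    rw [h.wr_eq, eval_derivative_C_mul_prod, hWeq, eval_derivative_C_mul_prod] at h1
    have s1 := prod_erase_sub_sign hy i
    have s2 := prod_erase_sub_sign h.mono (σ i)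
    have hpos : 0 < (a * d - b * c) ^ 2 * (c * y i + d) ^ 4 := by
      have := hcd i
      positivity
    have hκ := h.kap
    set A := ∏ j ∈ Finset.univ.erase i, (y i - y j)
    set B := ∏ j ∈ Finset.univ.erase (σ i), (x (σ i) - x j)
    have hA : A ^ 2 > 0 := by
      have : A ≠ 0 := by rintro h0; simp [h0] at s1
      positivity
    refine pos_of_mul_pos_left (b := A ^ 2) ?_ hA.le
    have e1 : W.coeff 6 * κ * (-1) ^ (i.val + (σ i).val) * A ^ 2 =
        ((a * d - b * c) ^ 2 * (c * y i + d) ^ 4) * κ ^ 2 *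
          (((-1) ^ (i.val + 1) * A) * ((-1) ^ ((σ i).val + 1) * B)) := by
      have e2 : W.coeff 6 * A = (a * d - b * c) ^ 2 * (c * y i + d) ^ 4 * (κ * B) := h1
      have : W.coeff 6 * κ * (-1) ^ (i.val + (σ i).val) * A ^ 2 =
        (W.coeff 6 * A) * κ * (-1) ^ (i.val + (σ i).val) * A := by ring
      rw [this, e2]
      ring
    rw [e1]
    positivity
  refine ⟨W.coeff 6, ⟨natDegree_mobSubst_le _ _ _ _ _ _, natDegree_mobSubst_le _ _ _ _ _ _, hy,
    fun h0 => ?_, hWeq, fun i => ?_, fun i => ?_⟩, hsign⟩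
  · have := hsign 0
    simp [h0] at this
  · rw [eval_mobSubst h.degp (hcd i), eval_mobSubst h.degq (hcd i), hN, h.val]
    simp only [Function.comp_apply]
    ring
  · rw [eval_mobSubst h.degq (hcd i), hN]
    exact mul_ne_zero (pow_ne_zero _ (hcd i)) (h.ne _)

theorem sign_right_of_no_return {p q : ℝ[X]} {a b v s : ℝ} (hab : a < b)
    (hW : ∀ z ∈ Set.Ioo a b, 0 < s * (wr p q).eval z) (ha : p.eval a = v * q.eval a)
    (hqa : q.eval a ≠ 0) (hne : ∀ z ∈ Set.Ioc a b, p.eval z ≠ v * q.eval z) :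
    0 < s * (p.eval b - v * q.eval b) * q.eval a := by
  have hs : s ≠ 0 := by
    rintro rfl
    simpa using hW ((a + b) / 2) ⟨by linarith, by linarith⟩
  by_contra hcon
  have hb := sub_ne_zero.2 (hne b ⟨hab, le_rfl⟩)
  have hcon' : s * (p.eval b - v * q.eval b) * q.eval a < 0 :=
    lt_of_le_of_ne (not_lt.1 hcon) (mul_ne_zero (mul_ne_zero hs hb) hqa)
  have hneg : ∀ z ∈ Set.Ioc a b, s * (p.eval z - v * q.eval z) * q.eval a < 0 := by
    intro z hz
    by_contra hz0
    have hcont : ContinuousOn (fun z => s * (p.eval z - v * q.eval z) * q.eval a)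
        (Set.Icc z b) := by fun_prop
    obtain ⟨w, hw, hw0⟩ := intermediate_value_Icc' hz.2 hcont ⟨hcon'.le, not_lt.1 hz0⟩
    exact mul_ne_zero (mul_ne_zero hs (sub_ne_zero.2 (hne w ⟨hz.1.trans_le hw.1, hw.2⟩))) hqa hw0
  have hanti := strictAntiOn_div_sub (convex_Ioc a b) (by rwa [interior_Ioc]) hne
  set G := s * q.eval b / (p.eval b - v * q.eval b) with hG
  have hle : ∀ z ∈ Set.Ioo a b,
      s * s * q.eval z * q.eval a - G * (s * (p.eval z - v * q.eval z) * q.eval a) ≤ 0 := by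
    intro z hz
    have h1 : G ≤ s * q.eval z / (p.eval z - v * q.eval z) :=
      hanti.antitoneOn ⟨hz.1, hz.2.le⟩ ⟨hab, le_rfl⟩ hz.2.le
    have h2 := mul_le_mul_of_nonpos_right h1 (hneg z ⟨hz.1, hz.2.le⟩).le
    have h3 := sub_ne_zero.2 (hne z ⟨hz.1, hz.2.le⟩)
    have h4 : s * q.eval z / (p.eval z - v * q.eval z) *
        (s * (p.eval z - v * q.eval z) * q.eval a) = s * s * q.eval z * q.eval a := by
      generalize p.eval z - v * q.eval z = A at h3
      field_simp
    linarith
  have hcont : Continuous fun z =>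
      s * s * q.eval z * q.eval a - G * (s * (p.eval z - v * q.eval z) * q.eval a) := by fun_prop
  have hlim := le_of_tendsto ((hcont.tendsto a).mono_left nhdsWithin_le_nhds)
    (Filter.mem_of_superset (Ioo_mem_nhdsGT hab) hle)
  rw [ha] at hlim
  have : 0 < (s * q.eval a) ^ 2 := by positivity
  nlinarith

theorem wr_comp_neg_X (p q : ℝ[X]) : wr (p.comp (-X)) (q.comp (-X)) = -(wr p q).comp (-X) := by
  simp [wr, derivative_comp]
  ring

theorem sign_left_of_no_return {p q : ℝ[X]} {a b v s : ℝ} (hab : b < a)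
    (hW : ∀ z ∈ Set.Ioo b a, 0 < s * (wr p q).eval z) (ha : p.eval a = v * q.eval a)
    (hqa : q.eval a ≠ 0) (hne : ∀ z ∈ Set.Ico b a, p.eval z ≠ v * q.eval z) :
    0 < -s * (p.eval b - v * q.eval b) * q.eval a := by
  have := sign_right_of_no_return (p := p.comp (-X)) (q := q.comp (-X)) (s := -s) (v := v)
    (neg_lt_neg hab) (fun z hz => ?_) (by simpa using ha) (by simpa using hqa) (fun z hz => ?_)
  · simpa using this
  · have := hW (-z) ⟨by linarith [hz.2], by linarith [hz.1]⟩
    rw [wr_comp_neg_X]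
    simpa using this
  · simpa using hne (-z) ⟨by linarith [hz.2], by linarith [hz.1]⟩

theorem eq_of_nine_roots {h : ℝ[X]} (hd : h.natDegree ≤ 8) {z : Fin 6 → ℝ}
    (hz : Function.Injective z) (h0 : ∀ i, h.eval (z i) = 0)
    (h1 : ∀ i : Fin 6, i.val % 2 = 0 → (derivative h).eval (z i) = 0) : h = 0 := by
  by_contra hne
  have key : ∀ i : Fin 6, (if i.val % 2 = 0 then 2 else 1) ≤ h.roots.count (z i) := by
    intro i
    rw [count_roots]
    split_ifs with hi
    · exact (one_lt_rootMultiplicity_iff_isRoot hne).2 ⟨h0 i, h1 i hi⟩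
    · exact (rootMultiplicity_pos hne).2 (h0 i)
  have h2 : ∑ a ∈ Finset.univ.image z, h.roots.count a ≤ h.roots.card := by
    rw [← Multiset.toFinset_sum_count_eq]
    refine Finset.sum_le_sum_of_subset fun a ha => ?_
    obtain ⟨i, -, rfl⟩ := Finset.mem_image.1 ha
    simp [hne, h0 i]
  rw [Finset.sum_image hz.injOn] at h2
  have h3 := Finset.sum_le_sum fun i (_ : i ∈ Finset.univ) => key i
  have h4 : ∑ i : Fin 6, (if i.val % 2 = 0 then 2 else 1) = 9 := by decide
  have := card_roots' h
  omega

theorem Marked.derivative_eq {p q : ℝ[X]} {x v : Fin 6 → ℝ} {κ : ℝ} (h : Marked p q x v κ)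
    (i : Fin 6) : (derivative p).eval (x i) = v i * (derivative q).eval (x i) := by
  have h0 : (wr p q).eval (x i) = 0 := by
    rw [h.wr_eq, eval_mul, eval_prod, Finset.prod_eq_zero (Finset.mem_univ i) (by simp), mul_zero]
  rw [eval_wr, h.val] at h0
  refine mul_right_cancel₀ (h.ne i) ?_
  linarith

theorem cross_mul_sign {A B q Q s : ℝ} (h1 : 0 < s * A * q) (h2 : 0 < s * B * Q) :
    A * Q * (-(B * q)) < 0 := by
  have h3 := mul_pos h1 h2
  have hs : s ≠ 0 := by rintro rfl; simp at h1
  have h4 : s * A * q * (s * B * Q) = s ^ 2 * (A * Q * (B * q)) := by ring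
  rw [h4] at h3
  have := (pos_iff_pos_of_mul_pos h3).1 (by positivity)
  linarith

section Aligned

variable {p q P Q : ℝ[X]} {x y c : Fin 6 → ℝ} {l : Fin 6 → Fin 6} {κ κ' : ℝ} {e : Bool}
  {g : Fin 6}

/-- Between corresponding marks lying between common double zeros, the cross difference of two
marked pairs changes sign. -/
theorem cross_root_of_lt (hf : Marked p q x (c ∘ l) κ) (hg : Marked P Q y (c ∘ l) κ')
    (he : 0 < κ ↔ e = true) (he' : 0 < κ' ↔ e = true) (hc : StrictMono c)
    (ht : (coverSet l e g).card = 4) {i j : Fin 6} (hi5 : i ≠ 5) (hij : j = i + 1)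
    (hxy : x j < y j) (hyx : y i < x j) (harc : ∀ z ∈ Set.Ioc (x j) (y j), z ∈ arc x j)
    (hup : sg (up i e) = -sg (up j e)) :
    ∃ z ∈ Set.Icc (x j) (y j), (p * Q - P * q).eval z = 0 := by
  have h1 := sign_right_of_no_return hxy
    (fun z hz => sg_mul_wr_pos hf he (harc z ⟨hz.1, hz.2.le⟩)) (hf.val j) (hf.ne j)
    fun z hz => no_return_right hf he hc ht (harc z hz) hz.1
  have harc' : ∀ z ∈ Set.Ico (x j) (y j), z ∈ arc y i := fun z hz =>
    (mem_arc_of_ne_five hi5).2 ⟨hyx.trans_le hz.1, hij ▸ hz.2⟩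
  have h2 := sign_left_of_no_return hxy
    (fun z hz => sg_mul_wr_pos hg he' (harc' z ⟨hz.1.le, hz.2⟩)) (hg.val j) (hg.ne j)
    fun z hz => by
      have := no_return_left hg he' hc ht hi5 (harc' z hz)
      rwa [← hij] at this
  rw [hup, neg_neg] at h2
  have h3 := cross_mul_sign h1 h2
  have hcont : ContinuousOn (fun z => (p * Q - P * q).eval z) (Set.Icc (x j) (y j)) := by fun_prop
  have e1 : (p * Q - P * q).eval (y j) =
      (p.eval (y j) - (c ∘ l) j * q.eval (y j)) * Q.eval (y j) := by
    simp only [eval_sub, eval_mul, hg.val]; ring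
  have e2 : (p * Q - P * q).eval (x j) =
      -((P.eval (x j) - (c ∘ l) j * Q.eval (x j)) * q.eval (x j)) := by
    simp only [eval_sub, eval_mul, hf.val]; ring
  rw [← e1, ← e2] at h3
  rcases mul_neg_iff.1 h3 with ⟨h4, h5⟩ | ⟨h4, h5⟩
  · exact intermediate_value_Icc hxy.le hcont ⟨h5.le, h4.le⟩
  · exact intermediate_value_Icc' hxy.le hcont ⟨h4.le, h5.le⟩

theorem cross_root (hf : Marked p q x (c ∘ l) κ) (hg : Marked P Q y (c ∘ l) κ')
    (he : 0 < κ ↔ e = true) (he' : 0 < κ' ↔ e = true) (hc : StrictMono c)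
    (ht : (coverSet l e g).card = 4) {i j : Fin 6} (hi5 : i ≠ 5) (hij : j = i + 1)
    (hi : x i = y i) (harc : ∀ z ∈ Set.Ioc (x j) (y j), z ∈ arc x j)
    (harc' : ∀ z ∈ Set.Ioc (y j) (x j), z ∈ arc y j)
    (hup : sg (up i e) = -sg (up j e)) :
    ∃ z, (x j ≤ z ∧ z ≤ y j ∨ y j ≤ z ∧ z ≤ x j) ∧ (p * Q - P * q).eval z = 0 := by
  have h1 : x i < x j := hij ▸ hf.mono (lt_add_one_of_ne_five hi5)
  have h2 : y i < y j := hij ▸ hg.mono (lt_add_one_of_ne_five hi5)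
  rcases lt_trichotomy (x j) (y j) with h | h | h
  · obtain ⟨z, hz, hz0⟩ := cross_root_of_lt hf hg he he' hc ht hi5 hij h (hi ▸ h1) harc hup
    exact ⟨z, Or.inl hz, hz0⟩
  · refine ⟨x j, Or.inl ⟨le_rfl, h.le⟩, ?_⟩
    have := hg.val j
    rw [← h] at this
    rw [eval_sub, eval_mul, eval_mul, hf.val, this]
    ring
  · obtain ⟨z, hz, hz0⟩ := cross_root_of_lt hg hf he' he hc ht hi5 hij h (hi ▸ h2) harc' hup
    refine ⟨z, Or.inr hz, ?_⟩
    have : p * Q - P * q = -(P * q - p * Q) := by ring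
    rw [this, eval_neg, hz0, neg_zero]

/-- Two marked pairs with the same marking whose even-numbered marks agree define the same
rational function. -/
theorem eq_of_aligned (hf : Marked p q x (c ∘ l) κ) (hg : Marked P Q y (c ∘ l) κ')
    (he : 0 < κ ↔ e = true) (he' : 0 < κ' ↔ e = true) (hc : StrictMono c)
    (ht : (coverSet l e g).card = 4) (h0 : x 0 = y 0) (h2 : x 2 = y 2) (h4 : x 4 = y 4) :
    p * Q = P * q := by
  have hx := hf.mono
  have hy := hg.mono
  obtain ⟨z1, hz1, hr1⟩ := cross_root (i := 0) (j := 1) hf hg he he' hc ht (by decide) rfl h0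
    (fun z hz => (mem_arc_of_ne_five (by decide)).2
      ⟨hz.1, hz.2.trans_lt (h2 ▸ hy (show (1 : Fin 6) < 2 by decide))⟩)
    (fun z hz => (mem_arc_of_ne_five (by decide)).2
      ⟨hz.1, hz.2.trans_lt (h2 ▸ hx (show (1 : Fin 6) < 2 by decide))⟩)
    (by cases e <;> simp [sg, up])
  obtain ⟨z3, hz3, hr3⟩ := cross_root (i := 2) (j := 3) hf hg he he' hc ht (by decide) rfl h2
    (fun z hz => (mem_arc_of_ne_five (by decide)).2
      ⟨hz.1, hz.2.trans_lt (h4 ▸ hy (show (3 : Fin 6) < 4 by decide))⟩)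
    (fun z hz => (mem_arc_of_ne_five (by decide)).2
      ⟨hz.1, hz.2.trans_lt (h4 ▸ hx (show (3 : Fin 6) < 4 by decide))⟩)
    (by cases e <;> simp [sg, up])
  obtain ⟨z5, hz5, hr5⟩ := cross_root (i := 4) (j := 5) hf hg he he' hc ht (by decide) rfl h4
    (fun z hz => mem_arc_five.2 (Or.inl hz.1))
    (fun z hz => mem_arc_five.2 (Or.inl hz.1))
    (by cases e <;> simp [sg, up])
  have x01 := hx (show (0 : Fin 6) < 1 by decide)
  have x12 := hx (show (1 : Fin 6) < 2 by decide)
  have x23 := hx (show (2 : Fin 6) < 3 by decide)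
  have x34 := hx (show (3 : Fin 6) < 4 by decide)
  have x45 := hx (show (4 : Fin 6) < 5 by decide)
  have y01 := hy (show (0 : Fin 6) < 1 by decide)
  have y12 := hy (show (1 : Fin 6) < 2 by decide)
  have y23 := hy (show (2 : Fin 6) < 3 by decide)
  have y34 := hy (show (3 : Fin 6) < 4 by decide)
  have y45 := hy (show (4 : Fin 6) < 5 by decide)
  have hdouble : ∀ i, x i = y i → (p * Q - P * q).eval (x i) = 0 ∧
      (derivative (p * Q - P * q)).eval (x i) = 0 := by
    intro i hi
    have v1 := hf.val i
    have v2 := hg.val i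
    have d1 := hf.derivative_eq i
    have d2 := hg.derivative_eq i
    rw [← hi] at v2 d2
    simp only [derivative_sub, derivative_mul, eval_sub, eval_add, eval_mul, v1, v2, d1, d2]
    constructor <;> ring
  rw [← sub_eq_zero]
  have hz01 : x 0 < z1 := by rcases hz1 with h | h <;> linarith
  have hz12 : z1 < x 2 := by rcases hz1 with h | h <;> linarith
  have hz23 : x 2 < z3 := by rcases hz3 with h | h <;> linarith
  have hz34 : z3 < x 4 := by rcases hz3 with h | h <;> linarith
  have hz45 : x 4 < z5 := by rcases hz5 with h | h <;> linarith
  refine eq_of_nine_roots (z := ![x 0, z1, x 2, z3, x 4, z5]) ?_ (StrictMono.injective ?_) ?_ ?_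
  · exact natDegree_sub_le_of_le (natDegree_mul_le.trans (add_le_add hf.degp hg.degq))
      (natDegree_mul_le.trans (add_le_add hg.degp hf.degq))
  · refine Fin.strictMono_iff_lt_succ.2 fun i => ?_
    fin_cases i <;> simpa
  · intro i
    fin_cases i
    exacts [(hdouble 0 h0).1, hr1, (hdouble 2 h2).1, hr3, (hdouble 4 h4).1, hr5]
  · intro i hi
    fin_cases i
    exacts [(hdouble 0 h0).2, by simp at hi, (hdouble 2 h2).2, by simp at hi, (hdouble 4 h4).2,
      by simp at hi]

end Aligned

/-- Möbius equivalence of quotients `p / q` and `P / Q` of polynomials of degree at most `4`. -/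
def MEq (p q P Q : ℝ[X]) : Prop :=
  ∃ a b c d : ℝ, a * d - b * c ≠ 0 ∧ P * mobSubst 4 a b c d q = Q * mobSubst 4 a b c d p

theorem mEq_of_eval {p q P Q : ℝ[X]} (hp : p.natDegree ≤ 4) (hq : q.natDegree ≤ 4)
    {a b c d : ℝ} (hdet : a * d - b * c ≠ 0) {s : Set ℝ} (hs : s.Finite)
    (h : ∀ y ∉ s, c * y + d ≠ 0 → P.eval y * q.eval ((a * y + b) / (c * y + d)) =
      Q.eval y * p.eval ((a * y + b) / (c * y + d))) : MEq p q P Q := by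
  refine ⟨a, b, c, d, hdet, eq_of_eval_eq_off_finite (hs.union (finite_linear_eq_zero hdet)) ?_⟩
  intro y hy
  rw [Set.mem_union, not_or] at hy
  rw [eval_mul, eval_mul, eval_mobSubst hp hy.2, eval_mobSubst hq hy.2]
  linear_combination (c * y + d) ^ 4 * h y hy.1 hy.2

theorem eval_of_mobSubst_eq {p q P Q : ℝ[X]} (hp : p.natDegree ≤ 4) (hq : q.natDegree ≤ 4)
    {a b c d : ℝ} (h : P * mobSubst 4 a b c d q = Q * mobSubst 4 a b c d p) {y : ℝ}
    (hy : c * y + d ≠ 0) : P.eval y * q.eval ((a * y + b) / (c * y + d)) =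
      Q.eval y * p.eval ((a * y + b) / (c * y + d)) := by
  have := congrArg (eval y) h
  rw [eval_mul, eval_mul, eval_mobSubst hp hy, eval_mobSubst hq hy] at this
  refine mul_left_cancel₀ (pow_ne_zero 4 hy) ?_
  linarith

theorem MEq.refl {p q : ℝ[X]} (hp : p.natDegree ≤ 4) (hq : q.natDegree ≤ 4) : MEq p q p q :=
  mEq_of_eval hp hq (a := 1) (b := 0) (c := 0) (d := 1) (by norm_num) Set.finite_empty
    fun y _ _ => by simp; ring

theorem mEq_mobSubst {p q : ℝ[X]} {a b c d : ℝ} (hdet : a * d - b * c ≠ 0) :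
    MEq p q (mobSubst 4 a b c d p) (mobSubst 4 a b c d q) :=
  ⟨a, b, c, d, hdet, mul_comm _ _⟩

theorem MEq.symm {p q P Q : ℝ[X]} (hp : p.natDegree ≤ 4) (hq : q.natDegree ≤ 4)
    (hP : P.natDegree ≤ 4) (hQ : Q.natDegree ≤ 4) (h : MEq p q P Q) : MEq P Q p q := by
  obtain ⟨a, b, c, d, hdet, h⟩ := h
  refine mEq_of_eval hP hQ (a := d) (b := -b) (c := -c) (d := a) (by intro h0; apply hdet; linarith)
    Set.finite_empty fun y _ hy => ?_
  have h1 : c * ((d * y + -b) / (-c * y + a)) + d = (a * d - b * c) / (-c * y + a) := by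
    generalize hu : -c * y + a = u at hy
    field_simp
    linear_combination -d * hu
  have h2 := eval_of_mobSubst_eq hp hq h (y := (d * y + -b) / (-c * y + a))
    (by rw [h1]; exact div_ne_zero hdet hy)
  have h3 : a * ((d * y + -b) / (-c * y + a)) + b = y * ((a * d - b * c) / (-c * y + a)) := by
    generalize hu : -c * y + a = u at hy
    field_simp
    linear_combination -b * hu
  rw [h1, h3, mul_div_cancel_right₀ _ (div_ne_zero hdet hy)] at h2
  linarith

theorem finite_eval_moebius_eq_zero {q : ℝ[X]} (hq : q ≠ 0) {a b c d : ℝ}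
    (hdet : a * d - b * c ≠ 0) :
    {y : ℝ | c * y + d ≠ 0 ∧ q.eval ((a * y + b) / (c * y + d)) = 0}.Finite := by
  refine Set.Finite.of_finite_image (f := fun y => (a * y + b) / (c * y + d))
    ((q.roots.toFinset.finite_toSet).subset ?_) ?_
  · rintro _ ⟨y, hy, rfl⟩
    simpa [hq] using hy.2
  · intro y hy z hz hyz
    have h1 := hy.1
    have h2 := hz.1
    simp only at hyz
    rw [div_eq_div_iff h1 h2] at hyz
    refine mul_left_cancel₀ hdet ?_
    linear_combination hyz

theorem MEq.trans {p q P Q R S : ℝ[X]} (hp : p.natDegree ≤ 4) (hq : q.natDegree ≤ 4)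
    (hP : P.natDegree ≤ 4) (hQ : Q.natDegree ≤ 4) (hQ0 : Q ≠ 0) (h : MEq p q P Q)
    (h' : MEq P Q R S) : MEq p q R S := by
  obtain ⟨a, b, c, d, hdet, h⟩ := h
  obtain ⟨a', b', c', d', hdet', h'⟩ := h'
  refine mEq_of_eval hp hq (a := a * a' + b * c') (b := a * b' + b * d') (c := c * a' + d * c')
    (d := c * b' + d * d') (fun h0 => mul_ne_zero hdet hdet' (by linear_combination h0))
    ((finite_eval_moebius_eq_zero hQ0 hdet').union (finite_linear_eq_zero hdet')) fun y hy hcd => ?_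
  rw [Set.mem_union, not_or] at hy
  have hy2 : c' * y + d' ≠ 0 := hy.2
  have h1 := eval_of_mobSubst_eq hP hQ h' hy2
  have hQz : Q.eval ((a' * y + b') / (c' * y + d')) ≠ 0 := fun h0 => hy.1 ⟨hy2, h0⟩
  have e1 : c * ((a' * y + b') / (c' * y + d')) + d =
      ((c * a' + d * c') * y + (c * b' + d * d')) / (c' * y + d') := by
    rw [eq_div_iff hy2, add_mul, mul_assoc, div_mul_cancel₀ _ hy2]; ring
  have e2 : a * ((a' * y + b') / (c' * y + d')) + b =
      ((a * a' + b * c') * y + (a * b' + b * d')) / (c' * y + d') := by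
    rw [eq_div_iff hy2, add_mul, mul_assoc, div_mul_cancel₀ _ hy2]; ring
  have h2 := eval_of_mobSubst_eq hp hq h (y := (a' * y + b') / (c' * y + d'))
    (by rw [e1]; exact div_ne_zero hcd hy2)
  rw [e1, e2, div_div_div_cancel_right₀ hy2] at h2
  refine mul_left_cancel₀ hQz ?_
  linear_combination q.eval (((a * a' + b * c') * y + (a * b' + b * d')) /
    ((c * a' + d * c') * y + (c * b' + d * d'))) * h1 + S.eval y * h2

theorem Marked.q_ne_zero {p q : ℝ[X]} {x v : Fin 6 → ℝ} {κ : ℝ} (h : Marked p q x v κ) :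
    q ≠ 0 := by
  rintro rfl
  exact h.ne 0 (by simp)

section Unique

variable {p q P Q : ℝ[X]} {x y c : Fin 6 → ℝ} {l : Fin 6 → Fin 6} {κ κ' : ℝ} {e : Bool}
  {g : Fin 6}

theorem mEq_of_marked_of_le (hf : Marked p q x (c ∘ l) κ) (hg : Marked P Q y (c ∘ l) κ')
    (he : 0 < κ ↔ e = true) (he' : 0 < κ' ↔ e = true) (hc : StrictMono c)
    (ht : (coverSet l e g).card = 4)
    (hle : (y 2 - y 0) * (x 4 - x 0) ≤ (y 4 - y 0) * (x 2 - x 0)) : MEq P Q p q := by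
  have hx02 := hf.mono (show (0 : Fin 6) < 2 by decide)
  have hx24 := hf.mono (show (2 : Fin 6) < 4 by decide)
  have hy02 := hg.mono (show (0 : Fin 6) < 2 by decide)
  have hy24 := hg.mono (show (2 : Fin 6) < 4 by decide)
  have hy0 : ∀ i, 0 ≤ y i - y 0 := fun i => sub_nonneg.2 (hg.mono.monotone (Fin.zero_le i))
  have a1 : 0 < y 2 - y 0 := by linarith
  have a2 : 0 < y 4 - y 0 := by linarith
  have a3 : 0 < x 4 - x 2 := by linarith
  have a4 : 0 < x 2 - x 0 := by linarith
  obtain ⟨γ, hγ0, hγeq⟩ : ∃ γ, 0 ≤ γ ∧ γ * ((y 2 - y 0) * (y 4 - y 0) * (x 4 - x 2)) =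
      (y 4 - y 0) * (x 2 - x 0) - (y 2 - y 0) * (x 4 - x 0) :=
    ⟨_, div_nonneg (sub_nonneg.2 hle) (mul_pos (mul_pos a1 a2) a3).le,
      div_mul_cancel₀ _ (mul_pos (mul_pos a1 a2) a3).ne'⟩
  obtain ⟨A, hApos, hAeq⟩ : ∃ A, 0 < A ∧
      A * (y 2 - y 0) = (x 2 - x 0) * (1 + γ * (y 2 - y 0)) :=
    ⟨(x 2 - x 0) * (1 + γ * (y 2 - y 0)) / (y 2 - y 0), by positivity, div_mul_cancel₀ _ a1.ne'⟩
  have hk : ∀ i, 0 < 1 + γ * (y i - y 0) := fun i => by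
    have := mul_nonneg hγ0 (hy0 i); linarith
  obtain ⟨t, ht'⟩ : ∃ t : Fin 6 → ℝ,
      ∀ i, (t i - x 0) * (1 + γ * (y i - y 0)) = A * (y i - y 0) :=
    ⟨fun i => x 0 + A * (y i - y 0) / (1 + γ * (y i - y 0)), fun i => by
      rw [add_sub_cancel_left, div_mul_cancel₀ _ (hk i).ne']⟩
  have hmono : StrictMono t := fun i j hij => by
    have h1 := hg.mono hij
    have h2 : (t j - t i) * ((1 + γ * (y i - y 0)) * (1 + γ * (y j - y 0))) =
        A * (y j - y i) := by
      linear_combination (1 + γ * (y i - y 0)) * ht' j - (1 + γ * (y j - y 0)) * ht' i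
    have h3 : 0 < (t j - t i) * ((1 + γ * (y i - y 0)) * (1 + γ * (y j - y 0))) := by
      rw [h2]; exact mul_pos hApos (sub_pos.2 h1)
    exact sub_pos.1 (pos_of_mul_pos_left h3 (mul_pos (hk i) (hk j)).le)
  have hcd : ∀ i, -γ * t i + (A + γ * x 0) = A / (1 + γ * (y i - y 0)) := fun i => by
    rw [eq_div_iff (hk i).ne']
    linear_combination -γ * ht' i
  obtain ⟨κ'', hM, hs⟩ := hg.mobSubst (a := 1 - γ * y 0) (b := -x 0 + y 0 * (A + γ * x 0))
    (c := -γ) (d := A + γ * x 0) (by intro h0; apply hApos.ne'; linear_combination h0) hmono id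
    (fun i => by rw [hcd]; exact (div_pos hApos (hk i)).ne')
    (fun i => by
      have := hk i
      rw [hcd, id]
      refine mul_left_cancel₀ this.ne' ?_
      rw [mul_left_comm, mul_div_cancel₀ _ this.ne']
      linear_combination (1 - γ * y 0) * ht' i)
  have he'' : 0 < κ'' ↔ e = true := by
    rw [← he']
    have := hs 0
    simp only [Fin.val_zero, id, add_zero, pow_zero, mul_one] at this
    exact pos_iff_pos_of_mul_pos this
  have t0 : x 0 = t 0 := by
    have := ht' 0
    simp only [sub_self, mul_zero, add_zero, mul_one] at this
    linarith
  have t2 : x 2 = t 2 := by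
    have := ht' 2
    have h1 := (hk 2).ne'
    have : (t 2 - x 0) = x 2 - x 0 := mul_right_cancel₀ h1 (by rw [this, hAeq])
    linarith
  have t4 : x 4 = t 4 := by
    have h2 := ht' 4
    have h1 := (hk 4).ne'
    have : (t 4 - x 0) = x 4 - x 0 := by
      refine mul_right_cancel₀ h1 ?_
      rw [h2]
      refine mul_right_cancel₀ a1.ne' ?_
      linear_combination (y 4 - y 0) * hAeq - hγeq
    linarith
  exact ⟨_, _, _, _, by intro h0; apply hApos.ne'; linear_combination h0,
    (eq_of_aligned hf hM he he'' hc ht t0 t2 t4).trans (mul_comm _ _)⟩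

/-- Two marked pairs with the same tight marking are Möbius equivalent. -/
theorem mEq_of_marked (hf : Marked p q x (c ∘ l) κ) (hg : Marked P Q y (c ∘ l) κ')
    (he : 0 < κ ↔ e = true) (he' : 0 < κ' ↔ e = true) (hc : StrictMono c)
    (ht : (coverSet l e g).card = 4) : MEq p q P Q := by
  rcases le_total ((y 2 - y 0) * (x 4 - x 0)) ((y 4 - y 0) * (x 2 - x 0)) with h | h
  · exact (mEq_of_marked_of_le hf hg he he' hc ht h).symm hg.degp hg.degq hf.degp hf.degq
  · exact mEq_of_marked_of_le hg hf he' he hc ht (by linarith)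

end Unique

theorem sq_mul_wr_eq {p q P Q : ℝ[X]} (h : P * q = Q * p) :
    Q ^ 2 * wr p q = q ^ 2 * wr P Q := by
  have h' := congrArg derivative h
  rw [derivative_mul, derivative_mul] at h'
  rw [wr, wr]
  linear_combination (-(q * Q)) * h' + (q * derivative Q + Q * derivative q) * h

section Invariance

variable {p q P Q : ℝ[X]} {x y c : Fin 6 → ℝ} {l l' : Fin 6 → Fin 6} {κ κ' : ℝ}

theorem marks_of_mobSubst_eq {v v' : Fin 6 → ℝ} (hf : Marked p q x v κ)
    (hg : Marked P Q y v' κ') {a b c d : ℝ} (hdet : a * d - b * c ≠ 0)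
    (h : P * mobSubst 4 a b c d q = Q * mobSubst 4 a b c d p) (i : Fin 6) :
    ∃ j, c * y i + d ≠ 0 ∧ a * y i + b = x j * (c * y i + d) ∧ v' i = v j := by
  have hroot : (wr (mobSubst 4 a b c d p) (mobSubst 4 a b c d q)).eval (y i) = 0 := by
    have h1 := congrArg (eval (y i)) (sq_mul_wr_eq h)
    have h2 : (wr P Q).eval (y i) = 0 := by
      rw [hg.wr_eq, eval_mul, eval_prod, Finset.prod_eq_zero (Finset.mem_univ i) (by simp),
        mul_zero]
    rw [eval_mul, eval_mul, h2, mul_zero, eval_pow] at h1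
    exact (mul_eq_zero.1 h1).resolve_left (pow_ne_zero 2 (hg.ne i))
  have hcd : c * y i + d ≠ 0 := by
    intro h0
    rw [wr_mobSubst hdet hf.degp hf.degq, eval_mul, eval_C, eval_mobSubst_pole _ h0,
      hf.wr_coeff] at hroot
    have h1 := (mul_eq_zero.1 ((mul_eq_zero.1 hroot).resolve_left hdet)).resolve_left hf.kap
    have h2 : a * y i + b = 0 := by simpa using h1
    by_cases hc : c = 0
    · subst hc
      have : d = 0 := by linarith
      exact hdet (by rw [this]; ring)
    · exact hdet (mul_right_cancel₀ hc (by linear_combination a * c * h0 - c * c * h2))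
  rw [eval_wr_mobSubst hf.degp hf.degq hcd, hf.wr_eq, eval_mul, eval_prod, eval_C] at hroot
  have h1 := (mul_eq_zero.1 ((mul_eq_zero.1 hroot).resolve_left
    (mul_ne_zero hdet (pow_ne_zero 6 hcd)))).resolve_left hf.kap
  obtain ⟨j, -, hj⟩ := Finset.prod_eq_zero_iff.1 h1
  have hj' : (a * y i + b) / (c * y i + d) = x j := by simpa [sub_eq_zero] using hj
  refine ⟨j, hcd, (div_eq_iff hcd).1 hj', ?_⟩
  have h2 := eval_of_mobSubst_eq hf.degp hf.degq h hcd
  rw [hj', hg.val, hf.val] at h2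
  refine mul_right_cancel₀ (mul_ne_zero (hg.ne i) (hf.ne j)) ?_
  linarith

/-- A permutation of the marks induced by a Möbius map and fixing the first one either is the
identity or reverses the others. -/
theorem marks_perm (hx : StrictMono x) (hy : StrictMono y) {a b c d : ℝ} {σ : Fin 6 → Fin 6}
    (hdet : a * d - b * c ≠ 0) (hcd : ∀ i, c * y i + d ≠ 0)
    (hyx : ∀ i, a * y i + b = x (σ i) * (c * y i + d)) (h0 : σ 0 = 0) :
    σ = id ∨ σ 1 = 5 ∧ σ 5 = 1 := by
  have hdiff : ∀ i j, (x (σ j) - x (σ i)) * ((c * y i + d) * (c * y j + d)) =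
      (a * d - b * c) * (y j - y i) := fun i j => by
    linear_combination (c * y j + d) * hyx i - (c * y i + d) * hyx j
  have hinj : Function.Injective σ := fun i j hij => by
    have := hdiff i j
    rw [hij, sub_self, zero_mul] at this
    exact hy.injective (sub_eq_zero.1 ((mul_eq_zero.1 this.symm).resolve_left hdet)).symm
  have hpos : ∀ i, i ≠ 0 → 0 < σ i := fun i hi =>
    Fin.pos_iff_ne_zero.2 fun h => hi (hinj (h.trans h0.symm))
  have key : ∀ i j, 0 < i → i < j → 0 < (a * d - b * c) * (x (σ j) - x (σ i)) := by
    intro i j hi hij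
    have e1 := hdiff 0 i
    have e2 := hdiff i j
    have e3 := hdiff 0 j
    rw [h0] at e1 e3
    have p1 := sub_pos.2 (hx (hpos i hi.ne'))
    have p3 := sub_pos.2 (hx (hpos j (hi.trans hij).ne'))
    have q1 := sub_pos.2 (hy hi)
    have q2 := sub_pos.2 (hy hij)
    have q3 := sub_pos.2 (hy (hi.trans hij))
    have k0 := hcd 0
    have ki := hcd i
    have kj := hcd j
    have e4 : (a * d - b * c) * (x (σ j) - x (σ i)) * ((x (σ i) - x 0) * (x (σ j) - x 0) *
        ((c * y 0 + d) * (c * y i + d) * (c * y j + d)) ^ 2) =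
        (a * d - b * c) ^ 4 * ((y i - y 0) * (y j - y i) * (y j - y 0)) := by
      have : (a * d - b * c) * (x (σ j) - x (σ i)) * ((x (σ i) - x 0) * (x (σ j) - x 0) *
        ((c * y 0 + d) * (c * y i + d) * (c * y j + d)) ^ 2) = (a * d - b * c) *
        ((x (σ j) - x (σ i)) * ((c * y i + d) * (c * y j + d))) *
        ((x (σ i) - x 0) * ((c * y 0 + d) * (c * y i + d))) *
        ((x (σ j) - x 0) * ((c * y 0 + d) * (c * y j + d))) := by ring
      rw [this, e1, e2, e3]
      ring
    refine pos_of_mul_pos_left (e4 ▸ ?_) (b := (x (σ i) - x 0) * (x (σ j) - x 0) *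
        ((c * y 0 + d) * (c * y i + d) * (c * y j + d)) ^ 2) (by positivity)
    have := pow_pos (sq_pos_of_ne_zero hdet) 2
    rw [← pow_mul] at this
    positivity
  have k12 := key 1 2 (by decide) (by decide)
  have k23 := key 2 3 (by decide) (by decide)
  have k34 := key 3 4 (by decide) (by decide)
  have k45 := key 4 5 (by decide) (by decide)
  have k1 := hpos 1 (by decide)
  have k5 := hpos 5 (by decide)
  rcases lt_or_gt_of_ne hdet with hd | hd
  · right
    have conv : ∀ i j, 0 < (a * d - b * c) * (x (σ j) - x (σ i)) → σ j < σ i := fun i j h =>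
      hx.lt_iff_lt.1 (by nlinarith)
    have k12 := conv _ _ k12
    have k23 := conv _ _ k23
    have k34 := conv _ _ k34
    have k45 := conv _ _ k45
    simp only [Fin.lt_def, Fin.val_zero] at k5 k12 k23 k34 k45
    constructor <;> apply Fin.ext <;> simp <;> omega
  · left
    have conv : ∀ i j, 0 < (a * d - b * c) * (x (σ j) - x (σ i)) → σ i < σ j := fun i j h =>
      hx.lt_iff_lt.1 (sub_pos.1 (pos_of_mul_pos_right h hd.le))
    have k12 := conv _ _ k12
    have k23 := conv _ _ k23
    have k34 := conv _ _ k34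
    have k45 := conv _ _ k45
    funext i
    simp only [Fin.lt_def, Fin.val_zero] at k1 k12 k23 k34 k45
    fin_cases i
    · exact h0
    all_goals
      apply Fin.ext
      simp
      omega

/-- The normalised marking and the sign are invariants of Möbius equivalence. -/
theorem marking_eq_of_mEq (hf : Marked p q x (c ∘ l) κ) (hg : Marked P Q y (c ∘ l') κ')
    (hc : StrictMono c) (hl : Function.Injective l) (hl0 : l 0 = 0) (hl15 : l 1 < l 5)
    (hl0' : l' 0 = 0) (hl15' : l' 1 < l' 5) (h : MEq p q P Q) : l' = l ∧ 0 < κ * κ' := by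
  obtain ⟨a, b, γ, d, hdet, h⟩ := h
  choose σ hcd hyx hv using marks_of_mobSubst_eq hf hg hdet h
  have hlσ : ∀ i, l' i = l (σ i) := fun i => hc.injective (hv i)
  have h0 : σ 0 = 0 := hl (by rw [← hlσ, hl0, hl0'])
  rcases marks_perm hf.mono hg.mono hdet hcd hyx h0 with rfl | ⟨h1, h5⟩
  · refine ⟨funext hlσ, ?_⟩
    obtain ⟨κ'', hM, hs⟩ := hf.mobSubst hdet hg.mono id hcd hyx
    have e1 := sq_mul_wr_eq h
    rw [hM.wr_eq, hg.wr_eq, ← mul_assoc, ← mul_assoc] at e1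
    have e2 := congrArg (eval (y 0)) (mul_right_cancel₀
      (monic_prod_of_monic _ _ fun i _ => monic_X_sub_C (y i)).ne_zero e1)
    simp only [eval_mul, eval_pow, eval_C] at e2
    have h2 := hs 0
    simp only [Fin.val_zero, id, add_zero, pow_zero, mul_one] at h2
    have n1 := hg.ne 0
    have n2 := hM.ne 0
    refine pos_of_mul_pos_left (b := (eval (y 0) (mobSubst 4 a b γ d q)) ^ 2) ?_ (sq_nonneg _)
    have : κ * κ' * (eval (y 0) (mobSubst 4 a b γ d q)) ^ 2 = κ'' * κ * eval (y 0) Q ^ 2 := by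
      linear_combination -κ * e2
    rw [this]
    positivity
  · rw [hlσ, hlσ, h1, h5] at hl15'
    exact absurd hl15' hl15.asymm

end Invariance

section Moves

variable {p q : ℝ[X]} {x v : Fin 6 → ℝ} {κ : ℝ}

/-- Change of variable sending a point between the last and the first mark, in the cyclic order
starting after the first mark, to infinity. -/
theorem Marked.rotate_at (h : Marked p q x v κ) {t : ℝ} (h0 : x 0 < t) (h1 : t < x 1) :
    ∃ y κ', Marked (_root_.mobSubst 4 t (-1) 1 0 p) (_root_.mobSubst 4 t (-1) 1 0 q) y
      (v ∘ (· + 1)) κ' ∧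
      κ * κ' < 0 := by
  have hx := h.mono
  have h1' : ∀ i : Fin 6, i ≠ 0 → t < x i := fun i hi =>
    h1.trans_le (hx.monotone (Fin.one_le_of_ne_zero hi))
  have ht : ∀ i, t - x i ≠ 0 := fun i => by
    by_cases hi : i = 0
    · subst hi; exact (sub_pos.2 h0).ne'
    · exact (sub_neg.2 (h1' i hi)).ne
  have hd : ∀ i : Fin 6, i ≠ 5 → i + 1 ≠ 0 := by decide
  have hd' : ∀ i j : Fin 6, i < j → j ≠ 5 → i + 1 < j + 1 := by decide
  have hmono : StrictMono fun i : Fin 6 => (t - x (i + 1))⁻¹ := by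
    intro i j hij
    have hi : i ≠ 5 := (hij.trans_le (Fin.le_last j)).ne
    have hti := sub_neg.2 (h1' (i + 1) (hd i hi))
    by_cases hj : j = 5
    · subst hj
      exact (inv_lt_zero.2 hti).trans (inv_pos.2 (sub_pos.2 h0))
    · have htj := sub_neg.2 (h1' (j + 1) (hd j hj))
      have : x (i + 1) < x (j + 1) := hx (hd' i j hij hj)
      exact (inv_lt_inv_of_neg hti htj).2 (by linarith)
  obtain ⟨κ', hM, hs⟩ := h.mobSubst (a := t) (b := -1) (c := 1) (d := 0) (by norm_num) hmono
    (· + 1) (fun i => by simpa using ht (i + 1)) fun i => by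
      have := ht (i + 1)
      simp only [one_mul, add_zero]
      field_simp
      ring
  refine ⟨_, κ', hM, ?_⟩
  have := hs 0
  simp at this
  linarith

theorem Marked.exists_rotate (h : Marked p q x v κ) :
    ∃ P Q y κ', Marked P Q y (v ∘ (· + 1)) κ' ∧ κ * κ' < 0 ∧ MEq p q P Q := by
  have h01 := h.mono (show (0 : Fin 6) < 1 by decide)
  obtain ⟨t, h0, h1⟩ := exists_between h01
  obtain ⟨y, κ', hM, hs⟩ := h.rotate_at h0 h1
  exact ⟨_, _, y, κ', hM, hs, mEq_mobSubst (by norm_num)⟩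

theorem Marked.exists_reflect (h : Marked p q x v κ) :
    ∃ P Q y κ', Marked P Q y (v ∘ Fin.rev) κ' ∧ κ * κ' < 0 ∧ MEq p q P Q := by
  obtain ⟨κ', hM, hs⟩ := h.mobSubst (a := -1) (b := 0) (c := 0) (d := 1) (by norm_num)
    (y := fun i => -x (Fin.rev i)) (fun i j hij => neg_lt_neg (h.mono (Fin.rev_lt_rev.2 hij)))
    Fin.rev (fun i => by simp) fun i => by simp
  refine ⟨_, _, _, κ', hM, ?_, mEq_mobSubst (by norm_num)⟩
  have := hs 0
  have e : (-1 : ℝ) ^ ((0 : Fin 6).val + (Fin.rev (0 : Fin 6)).val) = -1 := by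
    norm_num [Fin.val_rev]
  rw [e] at this
  linarith

/-- Change of variable moving a point of the last arc to infinity. -/
theorem Marked.move_at (h : Marked p q x v κ) {t : ℝ} (ht : t ∈ arc x 5) :
    ∃ y κ', Marked (_root_.mobSubst 4 t (-1) 1 0 p) (_root_.mobSubst 4 t (-1) 1 0 q) y v κ' ∧
      0 < κ * κ' := by
  have hx := h.mono
  rw [mem_arc_five] at ht
  have h5 : ∀ i, x i ≤ x 5 := fun i => hx.monotone (Fin.le_last i)
  have h0 : ∀ i, x 0 ≤ x i := fun i => hx.monotone (Fin.zero_le i)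
  have hne : ∀ i, t - x i ≠ 0 := fun i => by
    rcases ht with ht | ht
    · exact (sub_pos.2 ((h5 i).trans_lt ht)).ne'
    · exact (sub_neg.2 (ht.trans_le (h0 i))).ne
  have hmono : StrictMono fun i : Fin 6 => (t - x i)⁻¹ := by
    intro i j hij
    have := hx hij
    rcases ht with ht | ht
    · exact (inv_lt_inv₀ (sub_pos.2 ((h5 i).trans_lt ht)) (sub_pos.2 ((h5 j).trans_lt ht))).2
        (by linarith)
    · exact (inv_lt_inv_of_neg (sub_neg.2 (ht.trans_le (h0 i)))
        (sub_neg.2 (ht.trans_le (h0 j)))).2 (by linarith)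
  obtain ⟨κ', hM, hs⟩ := h.mobSubst (a := t) (b := -1) (c := 1) (d := 0) (by norm_num) hmono
    id (fun i => by simpa using hne i) fun i => by
      have := hne i
      simp only [one_mul, add_zero, id]
      field_simp
      ring
  refine ⟨_, κ', hM, ?_⟩
  have := hs 0
  simp at this
  linarith

theorem wr_post (α β γ δ : ℝ) (p q : ℝ[X]) :
    wr (C α * p + C β * q) (C γ * p + C δ * q) = C (α * δ - β * γ) * wr p q := by
  simp [wr]
  ring

/-- Post-composition of a marked pair with a Möbius transformation. -/
theorem Marked.post (h : Marked p q x v κ) {α β γ δ : ℝ} (hdet : α * δ - β * γ ≠ 0)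
    (hv : ∀ i, γ * v i + δ ≠ 0) :
    Marked (C α * p + C β * q) (C γ * p + C δ * q) x
      (fun i => (α * v i + β) / (γ * v i + δ)) ((α * δ - β * γ) * κ) where
  degp := natDegree_add_le_of_degree_le ((natDegree_C_mul_le _ _).trans h.degp)
    ((natDegree_C_mul_le _ _).trans h.degq)
  degq := natDegree_add_le_of_degree_le ((natDegree_C_mul_le _ _).trans h.degp)
    ((natDegree_C_mul_le _ _).trans h.degq)
  mono := h.mono
  kap := mul_ne_zero hdet h.kap
  wr_eq := by rw [wr_post, h.wr_eq, C_mul, mul_assoc]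
  val i := by
    simp only [eval_add, eval_mul, eval_C, h.val]
    have := hv i
    rw [div_mul_eq_mul_div, ← mul_assoc, ← add_mul, ← mul_assoc γ, ← add_mul]
    generalize γ * v i + δ = u at this
    field_simp
  ne i := by
    simp only [eval_add, eval_mul, eval_C, h.val, ← mul_assoc, ← add_mul]
    exact mul_ne_zero (hv i) (h.ne i)

theorem coeff_mobSubst_one (n : ℕ) (a b d : ℝ) {p : ℝ[X]} (hp : p.natDegree ≤ n) :
    (mobSubst n a b 1 d p).coeff n = p.eval a := by
  rw [mobSubst, finsetSum_coeff, eval_eq_sum_range' (Nat.lt_succ_of_le hp)]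
  refine Finset.sum_congr rfl fun k hk => ?_
  have hk' : k ≤ n := Nat.lt_succ_iff.1 (Finset.mem_range.1 hk)
  obtain ⟨m, rfl⟩ := Nat.exists_eq_add_of_le hk'
  have h1 := coeff_pow_of_natDegree_le (m := k) (natDegree_linear_le (a := a) (b := b))
  have h2 := coeff_pow_of_natDegree_le (m := m) (natDegree_linear_le (a := 1) (b := d))
  rw [mul_one] at h1 h2
  rw [coeff_C_mul, Nat.add_sub_cancel_left, coeff_mul_add_eq_of_natDegree_le, h1, h2]
  · simp
  · exact (natDegree_pow_le_of_le k (natDegree_linear_le (a := a) (b := b))).trans (by simp)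
  · exact (natDegree_pow_le_of_le m (natDegree_linear_le (a := 1) (b := d))).trans (by simp)

end Moves

section Exclusion

variable {p q : ℝ[X]} {x v : Fin 6 → ℝ} {κ : ℝ}

/-- Before the first pole the graph of `p / q` meets the graph of `ℓ`, if it starts on the
appropriate side. -/
theorem exists_cross_before_pole {ℓ : ℝ[X]} {a b va s : ℝ}
    (hW : ∀ z ∈ Set.Ioo a b, 0 < s * (wr p q).eval z) (ha : p.eval a = va * q.eval a)
    (hqa : q.eval a ≠ 0) (hz : ∃ z ∈ Set.Ioo a b, q.eval z = 0) (hl : s * (va - ℓ.eval a) < 0) :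
    ∃ z ∈ Set.Ioo a b, (p - ℓ * q).eval z = 0 := by
  obtain ⟨z, hz, hqz⟩ := hz
  have hK : IsCompact (Set.Icc a z ∩ {w | q.eval w = 0}) :=
    isCompact_Icc.inter_right (isClosed_eq q.continuous continuous_const)
  obtain ⟨π, ⟨⟨haπ, hπz⟩, hqπ : q.eval π = 0⟩, hmin⟩ :=
    hK.exists_isLeast ⟨z, ⟨hz.1.le, le_rfl⟩, hqz⟩
  have haπ' : a < π := haπ.lt_of_ne fun h => hqa (h ▸ hqπ)
  have hπb : π < b := hπz.trans_lt hz.2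
  obtain ⟨r, rfl⟩ := dvd_iff_isRoot.2 hqπ
  have hWπ := hW π ⟨haπ', hπb⟩
  simp only [eval_wr, derivative_mul, derivative_sub, derivative_X, derivative_C, sub_zero,
    eval_add, eval_mul, eval_sub, eval_X, eval_C, sub_self, zero_mul, mul_zero, add_zero,
    one_mul, zero_sub] at hWπ
  simp only [eval_mul, eval_sub, eval_X, eval_C] at ha hqa
  have hra : r.eval a ≠ 0 := right_ne_zero_of_mul hqa
  have hr : 0 < r.eval a * r.eval π := by
    by_contra hneg
    have hcont : ContinuousOn (fun w => r.eval a * r.eval w) (Set.Icc a π) :=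
      (continuous_const.mul r.continuous).continuousOn
    obtain ⟨w, hw, hw0⟩ := intermediate_value_Icc' haπ hcont
      ⟨not_lt.1 hneg, mul_self_nonneg (r.eval a)⟩
    have hw0' : r.eval w = 0 := (mul_eq_zero.1 hw0).resolve_left hra
    have hwπ : w = π := le_antisymm hw.2 (hmin ⟨⟨hw.1, hw.2.trans hπz⟩, by simp [hw0']⟩)
    rw [← hwπ, hw0'] at hWπ
    simp at hWπ
  have hcont : ContinuousOn (fun w => s * r.eval a * (p - ℓ * ((X - C π) * r)).eval w)
      (Set.Icc a π) := (continuous_const.mul (Polynomial.continuous _)).continuousOn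
  have h1 : 0 < s * r.eval a * (p - ℓ * ((X - C π) * r)).eval a := by
    simp only [eval_sub, eval_mul, eval_X, eval_C, ha]
    have : 0 < r.eval a ^ 2 := by positivity
    have := mul_pos_of_neg_of_neg hl (mul_neg_of_pos_of_neg this (sub_neg.2 haπ'))
    linarith
  have h2 : s * r.eval a * (p - ℓ * ((X - C π) * r)).eval π < 0 := by
    simp only [eval_sub, eval_mul, eval_X, eval_C, sub_self, zero_mul, mul_zero, sub_zero]
    have h3 : s * p.eval π * r.eval π < 0 := by linarith
    have h4 : 0 < r.eval π ^ 2 := by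
      have := (right_ne_zero_of_mul hr.ne' : r.eval π ≠ 0)
      positivity
    by_contra h5
    have := mul_nonpos_of_nonpos_of_nonneg h3.le hr.le
    nlinarith [mul_neg_of_neg_of_pos h3 hr]
  obtain ⟨w, hw, hw0⟩ := intermediate_value_Ioo' haπ hcont ⟨h2, h1⟩
  refine ⟨w, ⟨hw.1, hw.2.trans hπb⟩, (mul_eq_zero.1 hw0).resolve_left ?_⟩
  exact left_ne_zero_of_mul h1.ne'

/-- After the last pole the graph of `p / q` meets the graph of `ℓ`, if it ends on the
appropriate side. -/
theorem exists_cross_after_pole {ℓ : ℝ[X]} {a b vb s : ℝ}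
    (hW : ∀ z ∈ Set.Ioo a b, 0 < s * (wr p q).eval z) (hb : p.eval b = vb * q.eval b)
    (hqb : q.eval b ≠ 0) (hz : ∃ z ∈ Set.Ioo a b, q.eval z = 0) (hl : 0 < s * (vb - ℓ.eval b)) :
    ∃ z ∈ Set.Ioo a b, (p - ℓ * q).eval z = 0 := by
  obtain ⟨z, hz, hqz⟩ := hz
  obtain ⟨w, hw, hw0⟩ := exists_cross_before_pole (p := p.comp (-X)) (q := q.comp (-X))
    (ℓ := ℓ.comp (-X)) (a := -b) (b := -a) (va := vb) (s := -s)
    (fun w hw => by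
      have := hW (-w) ⟨by linarith [hw.2], by linarith [hw.1]⟩
      simpa [wr_comp_neg_X] using this)
    (by simpa using hb) (by simpa using hqb)
    ⟨-z, ⟨neg_lt_neg hz.2, neg_lt_neg hz.1⟩, by simpa using hqz⟩
    (by simp only [eval_comp, eval_neg, eval_X, neg_neg]; linarith)
  exact ⟨-w, ⟨by linarith [hw.2], by linarith [hw.1]⟩, by simpa using hw0⟩

theorem exists_pole_of_le {a b va vb : ℝ} (hab : a < b)
    (hW : ∀ z ∈ Set.Ioo a b, (wr p q).eval z < 0) (ha : p.eval a = va * q.eval a)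
    (hb : p.eval b = vb * q.eval b) (hqa : q.eval a ≠ 0) (hqb : q.eval b ≠ 0) (h : va ≤ vb) :
    ∃ z ∈ Set.Ioo a b, q.eval z = 0 := by
  by_contra! hne
  have hanti := strictAntiOn_div_sub (p := q) (q := p) (s := 1) (y := 0) (t := Set.Icc a b)
    (convex_Icc a b) (fun z hz => by
      rw [interior_Icc] at hz
      have := hW z hz
      simp only [eval_wr] at this ⊢
      linarith) fun z hz => by
      rw [zero_mul]
      rcases hz.1.eq_or_lt with rfl | h1
      · exact hqa
      rcases hz.2.eq_or_lt with rfl | h2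
      · exact hqb
      exact hne z ⟨h1, h2⟩
  have := hanti ⟨le_rfl, hab.le⟩ ⟨hab.le, le_rfl⟩ hab
  simp only [one_mul, zero_mul, sub_zero, ha, hb] at this
  rw [mul_div_cancel_right₀ _ hqa, mul_div_cancel_right₀ _ hqb] at this
  linarith

theorem natDegree_le_three {r : ℝ[X]} (hr : r.natDegree ≤ 4) (h : r.coeff 4 = 0) :
    r.natDegree ≤ 3 := by
  rw [natDegree_le_iff_coeff_eq_zero] at hr ⊢
  intro n hn
  rcases (Nat.succ_le_of_lt hn).eq_or_lt with rfl | hn'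
  · exact h
  · exact hr n hn'

/-- A configuration of values ruled out by counting the intersections of the graph of `p / q`
with a line of negative slope. -/
theorem Marked.not_of_values (h : Marked p q x v κ) (hκ : 0 < κ) (hq : q.natDegree ≤ 3)
    (h01 : v 0 < v 1) (h12 : v 1 < v 2) (h34 : v 3 < v 4) (h41 : v 4 < v 1) (h45 : v 4 < v 5) :
    False := by
  have he : 0 < κ ↔ true = true := by simp [hκ]
  have hx := h.mono
  have x01 : x 0 < x 1 := hx (by decide)
  have x12 : x 1 < x 2 := hx (by decide)
  have x23 : x 2 < x 3 := hx (by decide)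
  have x34 : x 3 < x 4 := hx (by decide)
  have x45 : x 4 < x 5 := hx (by decide)
  have W0 : ∀ z ∈ Set.Ioo (x 0) (x 1), (wr p q).eval z < 0 := fun z hz => by
    have := sg_mul_wr_pos h he (i := 0) ((mem_arc_of_ne_five (by decide)).2 hz)
    simpa [up, sg] using this
  have W1 : ∀ z ∈ Set.Ioo (x 1) (x 2), 0 < (wr p q).eval z := fun z hz => by
    have := sg_mul_wr_pos h he (i := 1) ((mem_arc_of_ne_five (by decide)).2 hz)
    simpa [up, sg] using this
  have W2 : ∀ z ∈ Set.Ioo (x 2) (x 3), (wr p q).eval z < 0 := fun z hz => by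
    have := sg_mul_wr_pos h he (i := 2) ((mem_arc_of_ne_five (by decide)).2 hz)
    simpa [up, sg] using this
  have W3 : ∀ z ∈ Set.Ioo (x 3) (x 4), 0 < (wr p q).eval z := fun z hz => by
    have := sg_mul_wr_pos h he (i := 3) ((mem_arc_of_ne_five (by decide)).2 hz)
    simpa [up, sg] using this
  have W4 : ∀ z ∈ Set.Ioo (x 4) (x 5), (wr p q).eval z < 0 := fun z hz => by
    have := sg_mul_wr_pos h he (i := 4) ((mem_arc_of_ne_five (by decide)).2 hz)
    simpa [up, sg] using this
  obtain ⟨η, hη1, hη2⟩ := exists_between h12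
  obtain ⟨θ, hθ3, hθ4⟩ := exists_between h34
  have hcross : ∀ {a b y : ℝ}, a < y → y < b → 1 * (a - y)⁻¹ ≤ 1 * (b - y)⁻¹ :=
    fun {a b y} ha hb => by
      rw [one_mul, one_mul]
      exact (inv_lt_zero.2 (sub_neg.2 ha)).le.trans (inv_pos.2 (sub_pos.2 hb)).le
  obtain ⟨z, hz, hzη⟩ := exists_root_between x12 (s := 1) (fun z hz => by simpa using W1 z hz)
    (h.val 1) (h.val 2) (h.ne 1) (h.ne 2) hη1.ne hη2.ne' (hcross hη1 hη2)
  obtain ⟨w, hw, hwθ⟩ := exists_root_between x34 (s := 1) (fun z hz => by simpa using W3 z hz)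
    (h.val 3) (h.val 4) (h.ne 3) (h.ne 4) hθ3.ne hθ4.ne' (hcross hθ3 hθ4)
  have hzw : z < w := hz.2.trans (x23.trans hw.1)
  have hθη : θ < η := by linarith
  obtain ⟨m, hm, hmθ⟩ : ∃ m : ℝ, m < 0 ∧ m * (w - z) = θ - η :=
    ⟨(θ - η) / (w - z), div_neg_of_neg_of_pos (by linarith) (by linarith),
      div_mul_cancel₀ _ (by linarith)⟩
  obtain ⟨ℓ, hℓd, hℓ⟩ : ∃ ℓ : ℝ[X], ℓ.natDegree ≤ 1 ∧ ∀ t, ℓ.eval t = η + m * (t - z) :=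
    ⟨C m * X + C (η - m * z), natDegree_linear_le, fun t => by
      simp only [eval_add, eval_mul, eval_C, eval_X]; ring⟩
  have l1 : η < ℓ.eval (x 1) := by rw [hℓ]; nlinarith [hz.1]
  have l2 : ℓ.eval (x 2) < η := by rw [hℓ]; nlinarith [hz.2]
  have l3 : θ < ℓ.eval (x 3) := by rw [hℓ]; nlinarith [hw.1]
  have l4 : ℓ.eval (x 4) < θ := by rw [hℓ]; nlinarith [hw.2]
  obtain ⟨r0, hr0, hr0'⟩ := exists_cross_after_pole (ℓ := ℓ) (s := -1)
    (fun z hz => by have := W0 z hz; linarith) (h.val 1) (h.ne 1)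
    (exists_pole_of_le x01 W0 (h.val 0) (h.val 1) (h.ne 0) (h.ne 1) h01.le) (by linarith)
  obtain ⟨r4, hr4, hr4'⟩ := exists_cross_before_pole (ℓ := ℓ) (s := -1)
    (fun z hz => by have := W4 z hz; linarith) (h.val 4) (h.ne 4)
    (exists_pole_of_le x45 W4 (h.val 4) (h.val 5) (h.ne 4) (h.ne 5) h45.le) (by linarith)
  obtain ⟨r2, hr2, hr2'⟩ : ∃ r ∈ Set.Ioo (x 2) (x 3), (p - ℓ * q).eval r = 0 := by
    by_cases hpole : ∃ r ∈ Set.Ioo (x 2) (x 3), q.eval r = 0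
    · exact exists_cross_before_pole (s := -1) (fun z hz => by have := W2 z hz; linarith)
        (h.val 2) (h.ne 2) hpole (by linarith)
    · have hqq : 0 < q.eval (x 2) * q.eval (x 3) := by
        by_contra hneg
        have hneg' : q.eval (x 2) * q.eval (x 3) < 0 :=
          (not_lt.1 hneg).lt_of_ne (mul_ne_zero (h.ne 2) (h.ne 3))
        have hcont : ContinuousOn (fun t => q.eval (x 2) * q.eval t) (Set.Icc (x 2) (x 3)) :=
          (continuous_const.mul q.continuous).continuousOn
        obtain ⟨r, hr, hr0⟩ := intermediate_value_Ioo' x23.le hcont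
          ⟨hneg', mul_self_pos.2 (h.ne 2)⟩
        exact hpole ⟨r, hr, (mul_eq_zero.1 hr0).resolve_left (h.ne 2)⟩
      have hcont : ContinuousOn (fun t => q.eval (x 2) * (p - ℓ * q).eval t)
          (Set.Icc (x 2) (x 3)) := (continuous_const.mul (Polynomial.continuous _)).continuousOn
      have e2 : 0 < q.eval (x 2) * (p - ℓ * q).eval (x 2) := by
        simp only [eval_sub, eval_mul, h.val]
        have := mul_pos (show 0 < v 2 - ℓ.eval (x 2) by linarith) (mul_self_pos.2 (h.ne 2))
        linarith
      have e3 : q.eval (x 2) * (p - ℓ * q).eval (x 3) < 0 := by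
        simp only [eval_sub, eval_mul, h.val]
        have := mul_pos (show 0 < ℓ.eval (x 3) - v 3 by linarith) hqq
        linarith
      obtain ⟨r, hr, hr0⟩ := intermediate_value_Ioo' x23.le hcont ⟨e3, e2⟩
      exact ⟨r, hr, (mul_eq_zero.1 hr0).resolve_left (h.ne 2)⟩
  have hH : p - ℓ * q ≠ 0 := fun h0 => by
    have := congrArg (eval (x 1)) h0
    simp only [eval_sub, eval_mul, h.val, eval_zero, ← sub_mul] at this
    exact mul_ne_zero (by linarith) (h.ne 1) this
  have hd : (p - ℓ * q).natDegree ≤ 4 :=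
    natDegree_sub_le_of_le h.degp (natDegree_mul_le_of_le hℓd hq)
  have hmono : StrictMono ![r0, z, r2, w, r4] := by
    refine Fin.strictMono_iff_lt_succ.2 fun i => ?_
    fin_cases i
    · exact hr0.2.trans hz.1
    · exact hz.2.trans hr2.1
    · exact hr2.2.trans hw.1
    · exact hw.2.trans hr4.1
  have hroots : ∀ i, (p - ℓ * q).eval (![r0, z, r2, w, r4] i) = 0 := by
    intro i
    fin_cases i
    · exact hr0'
    · simp [hzη, hℓ]
    · exact hr2'
    · have : ℓ.eval w = θ := by rw [hℓ]; linarith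
      simp [hwθ, this]
    · exact hr4'
  have := card_le_of_roots hH hd Finset.univ _ hmono.injective.injOn fun i _ => hroots i
  simp at this

/-- Post-composition sending the value `η` to infinity. -/
theorem Marked.post_inv (h : Marked p q x v κ) {η : ℝ} (hv : ∀ i, v i ≠ η) :
    Marked (C 0 * p + C (-1) * q) (C 1 * p + C (-η) * q) x (fun i => (η - v i)⁻¹) κ := by
  have := h.post (α := 0) (β := -1) (γ := 1) (δ := -η) (by norm_num)
    (fun i => by have := sub_ne_zero.2 (hv i); simpa [← sub_eq_add_neg] using this)
  convert this using 1
  · ext i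
    have h1 : η - v i ≠ 0 := sub_ne_zero.2 (hv i).symm
    have h2 : v i + -η ≠ 0 := by rw [← sub_eq_add_neg]; exact sub_ne_zero.2 (hv i)
    simp only [zero_mul, zero_add, one_mul]
    rw [inv_eq_one_div, div_eq_div_iff h1 h2]
    ring
  · ring

variable {c : Fin 6 → ℝ}

theorem Marked.not_of_marking_neg (hc : StrictMono c)
    (h : Marked p q x (c ∘ ![0, 1, 4, 5, 2, 3]) κ) (hκ : κ < 0) : False := by
  have he : 0 < κ ↔ false = true := by simp [hκ.le]
  obtain ⟨η, hη, hη4⟩ := exists_inGap hc 0 h.coeff_ne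
  obtain ⟨t, ht, htη⟩ := exists_root_arc h he hc hη hη4 (i := 0) (by decide)
  have hp := h.post_inv (η := η) fun i => hη.ne _
  rw [mem_arc_of_ne_five (by decide)] at ht
  obtain ⟨y, κ', hM, hs⟩ := hp.rotate_at ht.1 ht.2
  have hc0 : c 0 < η := hη 0
  have hlt : ∀ j : Fin 6, 1 ≤ j → η < c j := fun j hj => by
    have := hη j
    rwa [if_neg (not_le.2 ((show (0 : Fin 6) < 1 by decide).trans_le hj))] at this
  have key : ∀ i j : Fin 6, 1 ≤ i → i < j → (η - c i)⁻¹ < (η - c j)⁻¹ := fun i j hi hij =>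
    (inv_lt_inv_of_neg (sub_neg.2 (hlt i hi)) (sub_neg.2 (hlt j (hi.trans hij.le)))).2
      (by linarith [hc hij])
  refine hM.not_of_values (by nlinarith) (natDegree_le_three hM.degq ?_) ?_ ?_ ?_ ?_ ?_
  · rw [coeff_mobSubst_one _ _ _ _ hp.degq]
    simp [htη]
  · exact key 1 4 (by decide) (by decide)
  · exact key 4 5 (by decide) (by decide)
  · exact key 2 3 (by decide) (by decide)
  · exact key 3 4 (by decide) (by decide)
  · exact (inv_lt_zero.2 (sub_neg.2 (hlt 3 (by decide)))).trans (inv_pos.2 (sub_pos.2 hc0))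

theorem Marked.not_of_marking_pos (hc : StrictMono c)
    (h : Marked p q x (c ∘ ![0, 3, 4, 1, 2, 5]) κ) (hκ : 0 < κ) : False := by
  have he : 0 < κ ↔ true = true := by simp [hκ]
  obtain ⟨η, hη, hη4⟩ := exists_inGap hc 5 h.coeff_ne
  obtain ⟨t, ht, htη⟩ := exists_root_arc h he hc hη hη4 (i := 5) (by decide)
  have hp := h.post_inv (η := η) fun i => hη.ne _
  obtain ⟨y, κ', hM, hs⟩ := hp.move_at ht
  have hlt : ∀ j : Fin 6, c j < η := fun j => by
    have := hη j
    rwa [if_pos (show j ≤ 5 from Fin.le_last j)] at this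
  have key : ∀ i j : Fin 6, i < j → (η - c i)⁻¹ < (η - c j)⁻¹ := fun i j hij =>
    (inv_lt_inv₀ (sub_pos.2 (hlt i)) (sub_pos.2 (hlt j))).2 (by linarith [hc hij])
  refine hM.not_of_values (by nlinarith) (natDegree_le_three hM.degq ?_) ?_ ?_ ?_ ?_ ?_
  · rw [coeff_mobSubst_one _ _ _ _ hp.degq]
    simp [htη]
  · exact key 0 3 (by decide)
  · exact key 3 4 (by decide)
  · exact key 1 2 (by decide)
  · exact key 2 3 (by decide)
  · exact key 2 5 (by decide)

end Exclusion

section Markings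

variable {p q : ℝ[X]} {c : Fin 6 → ℝ} {l : Fin 6 → Fin 6} {e : Bool}

/-- The function `p / q` has, up to Möbius equivalence, the marking `l` and the sign `e`. -/
def Realizes (c : Fin 6 → ℝ) (p q : ℝ[X]) (l : Fin 6 → Fin 6) (e : Bool) : Prop :=
  ∃ P Q x κ, Marked P Q x (c ∘ l) κ ∧ (0 < κ ↔ e = true) ∧ MEq p q P Q

theorem pos_iff_of_mul_neg {κ κ' : ℝ} (he : 0 < κ ↔ e = true) (h : κ * κ' < 0) :
    0 < κ' ↔ (!e) = true := by
  rcases mul_neg_iff.1 h with h | h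
  · simp [he.1 h.1, h.2.le]
  · have : e = false := by
      rw [← Bool.not_eq_true, ← he]
      exact h.1.not_gt
    simp [this, h.2]

theorem Realizes.rotate (hp : p.natDegree ≤ 4) (hq : q.natDegree ≤ 4) (h : Realizes c p q l e) :
    Realizes c p q (l ∘ (· + 1)) (!e) := by
  obtain ⟨P, Q, x, κ, hM, he, hE⟩ := h
  obtain ⟨P', Q', y, κ', hM', hs, hE'⟩ := hM.exists_rotate
  exact ⟨P', Q', y, κ', hM', pos_iff_of_mul_neg he hs,
    hE.trans hp hq hM.degp hM.degq hM.q_ne_zero hE'⟩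

theorem Realizes.reflect (hp : p.natDegree ≤ 4) (hq : q.natDegree ≤ 4) (h : Realizes c p q l e) :
    Realizes c p q (l ∘ Fin.rev) (!e) := by
  obtain ⟨P, Q, x, κ, hM, he, hE⟩ := h
  obtain ⟨P', Q', y, κ', hM', hs, hE'⟩ := hM.exists_reflect
  exact ⟨P', Q', y, κ', hM', pos_iff_of_mul_neg he hs,
    hE.trans hp hq hM.degp hM.degq hM.q_ne_zero hE'⟩

theorem Realizes.rotate_iterate (hp : p.natDegree ≤ 4) (hq : q.natDegree ≤ 4)
    (h : Realizes c p q l e) (n : ℕ) :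
    Realizes c p q (fun i => l (i + Fin.ofNat 6 n)) (xor e (n % 2 = 1)) := by
  induction n with
  | zero => simpa using h
  | succ n ih =>
    convert ih.rotate hp hq using 1
    · funext i
      have : Fin.ofNat 6 (n + 1) = 1 + Fin.ofNat 6 n := by
        ext
        simp [Fin.val_add, add_comm]
      simp only [Function.comp, this, add_assoc]
    · rcases Nat.mod_two_eq_zero_or_one n with hn | hn <;> simp [Nat.succ_mod_two_eq_one_iff, hn]

theorem Realizes.rotate_fin (hp : p.natDegree ≤ 4) (hq : q.natDegree ≤ 4)
    (h : Realizes c p q l e) (n : Fin 6) :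
    Realizes c p q (fun i => l (i + n)) (xor e (n.val % 2 = 1)) := by
  simpa using h.rotate_iterate hp hq n.val

theorem Marked.realizes {x : Fin 6 → ℝ} {κ : ℝ} (h : Marked p q x (c ∘ l) κ) :
    Realizes c p q l (decide (0 < κ)) :=
  ⟨p, q, x, κ, h, by simp, MEq.refl h.degp h.degq⟩

/-- The twenty normalised markings. -/
def marking : Fin 20 → (Fin 6 → Fin 6) × Bool :=
  ![(![0, 1, 2, 3, 4, 5], true), (![0, 1, 2, 3, 4, 5], false), (![0, 1, 2, 5, 4, 3], true),
    (![0, 1, 2, 5, 4, 3], false), (![0, 1, 3, 2, 5, 4], true), (![0, 1, 3, 5, 4, 2], false),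
    (![0, 1, 4, 3, 2, 5], true), (![0, 1, 4, 3, 2, 5], false), (![0, 1, 4, 5, 3, 2], false),
    (![0, 1, 5, 3, 2, 4], false), (![0, 1, 5, 4, 2, 3], false), (![0, 2, 1, 4, 3, 5], false),
    (![0, 2, 1, 5, 3, 4], false), (![0, 2, 3, 1, 5, 4], true), (![0, 2, 4, 3, 1, 5], true),
    (![0, 3, 2, 1, 4, 5], true), (![0, 3, 2, 1, 4, 5], false), (![0, 3, 4, 2, 1, 5], true),
    (![0, 4, 2, 1, 3, 5], true), (![0, 4, 3, 1, 2, 5], true)]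

theorem marking_injective : Function.Injective marking := by decide +kernel

theorem marking_normalised (k : Fin 20) : Function.Injective (marking k).1 ∧
    (marking k).1 0 = 0 ∧ (marking k).1 1 < (marking k).1 5 := by
  revert k
  decide +kernel

theorem marking_tight (k : Fin 20) :
    ∃ g, (coverSet (marking k).1 (marking k).2 g).card = 4 := by
  revert k
  decide +kernel

set_option synthInstance.maxHeartbeats 400000 in
set_option synthInstance.maxSize 1000 in
theorem exists_marking_aux : ∀ i : Fin 6, i ≠ 0 → ∀ j, j ≠ 0 → j ≠ i →
    ∀ k, k ≠ 0 → k ≠ i → k ≠ j → ∀ m, m ≠ 0 → m ≠ i → m ≠ j → m ≠ k →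
    ∀ n, n ≠ 0 → n ≠ i → n ≠ j → n ≠ k → n ≠ m → i < n → ∀ e : Bool,
    (∀ g, (coverSet ![0, i, j, k, m, n] e g).card ≤ 4) →
    (![0, i, j, k, m, n], e) ≠ (![0, 1, 4, 5, 2, 3], false) →
    (![0, i, j, k, m, n], e) ≠ (![0, 3, 4, 1, 2, 5], true) →
    ∃ a, marking a = (![0, i, j, k, m, n], e) := by
  decide +kernel

theorem exists_marking (hl : Function.Injective l) (h0 : l 0 = 0) (h15 : l 1 < l 5)
    (hc : ∀ g, (coverSet l e g).card ≤ 4) (h1 : (l, e) ≠ (![0, 1, 4, 5, 2, 3], false))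
    (h2 : (l, e) ≠ (![0, 3, 4, 1, 2, 5], true)) : ∃ a, marking a = (l, e) := by
  obtain ⟨i, j, k, m, n, rfl⟩ : ∃ i j k m n, l = ![0, i, j, k, m, n] := by
    refine ⟨l 1, l 2, l 3, l 4, l 5, funext fun i => ?_⟩
    fin_cases i <;> first | exact h0 | rfl
  have hne : ∀ a b : Fin 6, a ≠ b → (![0, i, j, k, m, n] : Fin 6 → Fin 6) a ≠
    (![0, i, j, k, m, n] : Fin 6 → Fin 6) b := fun a b hab h => hab (hl h)
  exact exists_marking_aux i (hne 1 0 (by decide)) j (hne 2 0 (by decide)) (hne 2 1 (by decide))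
    k (hne 3 0 (by decide)) (hne 3 1 (by decide)) (hne 3 2 (by decide))
    m (hne 4 0 (by decide)) (hne 4 1 (by decide)) (hne 4 2 (by decide)) (hne 4 3 (by decide))
    n (hne 5 0 (by decide)) (hne 5 1 (by decide)) (hne 5 2 (by decide)) (hne 5 3 (by decide))
    (hne 5 4 (by decide)) h15 e hc h1 h2

/-- Every marked pair has one of the twenty normalised markings. -/
theorem Marked.exists_realizes_marking {x : Fin 6 → ℝ} {κ : ℝ} (h : Marked p q x (c ∘ l) κ)
    (hc : StrictMono c) (hl : Function.Injective l) :
    ∃ a, Realizes c p q (marking a).1 (marking a).2 := by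
  obtain ⟨m, e, hm, hm0, hm15, hr⟩ : ∃ m e, Function.Injective m ∧ m 0 = 0 ∧ m 1 < m 5 ∧
      Realizes c p q m e := by
    obtain ⟨n, hn⟩ := Finite.surjective_of_injective hl 0
    have hr := h.realizes.rotate_fin h.degp h.degq n
    have hinj : Function.Injective fun i => l (i + n) := hl.comp (add_left_injective n)
    by_cases h15 : l (1 + n) < l (5 + n)
    · exact ⟨_, _, hinj, by simpa using hn, h15, hr⟩
    · have hr' := (hr.reflect h.degp h.degq).rotate_fin h.degp h.degq 5
      refine ⟨_, _, hinj.comp (Fin.rev_injective.comp (add_left_injective 5)), ?_, ?_, hr'⟩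
      · simpa using hn
      · exact (not_lt.1 h15).lt_of_ne fun h => by simpa using hl h
  obtain ⟨P, Q, y, κ', hM, he, hE⟩ := hr
  obtain ⟨a, ha⟩ := exists_marking hm hm0 hm15 (coverSet_card_le hM he hc)
    (fun h => by
      obtain ⟨rfl, rfl⟩ := Prod.mk.inj h
      exact (Marked.not_of_marking_neg hc hM ((not_lt.1 (by simpa using he)).lt_of_ne hM.kap)))
    (fun h => by
      obtain ⟨rfl, rfl⟩ := Prod.mk.inj h
      exact Marked.not_of_marking_pos hc hM (by simpa using he))
  exact ⟨a, by rw [ha]; exact ⟨P, Q, y, κ', hM, he, hE⟩⟩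

/-- Markings, with positive sign, for which functions are constructed explicitly. -/
def IsModel (l : Fin 6 → Fin 6) : Prop :=
  l = id ∨ l = (· + 1) ∨ l 0 - l 3 = 5 ∧ l 4 - l 3 < l 5 - l 3 ∧ l 2 - l 3 < l 1 - l 3

instance : DecidablePred IsModel := fun l => by unfold IsModel; infer_instance

theorem exists_isModel (k : Fin 20) :
    (∃ n : Fin 6, IsModel (fun i => (marking k).1 (i - n)) ∧
      xor true (n.val % 2 = 1) = (marking k).2) ∨
    ∃ n : Fin 6, IsModel (fun i => (marking k).1 (Fin.rev (i + n))) ∧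
      xor false (n.val % 2 = 1) = (marking k).2 := by
  revert k
  decide +kernel

/-- All twenty markings occur as soon as the models do. -/
theorem exists_marked_marking
    (h : ∀ l, Function.Injective l → IsModel l → ∃ p q x κ, Marked p q x (c ∘ l) κ ∧ 0 < κ)
    (k : Fin 20) : ∃ p q x κ, Marked p q x (c ∘ (marking k).1) κ ∧
      (0 < κ ↔ (marking k).2 = true) := by
  have hinj := (marking_normalised k).1
  rcases exists_isModel k with ⟨n, hn, hs⟩ | ⟨n, hn, hs⟩
  · obtain ⟨p, q, x, κ, hM, hκ⟩ := h _ (hinj.comp (sub_left_injective (b := n))) hn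
    obtain ⟨P, Q, y, κ', hM', he, -⟩ := hM.realizes.rotate_fin hM.degp hM.degq n
    refine ⟨P, Q, y, κ', by simpa using hM', ?_⟩
    rwa [decide_eq_true hκ, hs] at he
  · obtain ⟨p, q, x, κ, hM, hκ⟩ :=
      h _ (hinj.comp (Fin.rev_injective.comp (add_left_injective n))) hn
    obtain ⟨P, Q, y, κ', hM', he, -⟩ :=
      (hM.realizes.reflect hM.degp hM.degq).rotate_fin hM.degp hM.degq n
    refine ⟨P, Q, y, κ', ?_, ?_⟩
    · convert hM' using 2
      ext i
      have : Fin.rev (Fin.rev (i + n) + n) = i := by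
        clear hn hs hM hM' he
        revert i n
        decide
      simp [this]
    · rwa [decide_eq_true hκ, Bool.not_true, hs] at he

end Markings

section Interface

theorem aeval_ofReal_eq (r : ℝ[X]) (t : ℝ) : aeval (t : ℂ) r = ((r.eval t : ℝ) : ℂ) := by
  have := aeval_algebraMap_apply ℂ t r
  simpa using this

theorem aeval_conj_eq (r : ℝ[X]) (z : ℂ) :
    aeval ((starRingEnd ℂ) z) r = (starRingEnd ℂ) (aeval z r) :=
  aeval_algHom_apply Complex.conjAe.toAlgHom z r

/-- A generic function of degree `4` gives rise to a marked pair. -/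
theorem GenericDegR.exists_marked {Cv : Set ℝ} {f : RatFunc ℝ} (hf : GenericDegR 4 Cv f)
    {c : Fin 6 → ℝ} (hc : StrictMono c) (hCv : Set.range c = Cv) :
    ∃ x l κ, Marked f.num f.denom x (c ∘ l) κ ∧ Function.Injective l := by
  obtain ⟨hmax, hdeg, hden, hval⟩ := hf
  have hWdef : wronskian' f = wr f.num f.denom := rfl
  have hW : (wr f.num f.denom).natDegree = 6 := by rw [← hWdef, hdeg]
  have hW0 : wr f.num f.denom ≠ 0 := fun h => by simp [h] at hW
  rw [hWdef] at hden hval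
  have hex : ∀ i, ∃ z : ℂ, aeval z (wr f.num f.denom) = 0 ∧
      aeval z f.num / aeval z f.denom = (c i : ℂ) := fun i => by
    have : ((c i : ℝ) : ℂ) ∈ Complex.ofReal '' Cv := ⟨c i, hCv ▸ ⟨i, rfl⟩, rfl⟩
    rwa [← hval] at this
  choose z hz hzc using hex
  have hzinj : Function.Injective z := fun i j hij => by
    have := hzc i
    rw [hij, hzc j] at this
    exact (hc.injective (Complex.ofReal_injective this)).symm
  have hroots : ∀ w : ℂ, aeval w (wr f.num f.denom) = 0 → ∃ i, z i = w := fun w hw => by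
    have h1 : Finset.univ.image z ⊆ ((wr f.num f.denom).aroots ℂ).toFinset := fun y hy => by
      obtain ⟨i, -, rfl⟩ := Finset.mem_image.1 hy
      rw [Multiset.mem_toFinset, mem_aroots]
      exact ⟨hW0, hz i⟩
    have h2 : ((wr f.num f.denom).aroots ℂ).toFinset.card ≤ (Finset.univ.image z).card := by
      rw [Finset.card_image_of_injective _ hzinj]
      refine (Multiset.toFinset_card_le _).trans ((card_roots' _).trans ?_)
      rw [natDegree_map, hW]
      simp
    have h3 : w ∈ Finset.univ.image z := by
      rw [Finset.eq_of_subset_of_card_le h1 h2, Multiset.mem_toFinset, mem_aroots]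
      exact ⟨hW0, hw⟩
    obtain ⟨i, -, hi⟩ := Finset.mem_image.1 h3
    exact ⟨i, hi⟩
  have hreal : ∀ i, ((z i).re : ℂ) = z i := fun i => by
    obtain ⟨j, hj⟩ := hroots ((starRingEnd ℂ) (z i)) (by rw [aeval_conj_eq, hz, map_zero])
    have : (c j : ℂ) = c i := by
      rw [← hzc j, hj, aeval_conj_eq, aeval_conj_eq, ← map_div₀, hzc i, Complex.conj_ofReal]
    rw [hc.injective (Complex.ofReal_injective this)] at hj
    exact (Complex.conj_eq_iff_re.1 hj.symm)
  obtain ⟨r, hr⟩ : ∃ r : Fin 6 → ℝ, ∀ i, (r i : ℂ) = z i := ⟨fun i => (z i).re, hreal⟩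
  have hrinj : Function.Injective r := fun i j hij => hzinj (by rw [← hr, ← hr, hij])
  have hmono : StrictMono (r ∘ Tuple.sort r) :=
    (Tuple.monotone_sort r).strictMono_of_injective (hrinj.comp (Tuple.sort r).injective)
  have hrW : ∀ i, (wr f.num f.denom).eval (r i) = 0 := fun i => by
    have := hz i
    rw [← hr, aeval_ofReal_eq] at this
    exact_mod_cast this
  have hrq : ∀ i, f.denom.eval (r i) ≠ 0 := fun i => by
    have := hden _ (hz i)
    rw [← hr, aeval_ofReal_eq] at this
    exact_mod_cast this
  refine ⟨r ∘ Tuple.sort r, Tuple.sort r, (wr f.num f.denom).coeff 6, ⟨?_, ?_, hmono, ?_, ?_, ?_,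
    fun i => hrq _⟩, (Tuple.sort r).injective⟩
  · exact (le_max_left _ _).trans hmax.le
  · exact (le_max_right _ _).trans hmax.le
  · rw [← hW]
    exact leadingCoeff_ne_zero.2 hW0
  · exact eq_C_mul_prod_of_roots hW.le hmono.injective fun i => hrW _
  · intro i
    have := hzc (Tuple.sort r i)
    rw [← hr, aeval_ofReal_eq, aeval_ofReal_eq] at this
    exact (div_eq_iff (hrq _)).1 (by exact_mod_cast this)

variable {p q : ℝ[X]} {x v : Fin 6 → ℝ} {κ : ℝ}

theorem Marked.isCoprime (h : Marked p q x v κ) : IsCoprime p q := by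
  refine isCoprime_of_irreducible_dvd (fun h0 => h.q_ne_zero h0.2) fun d hd hdp hdq => ?_
  have hdW : d ∣ wr p q := dvd_sub (hdq.mul_left _) (hdp.mul_right _)
  rw [h.wr_eq] at hdW
  rcases hd.prime.dvd_or_dvd hdW with h1 | h1
  · exact hd.not_isUnit (isUnit_of_dvd_unit h1 (isUnit_C.2 h.kap.isUnit))
  · obtain ⟨i, -, hi⟩ := (hd.prime.dvd_finsetProd_iff _).1 h1
    have hass : Associated d (X - C (x i)) := hd.associated_of_dvd (irreducible_X_sub_C _) hi
    exact h.ne i (dvd_iff_isRoot.1 (hass.dvd'.trans hdq))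

/-- The numerator and denominator of the rational function given by a marked pair. -/
theorem Marked.exists_num_denom (h : Marked p q x v κ) {f : RatFunc ℝ}
    (hf : f = algebraMap ℝ[X] (RatFunc ℝ) p / algebraMap ℝ[X] (RatFunc ℝ) q) :
    ∃ u : ℝ, u ≠ 0 ∧ p = C u * f.num ∧ q = C u * f.denom := by
  obtain ⟨r, hr⟩ : f.denom ∣ q := hf ▸ RatFunc.denom_div_dvd p q
  have hq0 := h.q_ne_zero
  have hcross : f.num * q = p * f.denom := (RatFunc.num_mul_eq_mul_denom_iff hq0).2 hf
  have hpr : p = f.num * r := by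
    refine mul_right_cancel₀ f.denom_ne_zero ?_
    rw [← hcross, hr]
    ring
  have hunit : IsUnit r := h.isCoprime.isUnit_of_dvd' (hpr ▸ dvd_mul_left _ _)
    (hr ▸ dvd_mul_left _ _)
  obtain ⟨u, hu, rfl⟩ := isUnit_iff.1 hunit
  exact ⟨u, hu.ne_zero, by rw [hpr, mul_comm], by rw [hr, mul_comm]⟩

theorem wr_C_mul (u : ℝ) (p q : ℝ[X]) : wr (C u * p) (C u * q) = C (u ^ 2) * wr p q := by
  simp [wr]
  ring

/-- A marked pair gives rise to a generic function. -/
theorem Marked.genericDegR {c : Fin 6 → ℝ} {l : Fin 6 → Fin 6} (h : Marked p q x (c ∘ l) κ)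
    (hl : Function.Injective l) {f : RatFunc ℝ}
    (hf : f = algebraMap ℝ[X] (RatFunc ℝ) p / algebraMap ℝ[X] (RatFunc ℝ) q) :
    GenericDegR 4 (Set.range c) f := by
  obtain ⟨u, hu, hp, hq⟩ := h.exists_num_denom hf
  have hWdef : wronskian' f = wr f.num f.denom := rfl
  have hW : C (u ^ 2) * wr f.num f.denom = C κ * ∏ i, (X - C (x i)) := by
    rw [← wr_C_mul, ← hp, ← hq, h.wr_eq]
  have hu2 : u ^ 2 ≠ 0 := pow_ne_zero 2 hu
  have hdegW : (wr f.num f.denom).natDegree = 6 := by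
    rw [← natDegree_C_mul hu2, hW, natDegree_C_mul h.kap, natDegree_finsetProd_X_sub_C_eq_card]
    simp
  have hroot : ∀ z : ℂ, aeval z (wr f.num f.denom) = 0 ↔ ∃ i, z = x i := fun z => by
    have := congrArg (aeval z) hW
    simp only [map_mul, map_prod, map_sub, aeval_C, aeval_X] at this
    have hu' : (algebraMap ℝ ℂ) (u ^ 2) ≠ 0 := by simpa using hu2
    have hk' : (algebraMap ℝ ℂ) κ ≠ 0 := by simpa using h.kap
    constructor
    · intro hz
      rw [hz, mul_zero, eq_comm, mul_eq_zero, Finset.prod_eq_zero_iff] at this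
      obtain ⟨i, -, hi⟩ := this.resolve_left hk'
      exact ⟨i, sub_eq_zero.1 hi⟩
    · rintro ⟨i, rfl⟩
      rw [Finset.prod_eq_zero (Finset.mem_univ i) (sub_self _), mul_zero] at this
      exact (mul_eq_zero.1 this).resolve_left hu'
  have hne : ∀ i, f.denom.eval (x i) ≠ 0 := fun i h0 => h.ne i (by rw [hq]; simp [h0])
  have hv : ∀ i, f.num.eval (x i) = c (l i) * f.denom.eval (x i) := fun i => by
    have := h.val i
    rw [hp, hq] at this
    simp only [eval_mul, eval_C] at this
    refine mul_left_cancel₀ hu ?_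
    rw [this, Function.comp]
    ring
  have hdiv : ∀ i, aeval (x i : ℂ) f.num / aeval (x i : ℂ) f.denom = (c (l i) : ℂ) := fun i => by
    rw [aeval_ofReal_eq, aeval_ofReal_eq, hv, Complex.ofReal_mul, mul_div_cancel_right₀]
    exact_mod_cast hne i
  have hnum : f.num.natDegree ≤ 4 := by rw [← natDegree_C_mul hu, ← hp]; exact h.degp
  have hden : f.denom.natDegree ≤ 4 := by rw [← natDegree_C_mul hu, ← hq]; exact h.degq
  refine ⟨le_antisymm (max_le hnum hden) ?_, by rw [hWdef, hdegW], ?_, ?_⟩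
  · by_contra hlt
    obtain ⟨h1, h2⟩ := max_lt_iff.1 (not_le.1 hlt)
    have := natDegree_wr_le (n := 2) (Nat.lt_succ_iff.1 h1) (Nat.lt_succ_iff.1 h2)
    omega
  · rw [hWdef]
    intro z hz
    obtain ⟨i, rfl⟩ := (hroot z).1 hz
    rw [aeval_ofReal_eq]
    exact_mod_cast hne i
  · rw [hWdef]
    ext w
    constructor
    · rintro ⟨z, hz, rfl⟩
      obtain ⟨i, rfl⟩ := (hroot z).1 hz
      exact ⟨c (l i), ⟨l i, rfl⟩, (hdiv i).symm⟩
    · rintro ⟨-, ⟨j, rfl⟩, rfl⟩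
      obtain ⟨i, rfl⟩ := Finite.surjective_of_injective hl j
      exact ⟨x i, (hroot _).2 ⟨i, rfl⟩, hdiv i⟩

theorem mobSubst_ne_zero {n : ℕ} {a b c d : ℝ} (hdet : a * d - b * c ≠ 0) (hq : q.natDegree ≤ n)
    (hq0 : q ≠ 0) : mobSubst n a b c d q ≠ 0 := fun h0 => by
  refine Set.infinite_univ (α := ℝ) (((finite_linear_eq_zero hdet).union
    (finite_eval_moebius_eq_zero hq0 hdet)).subset fun y _ => ?_)
  by_cases hy : c * y + d = 0
  · exact Or.inl hy
  · refine Or.inr ⟨hy, ?_⟩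
    have := eval_mobSubst hq (a := a) (b := b) hy
    rw [h0, eval_zero, eq_comm, mul_eq_zero] at this
    exact this.resolve_left (pow_ne_zero _ hy)

theorem aeval_moebius {n : ℕ} {a b c d : ℝ} {K : Type*} [Field K] [Algebra ℝ[X] K] [Algebra ℝ K]
    [IsScalarTower ℝ ℝ[X] K] (hp : p.natDegree ≤ n)
    (hcd : algebraMap ℝ[X] K (C c * X + C d) ≠ 0) :
    aeval (algebraMap ℝ[X] K (C a * X + C b) / algebraMap ℝ[X] K (C c * X + C d)) p *
      algebraMap ℝ[X] K (C c * X + C d) ^ n = algebraMap ℝ[X] K (mobSubst n a b c d p) := by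
  rw [aeval_eq_sum_range' (Nat.lt_succ_of_le hp), mobSubst, map_sum, Finset.sum_mul]
  refine Finset.sum_congr rfl fun k hk => ?_
  have hk' : k ≤ n := Nat.lt_succ_iff.1 (Finset.mem_range.1 hk)
  rw [map_mul, map_mul, map_pow, map_pow, ← algebraMap_eq, ← IsScalarTower.algebraMap_apply,
    algebraMap_eq, Algebra.smul_def, mul_assoc]
  congr 1
  generalize algebraMap ℝ[X] K (C c * X + C d) = u at hcd
  obtain ⟨m, rfl⟩ := Nat.exists_eq_add_of_le hk'
  rw [Nat.add_sub_cancel_left, div_pow, pow_add]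
  field_simp

theorem mobiusEquiv_iff {f g : RatFunc ℝ} (hp : f.num.natDegree ≤ 4)
    (hq : f.denom.natDegree ≤ 4) :
    MobiusEquiv f g ↔ MEq f.num f.denom g.num g.denom := by
  have hinj := RatFunc.algebraMap_injective ℝ
  have key : ∀ a b c d : ℝ, a * d - b * c ≠ 0 →
      (g = aeval (algebraMap ℝ[X] (RatFunc ℝ) (C a * X + C b) /
          algebraMap ℝ[X] (RatFunc ℝ) (C c * X + C d)) f.num /
        aeval (algebraMap ℝ[X] (RatFunc ℝ) (C a * X + C b) /
          algebraMap ℝ[X] (RatFunc ℝ) (C c * X + C d)) f.denom ↔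
      g.num * mobSubst 4 a b c d f.denom = g.denom * mobSubst 4 a b c d f.num) := by
    intro a b c d hdet
    have hcd : algebraMap ℝ[X] (RatFunc ℝ) (C c * X + C d) ≠ 0 := by
      rw [Ne, map_eq_zero_iff _ hinj]
      intro h0
      have h1 := congrArg (fun r => coeff r 1) h0
      have h2 := congrArg (fun r => coeff r 0) h0
      simp at h1 h2
      simp [h1, h2] at hdet
    have hm := mobSubst_ne_zero hdet hq f.denom_ne_zero
    rw [← mul_div_mul_right _ _ (pow_ne_zero 4 hcd), aeval_moebius hp hcd, aeval_moebius hq hcd]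
    conv_lhs => lhs; rw [← RatFunc.num_div_denom g]
    rw [div_eq_div_iff ((map_ne_zero_iff _ hinj).2 g.denom_ne_zero)
      ((map_ne_zero_iff _ hinj).2 hm), ← map_mul, ← map_mul, hinj.eq_iff, mul_comm g.denom]
  constructor
  · rintro ⟨a, b, c, d, hdet, L, rfl, hg⟩
    exact ⟨a, b, c, d, hdet, (key a b c d hdet).1 hg⟩
  · rintro ⟨a, b, c, d, hdet, hg⟩
    exact ⟨a, b, c, d, hdet, _, rfl, (key a b c d hdet).2 hg⟩

end Interface

section Counting

variable {p q : ℝ[X]} {x c : Fin 6 → ℝ} {κ : ℝ} {a b : Fin 20}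

theorem Realizes.mEq {P Q : ℝ[X]} (hc : StrictMono c) (hp : p.natDegree ≤ 4)
    (hq : q.natDegree ≤ 4) (hP : P.natDegree ≤ 4) (hQ : Q.natDegree ≤ 4)
    (h : Realizes c p q (marking a).1 (marking a).2)
    (h' : Realizes c P Q (marking a).1 (marking a).2) : MEq p q P Q := by
  obtain ⟨p₁, q₁, x, κ, hM, he, hE⟩ := h
  obtain ⟨P₁, Q₁, y, κ', hM', he', hE'⟩ := h'
  obtain ⟨g, hg⟩ := marking_tight a
  have h1 := mEq_of_marked hM hM' he he' hc hg
  have h2 := hE'.symm hP hQ hM'.degp hM'.degq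
  exact (hE.trans hp hq hM.degp hM.degq hM.q_ne_zero h1).trans hp hq hM'.degp hM'.degq
    hM'.q_ne_zero h2

theorem Realizes.marking_eq {P Q : ℝ[X]} (hc : StrictMono c) (hp : p.natDegree ≤ 4)
    (hq : q.natDegree ≤ 4) (hP : P.natDegree ≤ 4) (hQ : Q.natDegree ≤ 4) (hq0 : q ≠ 0)
    (hQ0 : Q ≠ 0) (h : Realizes c p q (marking a).1 (marking a).2)
    (h' : Realizes c P Q (marking b).1 (marking b).2) (hE₀ : MEq p q P Q) : a = b := by
  obtain ⟨p₁, q₁, x, κ, hM, he, hE⟩ := h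
  obtain ⟨P₁, Q₁, y, κ', hM', he', hE'⟩ := h'
  have h1 := ((hE.symm hp hq hM.degp hM.degq).trans hM.degp hM.degq hp hq hq0 hE₀).trans
    hM.degp hM.degq hP hQ hQ0 hE'
  obtain ⟨ha, ha0, ha15⟩ := marking_normalised a
  obtain ⟨-, hb0, hb15⟩ := marking_normalised b
  obtain ⟨hl, hs⟩ := marking_eq_of_mEq hM hM' hc ha ha0 ha15 hb0 hb15 h1
  refine marking_injective (Prod.ext hl.symm (Bool.eq_iff_iff.2 ?_))
  rw [← he, ← he']
  rcases mul_pos_iff.1 hs with h | h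
  · exact ⟨fun _ => h.2, fun _ => h.1⟩
  · exact ⟨fun h' => absurd h' h.1.not_gt, fun h' => absurd h' h.2.not_gt⟩

/-- The count, given that all the model markings occur. -/
theorem card_quot_mobiusEquiv {Cv : Set ℝ} (hc : StrictMono c) (hCv : Set.range c = Cv)
    (hmodel : ∀ l, Function.Injective l → IsModel l →
      ∃ p q x κ, Marked p q x (c ∘ l) κ ∧ 0 < κ) :
    Nat.card (Quot fun f g : {f : RatFunc ℝ // GenericDegR 4 Cv f} =>
      MobiusEquiv f.1 g.1) = 20 := by
  have hp : ∀ f : {f : RatFunc ℝ // GenericDegR 4 Cv f}, f.1.num.natDegree ≤ 4 :=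
    fun f => (le_max_left _ _).trans f.2.1.le
  have hq : ∀ f : {f : RatFunc ℝ // GenericDegR 4 Cv f}, f.1.denom.natDegree ≤ 4 :=
    fun f => (le_max_right _ _).trans f.2.1.le
  have hex : ∀ f : {f : RatFunc ℝ // GenericDegR 4 Cv f},
      ∃ a, Realizes c f.1.num f.1.denom (marking a).1 (marking a).2 := fun f => by
    obtain ⟨x, l, κ, hM, hl⟩ := f.2.exists_marked hc hCv
    exact hM.exists_realizes_marking hc hl
  choose inv hinv using hex
  have hiff : ∀ f g, MobiusEquiv f.1 g.1 ↔ inv f = inv g := fun f g => by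
    rw [mobiusEquiv_iff (hp f) (hq f)]
    constructor
    · exact (hinv f).marking_eq hc (hp f) (hq f) (hp g) (hq g) f.1.denom_ne_zero
        g.1.denom_ne_zero (hinv g)
    · intro h
      have := hinv g
      rw [← h] at this
      exact (hinv f).mEq hc (hp f) (hq f) (hp g) (hq g) this
  have hsurj : ∀ a, ∃ f, inv f = a := fun a => by
    obtain ⟨p, q, x, κ, hM, he⟩ := exists_marked_marking hmodel a
    obtain ⟨f, hf⟩ : ∃ f : RatFunc ℝ, f = algebraMap ℝ[X] (RatFunc ℝ) p /
      algebraMap ℝ[X] (RatFunc ℝ) q := ⟨_, rfl⟩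
    have hgen : GenericDegR 4 Cv f := hCv ▸ hM.genericDegR (marking_normalised a).1 hf
    obtain ⟨u, hu, hpu, hqu⟩ := hM.exists_num_denom hf
    refine ⟨⟨f, hgen⟩, ?_⟩
    have hE : MEq f.num f.denom p q := by
      refine mEq_of_eval (hp ⟨f, hgen⟩) (hq ⟨f, hgen⟩) (a := 1) (b := 0) (c := 0) (d := 1)
        (by norm_num) Set.finite_empty fun y _ _ => ?_
      rw [hpu, hqu]
      simp
      ring
    exact Realizes.marking_eq hc (hp ⟨f, hgen⟩) (hq ⟨f, hgen⟩) (hp ⟨f, hgen⟩) (hq ⟨f, hgen⟩)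
      f.denom_ne_zero f.denom_ne_zero (hinv ⟨f, hgen⟩) ⟨p, q, x, κ, hM, he, hE⟩
      (MEq.refl (hp ⟨f, hgen⟩) (hq ⟨f, hgen⟩))
  have hbij : Function.Bijective (Quot.lift inv fun f g h => (hiff f g).1 h) := by
    refine ⟨?_, fun a => ?_⟩
    · rintro ⟨f⟩ ⟨g⟩ h
      exact Quot.sound ((hiff f g).2 h)
    · obtain ⟨f, hf⟩ := hsurj a
      exact ⟨Quot.mk _ f, hf⟩
  rw [Nat.card_congr (Equiv.ofBijective _ hbij), Nat.card_fin]

theorem exists_strictMono_range_eq {Cv : Set ℝ} (hC : Cv.ncard = 6) :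
    ∃ c : Fin 6 → ℝ, StrictMono c ∧ Set.range c = Cv := by
  have hfin : Cv.Finite := Set.finite_of_ncard_pos (by omega)
  have hcard : hfin.toFinset.card = 6 := by rw [← Set.ncard_eq_toFinset_card _ hfin, hC]
  exact ⟨hfin.toFinset.orderEmbOfFin hcard, (hfin.toFinset.orderEmbOfFin hcard).strictMono, by
    rw [Finset.range_orderEmbOfFin, Set.Finite.coe_toFinset]⟩

end Counting

section Continuity

/-- The continuity method: an open and relatively closed set of values meeting a preconnected
set contains it. -/
theorem exists_solution_of_isPreconnected {U V : Type*} [TopologicalSpace V]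
    [FrechetUrysohnSpace V] {sol : Set U} {val : U → V} {Y : Set V} (hY : IsPreconnected Y)
    (hopen : ∀ u ∈ sol, ∀ᶠ y in nhds (val u), ∃ u' ∈ sol, val u' = y)
    (hclosed : ∀ u : ℕ → U, (∀ n, u n ∈ sol) → ∀ y ∈ Y,
      Filter.Tendsto (fun n => val (u n)) Filter.atTop (nhds y) → ∃ u' ∈ sol, val u' = y)
    (hne : ∃ u ∈ sol, val u ∈ Y) {y : V} (hy : y ∈ Y) : ∃ u ∈ sol, val u = y := by
  have hT : IsOpen (val '' sol) := by
    rw [isOpen_iff_mem_nhds]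
    rintro - ⟨u, hu, rfl⟩
    exact hopen u hu
  obtain ⟨u₀, hu₀, hu₀Y⟩ := hne
  refine hY.subset_of_closure_inter_subset hT ⟨val u₀, hu₀Y, u₀, hu₀, rfl⟩ ?_ hy
  rintro y ⟨hy, hyY⟩
  obtain ⟨w, hw, hwy⟩ := mem_closure_iff_seq_limit.1 hy
  choose u hu huw using hw
  exact hclosed u hu y hyY (by simpa only [huw] using hwy)

variable {S J : Type*} [NormedAddCommGroup S] [NormedSpace ℝ S] [FiniteDimensional ℝ S]
  [Fintype J]

/-- Nondegenerate critical points of a family depending on the right number of parameters: the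
critical values can be prescribed arbitrarily close to the original ones. -/
theorem eventually_exists_critical_values (hdim : Module.finrank ℝ S = Fintype.card J)
    {g h : S × ℝ → ℝ} {s : S} {x : J → ℝ} {g' h' : J → S × ℝ →L[ℝ] ℝ}
    (hg : ∀ j, HasStrictFDerivAt g (g' j) (s, x j))
    (hh : ∀ j, HasStrictFDerivAt h (h' j) (s, x j))
    (hg1 : ∀ j, g' j (0, 1) = 0) (hh1 : ∀ j, h' j (0, 1) ≠ 0)
    (hinj : ∀ δ, (∀ j, g' j (δ, 0) = 0) → δ = 0) (h0 : ∀ j, h (s, x j) = 0)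
    {N : Set (S × (J → ℝ))} (hN : N ∈ nhds (s, x)) :
    ∀ᶠ y in nhds fun j => g (s, x j),
      ∃ u ∈ N, (∀ j, h (u.1, u.2 j) = 0) ∧ (fun j => g (u.1, u.2 j)) = y := by
  let L : J → S × (J → ℝ) →L[ℝ] S × ℝ := fun j =>
    (ContinuousLinearMap.fst ℝ S (J → ℝ)).prod
      ((ContinuousLinearMap.proj j).comp (ContinuousLinearMap.snd ℝ S (J → ℝ)))
  let Φ : S × (J → ℝ) → (J → ℝ) × (J → ℝ) := fun u =>
    (fun j => g (u.1, u.2 j), fun j => h (u.1, u.2 j))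
  let Φ' : S × (J → ℝ) →L[ℝ] (J → ℝ) × (J → ℝ) :=
    (ContinuousLinearMap.pi fun j => (g' j).comp (L j)).prod
      (ContinuousLinearMap.pi fun j => (h' j).comp (L j))
  have hΦ : HasStrictFDerivAt Φ Φ' (s, x) := by
    refine HasStrictFDerivAt.prodMk (hasStrictFDerivAt_pi.2 fun j => ?_)
      (hasStrictFDerivAt_pi.2 fun j => ?_)
    · exact (hg j).comp (s, x) (L j).hasStrictFDerivAt
    · exact (hh j).comp (s, x) (L j).hasStrictFDerivAt
  have hlin : ∀ (φ : S × ℝ →L[ℝ] ℝ) (δ : S) (t : ℝ), φ (δ, t) = φ (δ, 0) + t * φ (0, 1) := by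
    intro φ δ t
    rw [← smul_eq_mul, ← map_smul, ← map_add, Prod.smul_mk, Prod.mk_add_mk, smul_zero, add_zero,
      zero_add, smul_eq_mul, mul_one]
  have hker : Function.Injective Φ' := by
    refine (injective_iff_map_eq_zero _).2 ?_
    rintro ⟨δ, t⟩ hδ
    have e1 : ∀ j, g' j (δ, t j) = 0 := fun j => congrFun (congrArg Prod.fst hδ) j
    have e2 : ∀ j, h' j (δ, t j) = 0 := fun j => congrFun (congrArg Prod.snd hδ) j
    obtain rfl : δ = 0 := hinj δ fun j => by
      have := e1 j
      rwa [hlin, hg1, mul_zero, add_zero] at this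
    have : t = 0 := funext fun j => by
      have := e2 j
      rw [hlin, ← Prod.zero_eq_mk, map_zero, zero_add] at this
      exact (mul_eq_zero.1 this).resolve_right (hh1 j)
    rw [this, Prod.zero_eq_mk]
  have hfin : Module.finrank ℝ (S × (J → ℝ)) = Module.finrank ℝ ((J → ℝ) × (J → ℝ)) := by
    rw [Module.finrank_prod, Module.finrank_prod, hdim, Module.finrank_fintype_fun_eq_card]
  have hsurj : Function.Surjective Φ' :=
    (LinearMap.injective_iff_surjective_of_finrank_eq_finrank (f := Φ'.toLinearMap) hfin).1 hker
  have hmap := hΦ.map_nhds_eq_of_surj (LinearMap.range_eq_top.2 hsurj)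
  have himg : Φ '' N ∈ nhds (Φ (s, x)) := hmap ▸ Filter.image_mem_map hN
  have hΦs : Φ (s, x) = (fun j => g (s, x j), 0) := Prod.ext rfl (funext h0)
  rw [hΦs] at himg
  have hcont : Filter.Tendsto (fun y : J → ℝ => (y, (0 : J → ℝ))) (nhds fun j => g (s, x j))
      (nhds (fun j => g (s, x j), 0)) := (Continuous.prodMk_left 0).tendsto _
  filter_upwards [hcont himg] with y hy
  obtain ⟨u, hu, huy⟩ := hy
  exact ⟨u, hu, congrFun (congrArg Prod.snd huy), congrArg Prod.fst huy⟩

/-- The directional derivative computed along a line. -/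
theorem HasStrictFDerivAt.apply_eq_of_hasDerivAt {E : Type*} [NormedAddCommGroup E]
    [NormedSpace ℝ E] {g : E → ℝ} {g' : E →L[ℝ] ℝ} {u δ : E} {d : ℝ}
    (hg : HasStrictFDerivAt g g' u) (hd : HasDerivAt (fun t : ℝ => g (u + t • δ)) d 0) :
    g' δ = d := by
  have h1 : HasDerivAt (fun t : ℝ => u + t • δ) δ 0 := by
    simpa using ((hasDerivAt_id (0 : ℝ)).smul_const δ).const_add u
  have h2 : HasFDerivAt g g' (u + (0 : ℝ) • δ) := by simpa using hg.hasFDerivAt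
  exact (h2.comp_hasDerivAt 0 h1).unique hd

/-- A simple zero of a product is a simple zero of the factor which vanishes. -/
theorem deriv_ne_zero_of_eval_eq {J : Type*} [Fintype J] [DecidableEq J] {x : J → ℝ}
    (hx : Function.Injective x) {K : ℝ} (hK : K ≠ 0) {M : ℝ[X]} {h : ℝ → ℝ} {d : ℝ} {j : J}
    (hM : ∀ᶠ y in nhds (x j), M.eval y * h y = K * ∏ i, (y - x i)) (h0 : h (x j) = 0)
    (hd : HasDerivAt h d (x j)) : d ≠ 0 := by
  rintro rfl
  have h1 := (M.hasDerivAt (x j)).mul hd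
  rw [h0, mul_zero, mul_zero, add_zero] at h1
  have h2 : HasDerivAt (fun y => K * ∏ i, (y - x i)) (K * ∏ i ∈ Finset.univ.erase j, (x j - x i))
      (x j) := by
    have : HasDerivAt (fun y => (y - x j) * ∏ i ∈ Finset.univ.erase j, (y - x i))
        (1 * (∏ i ∈ Finset.univ.erase j, (x j - x i)) + (x j - x j) *
          (derivative (∏ i ∈ Finset.univ.erase j, (X - C (x i)))).eval (x j)) (x j) := by
      refine ((hasDerivAt_id (x j)).sub_const (x j)).mul ?_
      have e : (fun y => ∏ i ∈ Finset.univ.erase j, (y - x i)) =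
          fun y => (∏ i ∈ Finset.univ.erase j, (X - C (x i))).eval y :=
        _root_.funext fun y => by simp [eval_prod]
      rw [e]
      exact (∏ i ∈ Finset.univ.erase j, (X - C (x i))).hasDerivAt (x j)
    rw [sub_self, zero_mul, add_zero, one_mul] at this
    refine (this.const_mul K).congr_of_eventuallyEq (Filter.Eventually.of_forall fun y => ?_)
    simp only
    rw [Finset.mul_prod_erase Finset.univ (fun i => y - x i) (Finset.mem_univ j)]
  have h3 := (h1.congr_of_eventuallyEq (Filter.EventuallyEq.symm hM)).unique h2
  refine mul_ne_zero hK (Finset.prod_ne_zero_iff.2 fun i hi => ?_) h3.symm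
  exact sub_ne_zero.2 fun h => Finset.ne_of_mem_erase hi (hx h).symm

/-- Nondegeneracy of Cauchy systems. -/
theorem eq_zero_of_sum_div_sub_eq_zero {I J : Type*} [Fintype I] [DecidableEq I] [Fintype J]
    {s a : I → ℝ} {x : J → ℝ} (hs : Function.Injective s) (hx : Function.Injective x)
    (hcard : Fintype.card I ≤ Fintype.card J) (hne : ∀ i j, x j ≠ s i)
    (h : ∀ j, ∑ i, a i / (x j - s i) = 0) (i : I) : a i = 0 := by
  let N : ℝ[X] := ∑ i, C (a i) * ∏ k ∈ Finset.univ.erase i, (X - C (s k))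
  have hdeg : N.natDegree ≤ Fintype.card I - 1 := by
    refine natDegree_sum_le_of_forall_le _ _ fun k _ => (natDegree_C_mul_le _ _).trans ?_
    rw [natDegree_finsetProd_X_sub_C_eq_card, Finset.card_erase_of_mem (Finset.mem_univ k),
      Finset.card_univ]
  have heval : ∀ y, N.eval y = ∑ k, a k * ∏ l ∈ Finset.univ.erase k, (y - s l) := fun y => by
    simp [N, eval_finsetSum, eval_prod]
  have hroot : ∀ j, N.eval (x j) = 0 := fun j => by
    have e : N.eval (x j) = (∑ k, a k / (x j - s k)) * ∏ l, (x j - s l) := by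
      rw [heval, Finset.sum_mul]
      refine Finset.sum_congr rfl fun k _ => ?_
      rw [← Finset.mul_prod_erase Finset.univ (fun l => x j - s l) (Finset.mem_univ k), ← mul_assoc,
        div_mul_cancel₀ _ (sub_ne_zero.2 (hne k j))]
    rw [e, h, zero_mul]
  have hN : N = 0 := by
    by_contra hN
    have h1 := card_le_of_roots hN hdeg Finset.univ x hx.injOn fun j _ => hroot j
    have h2 : 0 < Fintype.card I := Fintype.card_pos_iff.2 ⟨i⟩
    rw [Finset.card_univ] at h1
    omega
  have h1 : N.eval (s i) = a i * ∏ l ∈ Finset.univ.erase i, (s i - s l) := by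
    rw [heval]
    refine Finset.sum_eq_single_of_mem i (Finset.mem_univ i) fun k _ hk => ?_
    rw [Finset.prod_eq_zero (Finset.mem_erase.2 ⟨hk.symm, Finset.mem_univ i⟩) (sub_self _),
      mul_zero]
  rw [hN, eval_zero, eq_comm, mul_eq_zero] at h1
  refine h1.resolve_right (Finset.prod_ne_zero_iff.2 fun l hl => ?_)
  exact sub_ne_zero.2 fun h => Finset.ne_of_mem_erase hl (hs h).symm

end Continuity

section Interlacing

/-- The function `y + ∑ rᵢ / (y - pᵢ)` as a function of its parameters `(r, p)` and of `y`. -/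
noncomputable def polarFun (u : ((Fin 3 → ℝ) × (Fin 3 → ℝ)) × ℝ) : ℝ :=
  u.2 + ∑ i, u.1.1 i / (u.2 - u.1.2 i)

/-- The derivative of `polarFun` in its last variable. -/
noncomputable def polarDeriv (u : ((Fin 3 → ℝ) × (Fin 3 → ℝ)) × ℝ) : ℝ :=
  1 - ∑ i, u.1.1 i / (u.2 - u.1.2 i) ^ 2

/-- The numerator of `polarDeriv`. -/
noncomputable def polarNumer (r p : Fin 3 → ℝ) : ℝ[X] :=
  ((X - C (p 0)) * (X - C (p 1)) * (X - C (p 2))) ^ 2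
    - (C (r 0) * ((X - C (p 1)) * (X - C (p 2))) ^ 2
      + C (r 1) * ((X - C (p 0)) * (X - C (p 2))) ^ 2
      + C (r 2) * ((X - C (p 0)) * (X - C (p 1))) ^ 2)

theorem natDegree_polarNumer_le (r p : Fin 3 → ℝ) : (polarNumer r p).natDegree ≤ 6 := by
  unfold polarNumer
  compute_degree

theorem coeff_polarNumer (r p : Fin 3 → ℝ) : (polarNumer r p).coeff 6 = 1 := by
  unfold polarNumer
  compute_degree!

theorem eval_polarNumer (r p : Fin 3 → ℝ) (y : ℝ) : (polarNumer r p).eval y =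
    ((y - p 0) * (y - p 1) * (y - p 2)) ^ 2
    - (r 0 * ((y - p 1) * (y - p 2)) ^ 2 + r 1 * ((y - p 0) * (y - p 2)) ^ 2
      + r 2 * ((y - p 0) * (y - p 1)) ^ 2) := by
  simp [polarNumer]

theorem eval_polarNumer_eq {r p : Fin 3 → ℝ} {y : ℝ} (hy : ∀ i, y ≠ p i) :
    (polarNumer r p).eval y =
      ((y - p 0) * (y - p 1) * (y - p 2)) ^ 2 * polarDeriv ((r, p), y) := by
  have h0 := sub_ne_zero.2 (hy 0)
  have h1 := sub_ne_zero.2 (hy 1)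
  have h2 := sub_ne_zero.2 (hy 2)
  rw [eval_polarNumer, polarDeriv, Fin.sum_univ_three]
  dsimp only
  generalize y - p 0 = a at *
  generalize y - p 1 = b at *
  generalize y - p 2 = c at *
  field_simp

/-- The configurations of poles `p`, residues `r` and critical points `x` for which every pole lies
between two consecutive critical points. -/
structure Interlaced (u : ((Fin 3 → ℝ) × (Fin 3 → ℝ)) × (Fin 6 → ℝ)) : Prop where
  pos : ∀ i, 0 < u.1.1 i
  mono : StrictMono u.2
  left : ∀ i, u.2 (![0, 2, 4] i) < u.1.2 i
  right : ∀ i, u.1.2 i < u.2 (![1, 3, 5] i)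
  crit : ∀ j, polarDeriv (u.1, u.2 j) = 0

variable {r p : Fin 3 → ℝ} {x : Fin 6 → ℝ}

theorem Interlaced.ne (h : Interlaced ((r, p), x)) (i : Fin 3) (j : Fin 6) : x j ≠ p i := by
  have key : ∀ (i : Fin 3) (j : Fin 6), j ≤ ![0, 2, 4] i ∨ ![1, 3, 5] i ≤ j := by decide
  rcases key i j with hj | hj
  · exact ((h.mono.monotone hj).trans_lt (h.left i)).ne
  · exact ((h.right i).trans_le (h.mono.monotone hj)).ne'

theorem Interlaced.injective (h : Interlaced ((r, p), x)) : Function.Injective p := by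
  have key : ∀ i k : Fin 3, i < k → (![1, 3, 5] i : Fin 6) ≤ ![0, 2, 4] k := by decide
  have hp : StrictMono p := fun i k hik =>
    ((h.right i).trans_le (h.mono.monotone (key i k hik))).trans (h.left k)
  exact hp.injective

theorem Interlaced.eval_eq_zero (h : Interlaced ((r, p), x)) (j : Fin 6) :
    (polarNumer r p).eval (x j) = 0 := by
  rw [eval_polarNumer_eq fun i => h.ne i j, h.crit j, mul_zero]

theorem Interlaced.polarNumer_eq (h : Interlaced ((r, p), x)) :
    polarNumer r p = C 1 * ∏ i, (X - C (x i)) := by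
  rw [eq_C_mul_prod_of_roots (natDegree_polarNumer_le r p) h.mono.injective h.eval_eq_zero,
    coeff_polarNumer]

theorem Interlaced.le_sq (h : Interlaced ((r, p), x)) (i : Fin 3) (j : Fin 6) :
    r i ≤ (x j - p i) ^ 2 := by
  have h1 : 0 < (x j - p i) ^ 2 :=
    (sq_nonneg _).lt_of_ne' (pow_ne_zero 2 (sub_ne_zero.2 (h.ne i j)))
  have h2 := h.crit j
  have h3 : r i / (x j - p i) ^ 2 ≤ ∑ i, r i / (x j - p i) ^ 2 :=
    Finset.single_le_sum (f := fun i => r i / (x j - p i) ^ 2)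
      (fun k _ => div_nonneg (h.pos k).le (sq_nonneg _)) (Finset.mem_univ i)
  rw [polarDeriv] at h2
  dsimp only at h2
  rw [← div_le_one h1]
  linarith

/-- An interlaced configuration gives a generic rational function. -/
theorem Interlaced.marked (h : Interlaced ((r, p), x)) :
    ∃ P Q : ℝ[X], Marked P Q x (fun j => polarFun ((r, p), x j)) 1 := by
  refine ⟨X * ((X - C (p 0)) * (X - C (p 1)) * (X - C (p 2)))
    + (C (r 0) * ((X - C (p 1)) * (X - C (p 2))) + C (r 1) * ((X - C (p 0)) * (X - C (p 2)))
      + C (r 2) * ((X - C (p 0)) * (X - C (p 1)))),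
    (X - C (p 0)) * (X - C (p 1)) * (X - C (p 2)), ?_, ?_, h.mono, one_ne_zero, ?_, fun j => ?_,
    fun j => ?_⟩
  · compute_degree
  · compute_degree
    norm_num
  · rw [← h.polarNumer_eq, wr, polarNumer]
    simp only [derivative_add, derivative_mul, derivative_sub, derivative_X, derivative_C]
    ring
  · have h0 := sub_ne_zero.2 (h.ne 0 j)
    have h1 := sub_ne_zero.2 (h.ne 1 j)
    have h2 := sub_ne_zero.2 (h.ne 2 j)
    rw [polarFun, Fin.sum_univ_three]
    simp only [eval_add, eval_mul, eval_sub, eval_X, eval_C]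
    generalize x j - p 0 = a at *
    generalize x j - p 1 = b at *
    generalize x j - p 2 = c at *
    field_simp
  · simp only [eval_mul, eval_sub, eval_X, eval_C]
    exact mul_ne_zero (mul_ne_zero (sub_ne_zero.2 (h.ne 0 j)) (sub_ne_zero.2 (h.ne 1 j)))
      (sub_ne_zero.2 (h.ne 2 j))

theorem hasStrictFDerivAt_polarFun {y : ℝ} (hy : ∀ i, y ≠ p i) :
    HasStrictFDerivAt polarFun (fderiv ℝ polarFun ((r, p), y)) ((r, p), y) := by
  have : ContDiffAt ℝ 1 polarFun ((r, p), y) := by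
    unfold polarFun
    refine ContDiffAt.add (by fun_prop) (ContDiffAt.sum fun i _ => ContDiffAt.div (by fun_prop)
      (by fun_prop) (sub_ne_zero.2 (hy i)))
  exact this.hasStrictFDerivAt one_ne_zero

theorem hasStrictFDerivAt_polarDeriv {y : ℝ} (hy : ∀ i, y ≠ p i) :
    HasStrictFDerivAt polarDeriv (fderiv ℝ polarDeriv ((r, p), y)) ((r, p), y) := by
  have : ContDiffAt ℝ 1 polarDeriv ((r, p), y) := by
    unfold polarDeriv
    refine ContDiffAt.sub (by fun_prop) (ContDiffAt.sum fun i _ => ContDiffAt.div (by fun_prop)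
      (by fun_prop) (pow_ne_zero 2 (sub_ne_zero.2 (hy i))))
  exact this.hasStrictFDerivAt one_ne_zero

theorem fderiv_polarFun_apply {y : ℝ} (hy : ∀ i, y ≠ p i) (a b : Fin 3 → ℝ) (t : ℝ) :
    fderiv ℝ polarFun ((r, p), y) ((a, b), t) =
      t + ∑ i, (a i * (y - p i) - r i * (t - b i)) / (y - p i) ^ 2 := by
  refine (hasStrictFDerivAt_polarFun hy).apply_eq_of_hasDerivAt ?_
  have hlin : ∀ c d : ℝ, HasDerivAt (fun τ : ℝ => c + τ * d) d 0 := fun c d => by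
    simpa using ((hasDerivAt_id (0 : ℝ)).mul_const d).const_add c
  have h1 : ∀ i, HasDerivAt (fun τ : ℝ => (r i + τ * a i) / (y + τ * t - (p i + τ * b i)))
      ((a i * (y - p i) - r i * (t - b i)) / (y - p i) ^ 2) 0 := fun i => by
    simpa using (hlin (r i) (a i)).fun_div ((hlin y t).fun_sub (hlin (p i) (b i)))
      (by simpa using sub_ne_zero.2 (hy i))
  exact (hlin y t).add (HasDerivAt.fun_sum fun i _ => h1 i)

theorem Interlaced.eventually_exists (h : Interlaced ((r, p), x)) :
    ∀ᶠ y in nhds fun j => polarFun ((r, p), x j),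
      ∃ u, Interlaced u ∧ (fun j => polarFun (u.1, u.2 j)) = y := by
  have hN : {u : ((Fin 3 → ℝ) × (Fin 3 → ℝ)) × (Fin 6 → ℝ) | (∀ i, 0 < u.1.1 i) ∧
      (∀ j : Fin 5, u.2 j.castSucc < u.2 j.succ) ∧ (∀ i, u.2 (![0, 2, 4] i) < u.1.2 i) ∧
      ∀ i, u.1.2 i < u.2 (![1, 3, 5] i)} ∈ nhds ((r, p), x) := by
    refine Filter.Eventually.and ?_ (Filter.Eventually.and ?_ (Filter.Eventually.and ?_ ?_))
    · exact Filter.eventually_all.2 fun i =>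
        ContinuousAt.eventually_lt (by fun_prop) (by fun_prop) (h.pos i)
    · exact Filter.eventually_all.2 fun j =>
        ContinuousAt.eventually_lt (by fun_prop) (by fun_prop) (h.mono j.castSucc_lt_succ)
    · exact Filter.eventually_all.2 fun i =>
        ContinuousAt.eventually_lt (by fun_prop) (by fun_prop) (h.left i)
    · exact Filter.eventually_all.2 fun i =>
        ContinuousAt.eventually_lt (by fun_prop) (by fun_prop) (h.right i)
  have key := eventually_exists_critical_values (by simp)
    (fun j => hasStrictFDerivAt_polarFun fun i => h.ne i j)
    (fun j => hasStrictFDerivAt_polarDeriv fun i => h.ne i j) (fun j => ?_) (fun j => ?_) ?_ h.crit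
    hN
  · filter_upwards [key] with y hy
    obtain ⟨u, ⟨h1, h2, h3, h4⟩, h5, h6⟩ := hy
    exact ⟨u, ⟨h1, Fin.strictMono_iff_lt_succ.2 h2, h3, h4, h5⟩, h6⟩
  · have h1 := fderiv_polarFun_apply (r := r) (fun i => h.ne i j) 0 0 1
    have h2 := h.crit j
    rw [polarDeriv] at h2
    rw [← Prod.zero_eq_mk] at h1
    rw [h1, ← h2, sub_eq_add_neg, ← Finset.sum_neg_distrib]
    simp [neg_div]
  · refine deriv_ne_zero_of_eval_eq h.mono.injective one_ne_zero
      (M := ((X - C (p 0)) * (X - C (p 1)) * (X - C (p 2))) ^ 2)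
      (h := fun y => polarDeriv ((r, p), y)) (j := j) ?_ (h.crit j) ?_
    · have : ∀ᶠ y in nhds (x j), ∀ i, y ≠ p i :=
        Filter.eventually_all.2 fun i => eventually_ne_nhds (h.ne i j)
      filter_upwards [this] with y hy
      have e := congrArg (eval y) h.polarNumer_eq
      rw [eval_polarNumer_eq hy] at e
      simpa [eval_prod] using e
    · exact (hasStrictFDerivAt_polarDeriv fun i => h.ne i j).hasFDerivAt.comp_hasDerivAt (x j)
        ((hasDerivAt_const _ _).prodMk (hasDerivAt_id _))
  · rintro ⟨a, b⟩ hδ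
    have hδ' : ∀ j, ∑ i, (a i * (x j - p i) + r i * b i) / (x j - p i) ^ 2 = 0 := fun j => by
      have := hδ j
      rw [fderiv_polarFun_apply fun i => h.ne i j] at this
      simpa using this
    let N : ℝ[X] :=
      (C (a 0) * (X - C (p 0)) + C (r 0 * b 0)) * ((X - C (p 1)) * (X - C (p 2))) ^ 2
      + (C (a 1) * (X - C (p 1)) + C (r 1 * b 1)) * ((X - C (p 0)) * (X - C (p 2))) ^ 2
      + (C (a 2) * (X - C (p 2)) + C (r 2 * b 2)) * ((X - C (p 0)) * (X - C (p 1))) ^ 2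
    have hN : N = 0 := by
      by_contra hN
      have hdeg : N.natDegree ≤ 5 := by
        simp only [N]
        compute_degree
      have hroot : ∀ j, N.eval (x j) = 0 := fun j => by
        have h0 := sub_ne_zero.2 (h.ne 0 j)
        have h1 := sub_ne_zero.2 (h.ne 1 j)
        have h2 := sub_ne_zero.2 (h.ne 2 j)
        have e := hδ' j
        rw [Fin.sum_univ_three] at e
        simp only [N, eval_add, eval_mul, eval_sub, eval_pow, eval_X, eval_C]
        generalize x j - p 0 = z₀ at *
        generalize x j - p 1 = z₁ at *
        generalize x j - p 2 = z₂ at *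
        field_simp at e
        linear_combination e
      have := card_le_of_roots hN hdeg Finset.univ x h.mono.injective.injOn fun j _ => hroot j
      simp at this
    have hp : ∀ {i k}, i ≠ k → p i - p k ≠ 0 := fun hik =>
      sub_ne_zero.2 fun e => hik (h.injective e)
    have hb : b = 0 := by
      refine _root_.funext fun i => ?_
      have e : N.eval (p i) = 0 := by rw [hN, eval_zero]
      simp only [N, eval_add, eval_mul, eval_sub, eval_pow, eval_X, eval_C] at e
      have h1 := (h.pos i).ne'
      fin_cases i <;> simpa [h1, hp, (h.pos _).ne'] using e
    have ha : a = 0 := by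
      refine _root_.funext fun i => eq_zero_of_sum_div_sub_eq_zero h.injective h.mono.injective
        (by simp) h.ne (fun j => ?_) i
      rw [← hδ' j]
      refine Finset.sum_congr rfl fun i _ => ?_
      have := sub_ne_zero.2 (h.ne i j)
      rw [hb, Pi.zero_apply, mul_zero, add_zero, sq, mul_div_mul_right _ _ this]
    rw [ha, hb, ← Prod.zero_eq_mk]

/-- A vanishing residue lowers the degree of the numerator of the derivative, which then has too
many roots. -/
theorem residue_ne_zero {r p : Fin 3 → ℝ} {x : Fin 6 → ℝ} (hx : Function.Injective x)
    (hroot : ∀ j, (polarNumer r p).eval (x j) = 0) (k : Fin 3) : r k ≠ 0 := by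
  intro hk
  have key : ∃ a b α β : ℝ, ∀ y, (polarNumer r p).eval y =
      (y - p k) ^ 2 * (((X - C a) * (X - C b)) ^ 2
        - (C α * (X - C b) ^ 2 + C β * (X - C a) ^ 2)).eval y := by
    fin_cases k
    · refine ⟨p 1, p 2, r 1, r 2, fun y => ?_⟩
      simp only [Fin.zero_eta] at hk
      simp [eval_polarNumer, hk]
      ring
    · refine ⟨p 0, p 2, r 0, r 2, fun y => ?_⟩
      simp only [Fin.mk_one] at hk
      simp [eval_polarNumer, hk]
      ring
    · refine ⟨p 0, p 1, r 0, r 1, fun y => ?_⟩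
      simp only [Fin.reduceFinMk] at hk
      simp [eval_polarNumer, hk]
      ring
  obtain ⟨a, b, α, β, key⟩ := key
  generalize hD : ((X - C a) * (X - C b)) ^ 2
    - (C α * (X - C b) ^ 2 + C β * (X - C a) ^ 2) = D at key
  have hdeg : D.natDegree ≤ 4 := by
    rw [← hD]
    compute_degree
  have hD0 : D ≠ 0 := by
    intro h0
    have : D.coeff 4 = 1 := by
      rw [← hD]
      compute_degree!
    rw [h0, coeff_zero] at this
    exact zero_ne_one this
  obtain ⟨j₀, hj₀⟩ : ∃ j₀, ∀ j, j ≠ j₀ → x j ≠ p k := by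
    by_cases h : ∃ j₀, x j₀ = p k
    · obtain ⟨j₀, h₀⟩ := h
      exact ⟨j₀, fun j hj e => hj (hx (e.trans h₀.symm))⟩
    · exact ⟨0, fun j _ e => h ⟨j, e⟩⟩
  have := card_le_of_roots hD0 hdeg (Finset.univ.erase j₀) x hx.injOn fun j hj => by
    have e := hroot j
    rw [key, mul_eq_zero] at e
    exact e.resolve_left (pow_ne_zero 2 (sub_ne_zero.2 (hj₀ j (Finset.ne_of_mem_erase hj))))
  simp at this

/-- A quotient `r / z` with `0 ≤ r ≤ z ^ 2` depends continuously on `r` and `z`, even at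
`z = 0`. -/
theorem tendsto_div_of_le_sq {ι : Type*} {F : Filter ι} [F.NeBot] {r z : ι → ℝ} {r₀ z₀ : ℝ}
    (hr : Filter.Tendsto r F (nhds r₀)) (hz : Filter.Tendsto z F (nhds z₀))
    (h0 : ∀ n, 0 ≤ r n) (hle : ∀ n, r n ≤ z n ^ 2) :
    Filter.Tendsto (fun n => r n / z n) F (nhds (r₀ / z₀)) := by
  rcases eq_or_ne z₀ 0 with rfl | hne
  · rw [div_zero]
    refine squeeze_zero_norm (a := fun n => |z n|) (fun n => ?_) (by simpa using hz.abs)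
    rw [Real.norm_eq_abs, abs_div, abs_of_nonneg (h0 n)]
    rcases eq_or_ne (z n) 0 with h | h
    · simp [h]
    · rw [div_le_iff₀ (abs_pos.2 h), ← sq, sq_abs]
      exact hle n
  · exact hr.div hz hne

theorem Interlaced.lt_zero {r p : Fin 3 → ℝ} {x : Fin 6 → ℝ} (h : Interlaced ((r, p), x)) :
    polarFun ((r, p), x 0) < x 0 := by
  have : ∑ i, r i / (x 0 - p i) < 0 := Finset.sum_neg (fun i _ => div_neg_of_pos_of_neg (h.pos i)
    (sub_neg.2 ((h.mono.monotone (Fin.zero_le _)).trans_lt (h.left i)))) Finset.univ_nonempty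
  rw [polarFun]
  dsimp only
  linarith

theorem Interlaced.five_lt {r p : Fin 3 → ℝ} {x : Fin 6 → ℝ} (h : Interlaced ((r, p), x)) :
    x 5 < polarFun ((r, p), x 5) := by
  have : 0 < ∑ i, r i / (x 5 - p i) := Finset.sum_pos (fun i _ => div_pos (h.pos i)
    (sub_pos.2 ((h.right i).trans_le (h.mono.monotone (Fin.le_last _))))) Finset.univ_nonempty
  rw [polarFun]
  dsimp only
  linarith

theorem exists_interlaced_of_tendsto {u : ℕ → ((Fin 3 → ℝ) × (Fin 3 → ℝ)) × (Fin 6 → ℝ)}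
    (hu : ∀ n, Interlaced (u n)) {y : Fin 6 → ℝ} (hy : StrictMono y)
    (hlim : Filter.Tendsto (fun n j => polarFun ((u n).1, (u n).2 j)) Filter.atTop (nhds y)) :
    ∃ v, Interlaced v ∧ (fun j => polarFun (v.1, v.2 j)) = y := by
  have hlim' := tendsto_pi_nhds.1 hlim
  have hbound : ∀ᶠ n in Filter.atTop, u n ∈ Set.Icc
      (((fun _ => 0, fun _ => y 0 - 1), fun _ => y 0 - 1) :
        ((Fin 3 → ℝ) × (Fin 3 → ℝ)) × (Fin 6 → ℝ))
      ((fun _ => (y 5 + 1 - (y 0 - 1)) ^ 2, fun _ => y 5 + 1), fun _ => y 5 + 1) := by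
    filter_upwards [(hlim' 0).eventually (lt_mem_nhds (sub_one_lt (y 0))),
      (hlim' 5).eventually (gt_mem_nhds (lt_add_one (y 5)))] with n h0 h5
    have h := hu n
    have hx0 : ∀ j, y 0 - 1 < (u n).2 j := fun j =>
      (h0.trans h.lt_zero).trans_le (h.mono.monotone (Fin.zero_le j))
    have hx5 : ∀ j, (u n).2 j < y 5 + 1 := fun j =>
      (h.mono.monotone (Fin.le_last j)).trans_lt (h.five_lt.trans h5)
    have hp0 : ∀ i, y 0 - 1 < (u n).1.2 i := fun i => (hx0 _).trans (h.left i)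
    have hp5 : ∀ i, (u n).1.2 i < y 5 + 1 := fun i => (h.right i).trans (hx5 _)
    refine ⟨⟨⟨fun i => (h.pos i).le, fun i => (hp0 i).le⟩, fun j => (hx0 j).le⟩,
      ⟨⟨fun i => (h.le_sq i 0).trans ?_, fun i => (hp5 i).le⟩, fun j => (hx5 j).le⟩⟩
    exact sq_le_sq' (by linarith [hx0 0, hp5 i]) (by linarith [hx5 0, hp0 i])
  obtain ⟨⟨⟨r, p⟩, x⟩, -, φ, hφ, hconv⟩ := isCompact_Icc.tendsto_subseq' hbound.frequently
  have hr : ∀ i, Filter.Tendsto (fun n => (u (φ n)).1.1 i) Filter.atTop (nhds (r i)) := fun i =>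
    tendsto_pi_nhds.1 hconv.fst_nhds.fst_nhds i
  have hp : ∀ i, Filter.Tendsto (fun n => (u (φ n)).1.2 i) Filter.atTop (nhds (p i)) := fun i =>
    tendsto_pi_nhds.1 hconv.fst_nhds.snd_nhds i
  have hx : ∀ j, Filter.Tendsto (fun n => (u (φ n)).2 j) Filter.atTop (nhds (x j)) := fun j =>
    tendsto_pi_nhds.1 hconv.snd_nhds j
  have hval : ∀ j, polarFun ((r, p), x j) = y j := fun j => by
    refine tendsto_nhds_unique ?_ ((hlim' j).comp hφ.tendsto_atTop)
    exact (hx j).add (tendsto_finsetSum _ fun i _ => tendsto_div_of_le_sq (hr i)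
      ((hx j).sub (hp i)) (fun n => ((hu (φ n)).pos i).le) fun n => (hu (φ n)).le_sq i j)
  have hinj : Function.Injective x := fun j k hjk => hy.injective (by rw [← hval, ← hval, hjk])
  have hmono : StrictMono x := by
    refine Monotone.strictMono_of_injective (fun j k hjk => ?_) hinj
    exact le_of_tendsto_of_tendsto' (hx j) (hx k) fun n => (hu (φ n)).mono.monotone hjk
  have hroot : ∀ j, (polarNumer r p).eval (x j) = 0 := fun j => by
    have hc : Continuous fun w : ((Fin 3 → ℝ) × (Fin 3 → ℝ)) × (Fin 6 → ℝ) =>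
        (polarNumer w.1.1 w.1.2).eval (w.2 j) := by
      simp only [eval_polarNumer]
      fun_prop
    refine tendsto_nhds_unique ((hc.tendsto _).comp hconv) (tendsto_const_nhds.congr fun n => ?_)
    exact ((hu (φ n)).eval_eq_zero j).symm
  have hpos : ∀ i, 0 < r i := fun i =>
    (ge_of_tendsto' (hr i) fun n => ((hu (φ n)).pos i).le).lt_of_ne'
      (residue_ne_zero hinj hroot i)
  have hne : ∀ i j, x j ≠ p i := fun i j e => by
    have : r i ≤ (x j - p i) ^ 2 :=
      le_of_tendsto_of_tendsto' (hr i) (((hx j).sub (hp i)).pow 2) fun n => (hu (φ n)).le_sq i j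
    rw [e, sub_self] at this
    linarith [hpos i]
  refine ⟨((r, p), x), ⟨hpos, hmono, fun i => ?_, fun i => ?_, fun j => ?_⟩,
    _root_.funext hval⟩
  · exact (le_of_tendsto_of_tendsto' (hx _) (hp i) fun n => ((hu (φ n)).left i).le).lt_of_ne
      (hne i _)
  · exact (le_of_tendsto_of_tendsto' (hp i) (hx _) fun n => ((hu (φ n)).right i).le).lt_of_ne
      (hne i _).symm
  · have e := hroot j
    rw [eval_polarNumer_eq fun i => hne i j, mul_eq_zero] at e
    exact e.resolve_left (pow_ne_zero 2 (mul_ne_zero (mul_ne_zero (sub_ne_zero.2 (hne 0 j))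
      (sub_ne_zero.2 (hne 1 j))) (sub_ne_zero.2 (hne 2 j))))

theorem exists_interlaced : ∃ u, Interlaced u ∧ StrictMono fun j => polarFun (u.1, u.2 j) := by
  refine ⟨((![512 / 1225, 1 / 441, 512 / 1225], ![-1, 0, 1]),
    ![-5 / 3, -1 / 5, -1 / 7, 1 / 7, 1 / 5, 5 / 3]), ⟨?_, ?_, ?_, ?_, ?_⟩, ?_⟩
  · intro i
    fin_cases i <;> simp
  · rw [Fin.strictMono_iff_lt_succ]
    intro i
    fin_cases i <;> simp <;> norm_num
  · intro i
    fin_cases i <;> simp <;> norm_num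
  · intro i
    fin_cases i <;> simp <;> norm_num
  · intro j
    fin_cases j <;> simp [polarDeriv, Fin.sum_univ_three] <;> norm_num
  · rw [Fin.strictMono_iff_lt_succ]
    intro i
    fin_cases i <;> simp [polarFun, Fin.sum_univ_three] <;> norm_num

/-- All increasing sequences of critical values occur. -/
theorem exists_marked_of_strictMono {y : Fin 6 → ℝ} (hy : StrictMono y) :
    ∃ (P Q : ℝ[X]) (x : Fin 6 → ℝ), Marked P Q x y 1 := by
  have hY : IsPreconnected {y : Fin 6 → ℝ | StrictMono y} := by
    refine Convex.isPreconnected fun y hy z hz a b ha hb hab i j hij => ?_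
    rcases ha.eq_or_lt with rfl | ha
    · rw [zero_add] at hab
      simpa [hab] using hz hij
    · exact add_lt_add_of_lt_of_le (mul_lt_mul_of_pos_left (hy hij) ha)
        (mul_le_mul_of_nonneg_left (hz hij).le hb)
  obtain ⟨⟨⟨r, p⟩, x⟩, hu, rfl⟩ := exists_solution_of_isPreconnected
    (sol := {u | Interlaced u}) (val := fun u j => polarFun (u.1, u.2 j)) hY
    (fun u hu => Interlaced.eventually_exists hu)
    (fun u hu y hy hlim => exists_interlaced_of_tendsto hu hy hlim) exists_interlaced hy
  obtain ⟨P, Q, h⟩ := hu.marked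
  exact ⟨P, Q, x, h⟩

end Interlacing

section Existence

variable {c : Fin 6 → ℝ}

theorem exists_marked_id (hc : StrictMono c) :
    ∃ (p q : ℝ[X]) (x : Fin 6 → ℝ) (κ : ℝ), Marked p q x (c ∘ id) κ ∧ 0 < κ := by
  obtain ⟨P, Q, x, h⟩ := exists_marked_of_strictMono hc
  exact ⟨P, Q, x, 1, h, one_pos⟩

theorem exists_marked_add_one (hc : StrictMono c) :
    ∃ (p q : ℝ[X]) (x : Fin 6 → ℝ) (κ : ℝ), Marked p q x (c ∘ (· + 1)) κ ∧ 0 < κ := by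
  obtain ⟨η, h0, h1⟩ := exists_between (hc (show (0 : Fin 6) < 1 by decide))
  have hlt : ∀ i : Fin 6, i ≠ 0 → η < c i := fun i hi =>
    h1.trans_le (hc.monotone (Fin.one_le_of_ne_zero hi))
  have hne : ∀ i, η - c i ≠ 0 := fun i => by
    rcases eq_or_ne i 0 with rfl | hi
    · exact (sub_pos.2 h0).ne'
    · exact (sub_neg.2 (hlt i hi)).ne
  have hy : StrictMono fun i : Fin 6 => (η - c (i + 1))⁻¹ := by
    intro i j hij
    have hi : i + 1 ≠ 0 := by clear hlt hne; revert i j; decide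
    rcases eq_or_ne (j + 1) 0 with hj | hj
    · dsimp only
      rw [hj]
      exact (inv_lt_zero.2 (sub_neg.2 (hlt _ hi))).trans (inv_pos.2 (sub_pos.2 h0))
    · have : i + 1 < j + 1 := by clear hlt hne; revert i j; decide
      exact (inv_lt_inv_of_neg (sub_neg.2 (hlt _ hi)) (sub_neg.2 (hlt _ hj))).2
        (sub_lt_sub_left (hc this) η)
  obtain ⟨P, Q, x, h⟩ := exists_marked_of_strictMono hy
  have hpost := h.post (α := η) (β := -1) (γ := 1) (δ := 0) (by norm_num)
    fun i => by simpa using hne (i + 1)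
  have hval : (fun i => (η * (η - c (i + 1))⁻¹ + -1) / (1 * (η - c (i + 1))⁻¹ + 0)) =
      c ∘ (· + 1) := by
    refine _root_.funext fun i => ?_
    have := hne (i + 1)
    rw [one_mul, add_zero, div_inv_eq_mul, add_mul, mul_assoc, inv_mul_cancel₀ this,
      Function.comp_apply]
    ring
  exact ⟨_, _, x, _, hval ▸ hpost, by norm_num⟩

/-- A rational function with five critical points on the line and the sixth at infinity can be
moved to one with six critical points on the line. -/
theorem exists_marked_cons {p q : ℝ[X]} (hp : p.natDegree ≤ 4) (hq : q.natDegree ≤ 4)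
    {z : Fin 5 → ℝ} (hz : StrictMono z) {K : ℝ} (hK : 0 < K)
    (hw : wr p q = C K * ∏ i, (X - C (z i))) {v : Fin 5 → ℝ} {a : ℝ}
    (hval : ∀ i, p.eval (z i) = v i * q.eval (z i)) (hne : ∀ i, q.eval (z i) ≠ 0)
    (ha : p.coeff 4 = a * q.coeff 4) (ha' : q.coeff 4 ≠ 0) :
    ∃ (P Q : ℝ[X]) (x : Fin 6 → ℝ) (κ : ℝ), Marked P Q x (Fin.cons a v) κ ∧ 0 < κ := by
  obtain ⟨t, ht⟩ : ∃ t, ∀ i, z i < t :=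
    ⟨z 4 + 1, fun i => (hz.monotone (Fin.le_last i)).trans_lt (lt_add_one _)⟩
  have hpos : ∀ i, 0 < (t - z i)⁻¹ := fun i => inv_pos.2 (sub_pos.2 (ht i))
  let x : Fin 6 → ℝ := Fin.cons 0 fun i => (t - z i)⁻¹
  have hx : StrictMono x := by
    refine Fin.strictMono_cons.2 ⟨hpos, fun i j hij => ?_⟩
    exact (inv_lt_inv₀ (sub_pos.2 (ht i)) (sub_pos.2 (ht j))).2 (sub_lt_sub_left (hz hij) t)
  have hpole : (1 : ℝ) * 0 + 0 = 0 := by norm_num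
  have hpt : ∀ i, (t * (t - z i)⁻¹ + -1) / (1 * (t - z i)⁻¹ + 0) = z i := fun i => by
    have := (sub_pos.2 (ht i)).ne'
    rw [one_mul, add_zero, div_inv_eq_mul, add_mul, mul_assoc, inv_mul_cancel₀ this]
    ring
  have heval : ∀ {n : ℕ} {r : ℝ[X]}, r.natDegree ≤ n → ∀ i,
      (mobSubst n t (-1) 1 0 r).eval (t - z i)⁻¹ = (t - z i)⁻¹ ^ n * r.eval (z i) := by
    intro n r hr i
    rw [eval_mobSubst hr (by simpa using (hpos i).ne'), hpt, one_mul, add_zero]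
  have hprod : (∏ i, (X - C (z i))).natDegree = 5 := by
    rw [natDegree_finsetProd_X_sub_C_eq_card]; rfl
  have hw5 : (wr p q).natDegree ≤ 5 := by
    rw [hw]
    exact (natDegree_C_mul_le _ _).trans hprod.le
  have hdet : t * 0 - -1 * 1 = (1 : ℝ) := by norm_num
  have hW : wr (mobSubst 4 t (-1) 1 0 p) (mobSubst 4 t (-1) 1 0 q) =
      mobSubst 6 t (-1) 1 0 (wr p q) := by
    rw [wr_mobSubst (by rw [hdet]; exact one_ne_zero) hp hq, hdet, C_1, one_mul]
  have hroot : ∀ i, (mobSubst 6 t (-1) 1 0 (wr p q)).eval (x i) = 0 := by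
    refine Fin.cases ?_ fun i => ?_
    · exact (eval_mobSubst_pole _ hpole).trans
        (by rw [coeff_eq_zero_of_natDegree_lt (by omega), zero_mul])
    · refine (heval (by omega) i).trans ?_
      rw [hw, eval_mul, eval_prod, Finset.prod_eq_zero (Finset.mem_univ i) (by simp), mul_zero,
        mul_zero]
  have hκ : 0 < (wr p q).eval t := by
    rw [hw, eval_mul, eval_prod, eval_C]
    exact mul_pos hK (Finset.prod_pos fun i _ => by simpa using ht i)
  refine ⟨mobSubst 4 t (-1) 1 0 p, mobSubst 4 t (-1) 1 0 q, x, (wr p q).eval t,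
    ⟨natDegree_mobSubst_le _ _ _ _ _ _, natDegree_mobSubst_le _ _ _ _ _ _, hx, hκ.ne', ?_, ?_, ?_⟩,
    hκ⟩
  · rw [hW, eq_C_mul_prod_of_roots (natDegree_mobSubst_le _ _ _ _ _ _) hx.injective hroot,
      coeff_mobSubst_one _ _ _ _ (hw5.trans (by norm_num))]
  · refine Fin.cases ?_ fun i => ?_
    · refine (eval_mobSubst_pole _ hpole).trans ?_
      rw [ha, mul_assoc]
      exact congrArg (a * ·) (eval_mobSubst_pole _ hpole).symm
    · refine (heval hp i).trans ?_
      rw [hval, mul_left_comm]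
      exact congrArg (v i * ·) (heval hq i).symm
  · refine Fin.cases ?_ fun i => ?_
    · refine ne_of_eq_of_ne (eval_mobSubst_pole _ hpole)
        (mul_ne_zero ha' (show (t * 0 + -1) ^ 4 ≠ 0 by norm_num))
    · exact ne_of_eq_of_ne (heval hq i) (mul_ne_zero (pow_ne_zero 4 (hpos i).ne') (hne i))

/-- A Möbius transformation carrying two cyclically consecutive critical values to `∞` and `0`, and
preserving the cyclic order. -/
theorem exists_moebius_increasing (hc : StrictMono c) (k : Fin 6) :
    ∃ μ, 0 < μ * (c (k + 5) - c k) ∧ ∀ i j, i - k < j - k → j ≠ k + 5 →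
      μ * (c k - c i) / (c i - c (k + 5)) < μ * (c k - c j) / (c j - c (k + 5)) := by
  have key : ∀ {μ a b d e : ℝ}, 0 < μ * (a - b) → d ≠ a → e ≠ a →
      0 < (e - d) / ((d - a) * (e - a)) → μ * (b - d) / (d - a) < μ * (b - e) / (e - a) := by
    intro μ a b d e hμ hd he h
    have e1 : μ * (b - e) / (e - a) - μ * (b - d) / (d - a) =
        μ * (a - b) * ((e - d) / ((d - a) * (e - a))) := by
      have hd' := sub_ne_zero.2 hd
      have he' := sub_ne_zero.2 he
      field_simp
      ring
    exact sub_pos.1 (e1 ▸ mul_pos hμ h)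
  rcases eq_or_ne k 0 with rfl | hk
  · have h5 : ∀ i : Fin 6, i ≠ 0 + 5 → c i < c (0 + 5) := fun i hi =>
      hc (lt_of_le_of_ne (Fin.le_last i) hi)
    refine ⟨1, ?_, fun i j hij hj => ?_⟩
    · rw [one_mul]
      exact sub_pos.2 (h5 0 (by decide))
    · have hij' : i < j := by simpa using hij
      have hi : i ≠ 0 + 5 := (hij'.trans_le (Fin.le_last j)).ne
      refine key ?_ (h5 i hi).ne (h5 j hj).ne (div_pos (sub_pos.2 (hc hij'))
        (mul_pos_of_neg_of_neg (sub_neg.2 (h5 i hi)) (sub_neg.2 (h5 j hj))))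
      rw [one_mul]
      exact sub_pos.2 (h5 0 (by decide))
  · have hk' : k + 5 < k := by clear key; revert k; decide
    have comb : ∀ k i j : Fin 6, k ≠ 0 → i - k < j - k → j ≠ k + 5 →
        (k ≤ i ∧ i < j) ∨ (k ≤ i ∧ j < k + 5) ∨ (i < j ∧ j < k + 5) := by decide
    have hμ : 0 < -1 * (c (k + 5) - c k) := by
      have := hc hk'
      linarith
    refine ⟨-1, hμ, fun i j hij hj => ?_⟩
    rcases comb k i j hk hij hj with ⟨h1, h2⟩ | ⟨h1, h2⟩ | ⟨h1, h2⟩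
    · have hi := hc (hk'.trans_le h1)
      have hj := hc ((hk'.trans_le h1).trans h2)
      exact key hμ hi.ne' hj.ne' (div_pos (sub_pos.2 (hc h2))
        (mul_pos (sub_pos.2 hi) (sub_pos.2 hj)))
    · have hi := hc (hk'.trans_le h1)
      have hj := hc h2
      exact key hμ hi.ne' hj.ne (div_pos_of_neg_of_neg (sub_neg.2 (hj.trans hi))
        (mul_neg_of_pos_of_neg (sub_pos.2 hi) (sub_neg.2 hj)))
    · have hi := hc (h1.trans h2)
      have hj := hc h2
      exact key hμ hi.ne hj.ne (div_pos (sub_pos.2 (hc h1))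
        (mul_pos_of_neg_of_neg (sub_neg.2 hi) (sub_neg.2 hj)))

end Existence

section Straddling

/-- The exponents of the zeros and poles `s` in the product
`y ^ 2 (y - s₀) (y - s₁) / ((y - s₂) (y - s₃))`. -/
def exponent : Fin 4 → ℝ := ![1, 1, -1, -1]

theorem exponent_ne_zero (i : Fin 4) : exponent i ≠ 0 := by
  fin_cases i <;> simp [exponent]

/-- The logarithm of `y ^ 2 (y - s₀) (y - s₁) / ((y - s₂) (y - s₃))` as a function of `(s, y)`. -/
noncomputable def logFun (u : (Fin 4 → ℝ) × ℝ) : ℝ :=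
  2 * Real.log u.2 + ∑ i, exponent i * Real.log (u.2 - u.1 i)

/-- The derivative of `logFun` in its last variable. -/
noncomputable def logFunDeriv (u : (Fin 4 → ℝ) × ℝ) : ℝ :=
  2 / u.2 + ∑ i, exponent i / (u.2 - u.1 i)

/-- The numerator of `logFunDeriv`. -/
noncomputable def logNumer (s : Fin 4 → ℝ) : ℝ[X] :=
  C 2 * ((X - C (s 0)) * (X - C (s 1)) * (X - C (s 2)) * (X - C (s 3)))
    + X * ((X - C (s 1)) * (X - C (s 2)) * (X - C (s 3))
      + (X - C (s 0)) * (X - C (s 2)) * (X - C (s 3))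
      - (X - C (s 0)) * (X - C (s 1)) * (X - C (s 3))
      - (X - C (s 0)) * (X - C (s 1)) * (X - C (s 2)))

theorem natDegree_logNumer_le (s : Fin 4 → ℝ) : (logNumer s).natDegree ≤ 4 := by
  unfold logNumer
  compute_degree

theorem coeff_logNumer (s : Fin 4 → ℝ) : (logNumer s).coeff 4 = 2 := by
  unfold logNumer
  compute_degree!

variable {s z : Fin 4 → ℝ} {y c : ℝ}

theorem eval_logNumer (s : Fin 4 → ℝ) (y : ℝ) : (logNumer s).eval y =
    y * (y - s 1) * (y - s 3) * (s 0 - s 2)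
      + (y - s 0) * (y - s 2) * (2 * (y - s 1) * (y - s 3) + y * (s 1 - s 3)) := by
  simp [logNumer]
  ring

theorem eval_logNumer_eq (hy : y ≠ 0) (hs : ∀ i, y ≠ s i) : (logNumer s).eval y =
    y * ((y - s 0) * (y - s 1) * (y - s 2) * (y - s 3)) * logFunDeriv (s, y) := by
  have h0 := sub_ne_zero.2 (hs 0)
  have h1 := sub_ne_zero.2 (hs 1)
  have h2 := sub_ne_zero.2 (hs 2)
  have h3 := sub_ne_zero.2 (hs 3)
  simp only [logNumer, logFunDeriv, exponent, Fin.sum_univ_four, eval_add, eval_mul, eval_sub,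
    eval_X, eval_C, Matrix.cons_val]
  generalize y - s 0 = a at *
  generalize y - s 1 = b at *
  generalize y - s 2 = d at *
  generalize y - s 3 = e at *
  field_simp
  ring

theorem exp_logFun (hy : y ≠ 0) (hs : 0 < (y - s 0) * (y - s 1) * ((y - s 2) * (y - s 3))) :
    Real.exp (logFun (s, y)) * ((y - s 2) * (y - s 3)) = y ^ 2 * ((y - s 0) * (y - s 1)) := by
  have h01 := left_ne_zero_of_mul hs.ne'
  have h23 := right_ne_zero_of_mul hs.ne'
  have h0 := left_ne_zero_of_mul h01
  have h1 := right_ne_zero_of_mul h01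
  have h2 := left_ne_zero_of_mul h23
  have h3 := right_ne_zero_of_mul h23
  have e : logFun (s, y) =
      Real.log (y ^ 2 * ((y - s 0) * (y - s 1) / ((y - s 2) * (y - s 3)))) := by
    rw [Real.log_mul (pow_ne_zero 2 hy) (div_ne_zero h01 h23), Real.log_div h01 h23,
      Real.log_mul h0 h1, Real.log_mul h2 h3, Real.log_pow]
    simp only [logFun, exponent, Fin.sum_univ_four, Matrix.cons_val]
    push_cast
    ring
  have hpos : 0 < (y - s 0) * (y - s 1) / ((y - s 2) * (y - s 3)) := by
    have : (y - s 0) * (y - s 1) / ((y - s 2) * (y - s 3)) =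
        (y - s 0) * (y - s 1) * ((y - s 2) * (y - s 3)) / ((y - s 2) * (y - s 3)) ^ 2 := by
      field_simp
    rw [this]
    exact div_pos hs (sq_pos_of_ne_zero h23)
  rw [e, Real.exp_log (mul_pos (sq_pos_of_ne_zero hy) hpos), mul_assoc, div_mul_cancel₀ _ h23]

/-- The configurations of zeros and poles `s` and points `z` arranged as
`z₃ < s₃ < s₁ < z₂ < 0 < z₀ < s₀ < s₂ < z₁`. -/
structure StraddledOrder (u : (Fin 4 → ℝ) × (Fin 4 → ℝ)) : Prop where
  z3s3 : u.2 3 < u.1 3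
  s3s1 : u.1 3 < u.1 1
  s1z2 : u.1 1 < u.2 2
  z2neg : u.2 2 < 0
  z0pos : 0 < u.2 0
  z0s0 : u.2 0 < u.1 0
  s0s2 : u.1 0 < u.1 2
  s2z1 : u.1 2 < u.2 1
theorem StraddledOrder.ne (h : StraddledOrder (s, z)) (i j : Fin 4) : z j ≠ s i := by
  obtain ⟨h1, h2, h3, h4, h5, h6, h7, h8⟩ := h
  dsimp only at *
  fin_cases i <;> fin_cases j <;> dsimp <;> intro e <;> linarith

theorem StraddledOrder.ne_zero (h : StraddledOrder (s, z)) (j : Fin 4) : z j ≠ 0 := by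
  obtain ⟨h1, h2, h3, h4, h5, h6, h7, h8⟩ := h
  dsimp only at *
  fin_cases j <;> dsimp <;> intro e <;> linarith

theorem StraddledOrder.injective_params (h : StraddledOrder (s, z)) : Function.Injective s := by
  obtain ⟨h1, h2, h3, h4, h5, h6, h7, h8⟩ := h
  dsimp only at *
  intro i j
  fin_cases i <;> fin_cases j <;> dsimp <;> intro e <;> first | rfl | linarith

theorem StraddledOrder.injective (h : StraddledOrder (s, z)) : Function.Injective z := by
  obtain ⟨h1, h2, h3, h4, h5, h6, h7, h8⟩ := h
  dsimp only at *
  intro i j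
  fin_cases i <;> fin_cases j <;> dsimp <;> intro e <;> first | rfl | linarith

theorem StraddledOrder.prod_pos (h : StraddledOrder (s, z)) (j : Fin 4) :
    0 < (z j - s 0) * (z j - s 1) * ((z j - s 2) * (z j - s 3)) := by
  obtain ⟨h1, h2, h3, h4, h5, h6, h7, h8⟩ := h
  dsimp only at *
  fin_cases j <;> dsimp
  · refine mul_pos_of_neg_of_neg (mul_neg_of_neg_of_pos ?_ ?_) (mul_neg_of_neg_of_pos ?_ ?_) <;>
      linarith
  · refine mul_pos (mul_pos ?_ ?_) (mul_pos ?_ ?_) <;> linarith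
  · refine mul_pos_of_neg_of_neg (mul_neg_of_neg_of_pos ?_ ?_) (mul_neg_of_neg_of_pos ?_ ?_) <;>
      linarith
  · refine mul_pos (mul_pos_of_neg_of_neg ?_ ?_) (mul_pos_of_neg_of_neg ?_ ?_) <;> linarith

theorem StraddledOrder.exp_eq (h : StraddledOrder (s, z)) (j : Fin 4) :
    Real.exp (logFun (s, z j)) * ((z j - s 2) * (z j - s 3)) =
      z j ^ 2 * ((z j - s 0) * (z j - s 1)) :=
  exp_logFun (h.ne_zero j) (h.prod_pos j)

/-- The arranged configurations where the points `z` are critical. -/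
structure Straddled (u : (Fin 4 → ℝ) × (Fin 4 → ℝ)) : Prop extends StraddledOrder u where
  crit : ∀ j, logFunDeriv (u.1, u.2 j) = 0

theorem Straddled.eval_eq_zero (h : Straddled (s, z)) (j : Fin 4) :
    (logNumer s).eval (z j) = 0 := by
  rw [eval_logNumer_eq (h.ne_zero j) fun i => h.ne i j, h.crit j, mul_zero]

theorem Straddled.logNumer_eq (h : Straddled (s, z)) :
    logNumer s = C 2 * ∏ i, (X - C (z i)) := by
  rw [eq_C_mul_prod_of_roots (natDegree_logNumer_le s) h.injective h.eval_eq_zero,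
    coeff_logNumer]

theorem hasStrictFDerivAt_logFun (hy : y ≠ 0) (hs : ∀ i, y ≠ s i) :
    HasStrictFDerivAt logFun (fderiv ℝ logFun (s, y)) (s, y) := by
  have : ContDiffAt ℝ 1 logFun (s, y) := by
    unfold logFun
    refine ContDiffAt.add (contDiffAt_const.mul (ContDiffAt.log (by fun_prop) hy))
      (ContDiffAt.sum fun i _ => contDiffAt_const.mul
        (ContDiffAt.log (by fun_prop) (sub_ne_zero.2 (hs i))))
  exact this.hasStrictFDerivAt one_ne_zero

theorem hasStrictFDerivAt_logFunDeriv (hy : y ≠ 0) (hs : ∀ i, y ≠ s i) :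
    HasStrictFDerivAt logFunDeriv (fderiv ℝ logFunDeriv (s, y)) (s, y) := by
  have : ContDiffAt ℝ 1 logFunDeriv (s, y) := by
    unfold logFunDeriv
    refine ContDiffAt.add (contDiffAt_const.div (by fun_prop) hy)
      (ContDiffAt.sum fun i _ => contDiffAt_const.div (by fun_prop) (sub_ne_zero.2 (hs i)))
  exact this.hasStrictFDerivAt one_ne_zero

theorem fderiv_logFun_apply (hy : y ≠ 0) (hs : ∀ i, y ≠ s i) (δ : Fin 4 → ℝ) (t : ℝ) :
    fderiv ℝ logFun (s, y) (δ, t) = 2 * (t / y) + ∑ i, exponent i * ((t - δ i) / (y - s i)) := by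
  refine (hasStrictFDerivAt_logFun hy hs).apply_eq_of_hasDerivAt ?_
  have hlin : ∀ c d : ℝ, HasDerivAt (fun τ : ℝ => c + τ * d) d 0 := fun c d => by
    simpa using ((hasDerivAt_id (0 : ℝ)).mul_const d).const_add c
  have h0 : HasDerivAt (fun τ : ℝ => Real.log (y + τ * t)) (t / y) 0 := by
    simpa using (hlin y t).log (by simpa using hy)
  have h1 : ∀ i, HasDerivAt (fun τ : ℝ => Real.log (y + τ * t - (s i + τ * δ i)))
      ((t - δ i) / (y - s i)) 0 := fun i => by
    simpa using ((hlin y t).fun_sub (hlin (s i) (δ i))).log (by simpa using sub_ne_zero.2 (hs i))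
  exact (h0.const_mul 2).add (HasDerivAt.fun_sum fun i _ => (h1 i).const_mul _)

theorem Straddled.eventually_exists (h : Straddled (s, z)) :
    ∀ᶠ y in nhds fun j => logFun (s, z j),
      ∃ u, Straddled u ∧ (fun j => logFun (u.1, u.2 j)) = y := by
  have hN : ∀ᶠ u : (Fin 4 → ℝ) × (Fin 4 → ℝ) in nhds (s, z),
      u.2 3 < u.1 3 ∧ u.1 3 < u.1 1 ∧ u.1 1 < u.2 2 ∧ u.2 2 < 0 ∧ 0 < u.2 0 ∧ u.2 0 < u.1 0 ∧
        u.1 0 < u.1 2 ∧ u.1 2 < u.2 1 := by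
    have key : ∀ {f g : (Fin 4 → ℝ) × (Fin 4 → ℝ) → ℝ}, Continuous f → Continuous g →
        f (s, z) < g (s, z) → ∀ᶠ u in nhds (s, z), f u < g u := fun hf hg =>
      hf.continuousAt.eventually_lt hg.continuousAt
    exact (key (by fun_prop) (by fun_prop) h.z3s3).and
      ((key (by fun_prop) (by fun_prop) h.s3s1).and
      ((key (by fun_prop) (by fun_prop) h.s1z2).and
      ((key (by fun_prop) (by fun_prop) h.z2neg).and
      ((key (by fun_prop) (by fun_prop) h.z0pos).and
      ((key (by fun_prop) (by fun_prop) h.z0s0).and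
      ((key (by fun_prop) (by fun_prop) h.s0s2).and
      (key (by fun_prop) (by fun_prop) h.s2z1)))))))
  have key := eventually_exists_critical_values (by simp)
    (fun j => hasStrictFDerivAt_logFun (h.ne_zero j) fun i => h.ne i j)
    (fun j => hasStrictFDerivAt_logFunDeriv (h.ne_zero j) fun i => h.ne i j) (fun j => ?_)
    (fun j => ?_) ?_ h.crit hN
  · filter_upwards [key] with y hy
    obtain ⟨u, ⟨h1, h2, h3, h4, h5, h6, h7, h8⟩, h9, h10⟩ := hy
    exact ⟨u, ⟨⟨h1, h2, h3, h4, h5, h6, h7, h8⟩, h9⟩, h10⟩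
  · rw [fderiv_logFun_apply (h.ne_zero j) fun i => h.ne i j, ← h.crit j, logFunDeriv]
    simp [div_eq_mul_inv]
  · refine deriv_ne_zero_of_eval_eq h.injective two_ne_zero
      (M := X * ((X - C (s 0)) * (X - C (s 1)) * (X - C (s 2)) * (X - C (s 3))))
      (h := fun y => logFunDeriv (s, y)) (j := j) ?_ (h.crit j) ?_
    · have : ∀ᶠ y in nhds (z j), ∀ i, y ≠ s i :=
        Filter.eventually_all.2 fun i => eventually_ne_nhds (h.ne i j)
      filter_upwards [this, eventually_ne_nhds (h.ne_zero j)] with y hy hy0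
      have e := congrArg (eval y) h.logNumer_eq
      rw [eval_logNumer_eq hy0 hy] at e
      simpa [eval_prod] using e
    · exact (hasStrictFDerivAt_logFunDeriv (h.ne_zero j)
        fun i => h.ne i j).hasFDerivAt.comp_hasDerivAt (z j)
        ((hasDerivAt_const _ _).prodMk (hasDerivAt_id _))
  · intro δ hδ
    refine _root_.funext fun i => ?_
    have := eq_zero_of_sum_div_sub_eq_zero (a := fun i => exponent i * δ i) h.injective_params
      h.injective (by simp) h.ne (fun j => ?_) i
    · exact (mul_eq_zero.1 this).resolve_left (exponent_ne_zero i)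
    · have e := hδ j
      rw [fderiv_logFun_apply (h.ne_zero j) fun i => h.ne i j] at e
      simpa [neg_div, mul_div_assoc] using e

end Straddling

section Straddling

/-- The equations satisfied by a critical point `z` with value `c`, in a form which passes to
limits. -/
structure CriticalAt (s₀ s₁ s₂ s₃ z c : ℝ) : Prop where
  val : c * ((z - s₂) * (z - s₃)) = z ^ 2 * ((z - s₀) * (z - s₁))
  crit : z * (z - s₁) * (z - s₃) * (s₀ - s₂)
    + (z - s₀) * (z - s₂) * (2 * (z - s₁) * (z - s₃) + z * (s₁ - s₃)) = 0
  val' : c * (z - s₃) ^ 2 = z * (z * (z - s₁) * (z - s₃)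
    + (2 * (z - s₁) * (z - s₃) + z * (s₁ - s₃)) * (z - s₀))

variable {s₀ s₁ s₂ s₃ z z' c c' : ℝ}

theorem CriticalAt.of_ne (h : c * ((z - s₂) * (z - s₃)) = z ^ 2 * ((z - s₀) * (z - s₁)))
    (h' : z * (z - s₁) * (z - s₃) * (s₀ - s₂)
      + (z - s₀) * (z - s₂) * (2 * (z - s₁) * (z - s₃) + z * (s₁ - s₃)) = 0) (hz : z ≠ s₂) :
    CriticalAt s₀ s₁ s₂ s₃ z c where
  val := h
  crit := h'
  val' := by
    refine mul_left_cancel₀ (sub_ne_zero.2 hz) ?_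
    linear_combination -z * h' + (z - s₃) * h

/-- In a limit of configurations the two zeros and poles on the positive side do not collide with
each other, nor with the critical points. -/
theorem CriticalAt.lt_of_le (h : CriticalAt s₀ s₁ s₂ s₃ z c) (h' : CriticalAt s₀ s₁ s₂ s₃ z' c')
    (hc : 0 < c) (hcc : c ≠ c') (hz : 0 < z) (h0 : z ≤ s₀) (h02 : s₀ ≤ s₂) (h2 : s₂ ≤ z')
    (h31 : s₃ ≤ s₁) (h1 : s₁ < 0) : z < s₀ ∧ s₀ < s₂ ∧ s₂ < z' := by
  have hlt : s₀ < s₂ := by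
    refine lt_of_le_of_ne h02 fun e => hcc ?_
    subst e
    have key : ∀ {w : ℝ}, 0 < w →
        w * (w - s₁) * (w - s₃) * (s₀ - s₀)
          + (w - s₀) * (w - s₀) * (2 * (w - s₁) * (w - s₃) + w * (s₁ - s₃)) = 0 → w = s₀ := by
      intro w hw e
      have hpos : 0 < 2 * (w - s₁) * (w - s₃) + w * (s₁ - s₃) :=
        add_pos_of_pos_of_nonneg (mul_pos (by linarith) (by linarith))
          (mul_nonneg hw.le (by linarith))
      rw [sub_self, mul_zero, zero_add, mul_eq_zero, mul_self_eq_zero] at e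
      exact sub_eq_zero.1 (e.resolve_right hpos.ne')
    have hzs := key hz h.crit
    have hzs' := key (hz.trans_le (h0.trans h2)) h'.crit
    have e := h.val'
    have e' := h'.val'
    rw [hzs] at e
    rw [hzs'] at e'
    exact mul_right_cancel₀ (pow_ne_zero 2 (by linarith : s₀ - s₃ ≠ 0)) (e.trans e'.symm)
  refine ⟨lt_of_le_of_ne h0 ?_, hlt, lt_of_le_of_ne h2 ?_⟩
  · rintro rfl
    have e := h.val
    rw [sub_self, zero_mul, mul_zero] at e
    have : 0 < c * ((s₂ - z) * (z - s₃)) :=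
      mul_pos hc (mul_pos (by linarith) (by linarith))
    linarith
  · rintro rfl
    have e := h'.val
    rw [sub_self, zero_mul, mul_zero] at e
    have : 0 < s₂ ^ 2 * ((s₂ - s₀) * (s₂ - s₁)) :=
      mul_pos (pow_pos (by linarith) 2) (mul_pos (by linarith) (by linarith))
    linarith

theorem le_sq_of_value (h : c * ((z - s₂) * (z - s₃)) = z ^ 2 * ((z - s₀) * (z - s₁)))
    (hz : 0 < z) (h0 : z < s₀) (h02 : s₀ < s₂) (h31 : s₃ < s₁) (h1 : s₁ < 0) : c ≤ z ^ 2 := by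
  have hpos : 0 < (s₂ - z) * (z - s₃) := mul_pos (by linarith) (by linarith)
  refine le_of_mul_le_mul_right ?_ hpos
  have : c * ((s₂ - z) * (z - s₃)) = z ^ 2 * ((s₀ - z) * (z - s₁)) := by linear_combination -h
  rw [this]
  refine mul_le_mul_of_nonneg_left ?_ (sq_nonneg z)
  exact mul_le_mul (by linarith) (by linarith) (by linarith) (by linarith)

theorem sq_le_of_value (h : c * ((z - s₂) * (z - s₃)) = z ^ 2 * ((z - s₀) * (z - s₁)))
    (hc : 0 < c) (h0 : 0 < s₀) (h02 : s₀ < s₂) (h2 : s₂ < z) (h1 : s₁ < 0) (h3 : -z < s₃) :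
    z ^ 2 ≤ 2 * c := by
  have hpos : 0 < (z - s₀) * (z - s₁) := mul_pos (by linarith) (by linarith)
  refine le_of_mul_le_mul_right ?_ hpos
  rw [← h]
  have : (z - s₂) * (z - s₃) ≤ (z - s₀) * (2 * (z - s₁)) :=
    (mul_le_mul_of_nonneg_left (by linarith) (by linarith)).trans
      (mul_le_mul_of_nonneg_right (by linarith) (by linarith))
  have := mul_le_mul_of_nonneg_left this hc.le
  linarith

theorem CriticalAt.neg (h : CriticalAt s₀ s₁ s₂ s₃ z c) (hz : z ≠ s₃) :
    CriticalAt (-s₁) (-s₀) (-s₃) (-s₂) (-z) c := by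
  refine .of_ne ?_ ?_ fun e => hz (neg_injective e)
  · linear_combination h.val
  · linear_combination h.crit

/-- The critical points and parameters are bounded in terms of the critical values. -/
theorem Straddled.sq_le {s z : Fin 4 → ℝ} (h : Straddled (s, z)) {M : ℝ}
    (h1 : Real.exp (logFun (s, z 1)) ≤ M) (h3 : Real.exp (logFun (s, z 3)) ≤ M) :
    z 3 ^ 2 ≤ 2 * M ∧ z 1 ^ 2 ≤ 2 * M := by
  have e1 := h.exp_eq 1
  have e3 := h.exp_eq 3
  obtain ⟨⟨l1, l2, l3, l4, l5, l6, l7, l8⟩, -⟩ := h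
  dsimp only at *
  rcases le_total (-z 3) (z 1) with hle | hle
  · have := sq_le_of_value e1 (Real.exp_pos _) (by linarith) l7 l8 (by linarith) (by linarith)
    have h31 : z 3 ^ 2 ≤ z 1 ^ 2 := sq_le_sq' (by linarith) (by linarith)
    constructor <;> linarith
  · have e3' : Real.exp (logFun (s, z 3)) * ((-z 3 - -s 3) * (-z 3 - -s 2)) =
        (-z 3) ^ 2 * ((-z 3 - -s 1) * (-z 3 - -s 0)) := by linear_combination e3
    have := sq_le_of_value e3' (Real.exp_pos _) (by linarith) (by linarith) (by linarith)
      (by linarith) (by linarith)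
    rw [neg_sq] at this
    have h13 : z 1 ^ 2 ≤ (-z 3) ^ 2 := sq_le_sq' (by linarith) hle
    rw [neg_sq] at h13
    constructor <;> linarith

theorem exists_straddled_of_tendsto {u : ℕ → (Fin 4 → ℝ) × (Fin 4 → ℝ)}
    (hu : ∀ n, Straddled (u n)) {y : Fin 4 → ℝ} (hy01 : y 0 < y 1) (hy23 : y 2 < y 3)
    (hlim : Filter.Tendsto (fun n j => logFun ((u n).1, (u n).2 j)) Filter.atTop (nhds y)) :
    ∃ v, Straddled v ∧ (fun j => logFun (v.1, v.2 j)) = y := by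
  have hexp : ∀ j, Filter.Tendsto (fun n => Real.exp (logFun ((u n).1, (u n).2 j))) Filter.atTop
      (nhds (Real.exp (y j))) := fun j =>
    (Real.continuous_exp.tendsto _).comp (tendsto_pi_nhds.1 hlim j)
  obtain ⟨M, hM1, hM3⟩ : ∃ M, Real.exp (y 1) < M ∧ Real.exp (y 3) < M :=
    ⟨max (Real.exp (y 1)) (Real.exp (y 3)) + 1, by
      have := le_max_left (Real.exp (y 1)) (Real.exp (y 3)); linarith, by
      have := le_max_right (Real.exp (y 1)) (Real.exp (y 3)); linarith⟩
  have hbound : ∀ᶠ n in Filter.atTop, u n ∈ Set.Icc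
      ((fun _ => -√(2 * M), fun _ => -√(2 * M)) : (Fin 4 → ℝ) × (Fin 4 → ℝ))
      (fun _ => √(2 * M), fun _ => √(2 * M)) := by
    filter_upwards [(hexp 1).eventually (gt_mem_nhds hM1),
      (hexp 3).eventually (gt_mem_nhds hM3)] with n h1 h3
    obtain ⟨b3, b1⟩ := (hu n).sq_le h1.le h3.le
    have b3' := (abs_le.1 (Real.abs_le_sqrt b3)).1
    have b1' := (abs_le.1 (Real.abs_le_sqrt b1)).2
    obtain ⟨⟨l1, l2, l3, l4, l5, l6, l7, l8⟩, -⟩ := hu n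
    refine ⟨⟨fun i => ?_, fun i => ?_⟩, ⟨fun i => ?_, fun i => ?_⟩⟩ <;> fin_cases i <;>
      dsimp <;> linarith
  obtain ⟨⟨s, z⟩, -, φ, hφ, hconv⟩ := isCompact_Icc.tendsto_subseq' hbound.frequently
  have hs : ∀ i, Filter.Tendsto (fun n => (u (φ n)).1 i) Filter.atTop (nhds (s i)) := fun i =>
    tendsto_pi_nhds.1 hconv.fst_nhds i
  have hz : ∀ j, Filter.Tendsto (fun n => (u (φ n)).2 j) Filter.atTop (nhds (z j)) := fun j =>
    tendsto_pi_nhds.1 hconv.snd_nhds j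
  have hexp' := fun j => (hexp j).comp hφ.tendsto_atTop
  have hcritn : ∀ n j, CriticalAt ((u n).1 0) ((u n).1 1) ((u n).1 2) ((u n).1 3) ((u n).2 j)
      (Real.exp (logFun ((u n).1, (u n).2 j))) := fun n j =>
    .of_ne ((hu n).exp_eq j) (by rw [← eval_logNumer, (hu n).eval_eq_zero j]) ((hu n).ne 2 j)
  have hclosed : ∀ {s₀ s₁ s₂ s₃ w c : ℕ → ℝ} {t₀ t₁ t₂ t₃ w' c' : ℝ},
      (∀ n, CriticalAt (s₀ n) (s₁ n) (s₂ n) (s₃ n) (w n) (c n)) →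
      Filter.Tendsto s₀ Filter.atTop (nhds t₀) → Filter.Tendsto s₁ Filter.atTop (nhds t₁) →
      Filter.Tendsto s₂ Filter.atTop (nhds t₂) → Filter.Tendsto s₃ Filter.atTop (nhds t₃) →
      Filter.Tendsto w Filter.atTop (nhds w') → Filter.Tendsto c Filter.atTop (nhds c') →
      CriticalAt t₀ t₁ t₂ t₃ w' c' := by
    intro s₀ s₁ s₂ s₃ w c t₀ t₁ t₂ t₃ w' c' h h0 h1 h2 h3 hw hc
    have hwt : ∀ {a : ℕ → ℝ} {b : ℝ}, Filter.Tendsto a Filter.atTop (nhds b) →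
      Filter.Tendsto (fun n => w n - a n) Filter.atTop (nhds (w' - b)) := fun ha => hw.sub ha
    have hβ := (((hwt h1).const_mul 2).mul (hwt h3)).add (hw.mul (h1.sub h3))
    have h13 := (hw.mul (hwt h1)).mul (hwt h3)
    refine ⟨?_, ?_, ?_⟩
    · exact tendsto_nhds_unique_of_eventuallyEq (hc.mul ((hwt h2).mul (hwt h3)))
        ((hw.pow 2).mul ((hwt h0).mul (hwt h1))) (.of_forall fun n => (h n).val)
    · exact tendsto_nhds_unique_of_eventuallyEq
        ((h13.mul (h0.sub h2)).add (((hwt h0).mul (hwt h2)).mul hβ)) tendsto_const_nhds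
        (.of_forall fun n => (h n).crit)
    · exact tendsto_nhds_unique_of_eventuallyEq (hc.mul ((hwt h3).pow 2))
        (hw.mul (h13.add (hβ.mul (hwt h0)))) (.of_forall fun n => (h n).val')
  have hcrit : ∀ j, CriticalAt (s 0) (s 1) (s 2) (s 3) (z j) (Real.exp (y j)) := fun j =>
    hclosed (fun n => hcritn (φ n) j) (hs 0) (hs 1) (hs 2) (hs 3) (hz j) (hexp' j)
  have hcrit' : ∀ j, CriticalAt (-s 1) (-s 0) (-s 3) (-s 2) (-z j) (Real.exp (y j)) := fun j =>
    hclosed (fun n => (hcritn (φ n) j).neg ((hu (φ n)).ne 3 j)) (hs 1).neg (hs 0).neg (hs 3).neg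
      (hs 2).neg (hz j).neg (hexp' j)
  have hle : ∀ {a b : ℕ → ℝ} {a' b' : ℝ}, Filter.Tendsto a Filter.atTop (nhds a') →
      Filter.Tendsto b Filter.atTop (nhds b') → (∀ n, a n < b n) → a' ≤ b' := fun ha hb h =>
    le_of_tendsto_of_tendsto' ha hb fun n => (h n).le
  have hz0 : 0 < z 0 := by
    have h1 : Real.exp (y 0) ≤ z 0 ^ 2 :=
      le_of_tendsto_of_tendsto' (hexp' 0) ((hz 0).pow 2) fun n => by
        have h := hu (φ n)
        exact le_sq_of_value (h.exp_eq 0) h.z0pos h.z0s0 h.s0s2 h.s3s1 (h.s1z2.trans h.z2neg)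
    have h2 : 0 ≤ z 0 := hle tendsto_const_nhds (hz 0) fun n => (hu (φ n)).z0pos
    exact h2.lt_of_ne' fun e => by
      rw [e] at h1
      exact absurd ((Real.exp_pos _).trans_le h1) (by norm_num)
  have hz2 : z 2 < 0 := by
    have h1 : Real.exp (y 2) ≤ (-z 2) ^ 2 :=
      le_of_tendsto_of_tendsto' (hexp' 2) ((hz 2).neg.pow 2) fun n => by
        have h := hu (φ n)
        exact le_sq_of_value ((hcritn (φ n) 2).neg (h.ne 3 2)).val (neg_pos.2 h.z2neg)
          (neg_lt_neg h.s1z2) (neg_lt_neg h.s3s1) (neg_lt_neg h.s0s2)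
          (neg_neg_of_pos (h.z0pos.trans h.z0s0))
    have h2 : z 2 ≤ 0 := hle (hz 2) tendsto_const_nhds fun n => (hu (φ n)).z2neg
    exact h2.lt_of_ne fun e => by
      rw [e] at h1
      exact absurd ((Real.exp_pos _).trans_le h1) (by norm_num)
  have l1 := hle (hz 3) (hs 3) fun n => (hu (φ n)).z3s3
  have l2 := hle (hs 3) (hs 1) fun n => (hu (φ n)).s3s1
  have l3 := hle (hs 1) (hz 2) fun n => (hu (φ n)).s1z2
  have l6 := hle (hz 0) (hs 0) fun n => (hu (φ n)).z0s0
  have l7 := hle (hs 0) (hs 2) fun n => (hu (φ n)).s0s2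
  have l8 := hle (hs 2) (hz 1) fun n => (hu (φ n)).s2z1
  obtain ⟨m6, m7, m8⟩ := (hcrit 0).lt_of_le (hcrit 1) (Real.exp_pos _)
    (Real.exp_lt_exp.2 hy01).ne hz0 l6 l7 l8 l2 (l3.trans_lt hz2)
  obtain ⟨m3, m2, m1⟩ := (hcrit' 2).lt_of_le (hcrit' 3) (Real.exp_pos _)
    (Real.exp_lt_exp.2 hy23).ne (neg_pos.2 hz2) (neg_le_neg l3) (neg_le_neg l2) (neg_le_neg l1)
    (neg_le_neg l7) (neg_neg_of_pos (hz0.trans m6))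
  rw [neg_lt_neg_iff] at m1 m2 m3
  have hord : StraddledOrder (s, z) := ⟨m1, m2, m3, hz2, hz0, m6, m7, m8⟩
  refine ⟨(s, z), ⟨hord, fun j => ?_⟩, _root_.funext fun j => ?_⟩
  · have e := (hcrit j).crit
    rw [← eval_logNumer, eval_logNumer_eq (hord.ne_zero j) fun i => hord.ne i j] at e
    refine (mul_eq_zero.1 e).resolve_left (mul_ne_zero (hord.ne_zero j) ?_)
    exact mul_ne_zero (mul_ne_zero (mul_ne_zero (sub_ne_zero.2 (hord.ne 0 j))
      (sub_ne_zero.2 (hord.ne 1 j))) (sub_ne_zero.2 (hord.ne 2 j))) (sub_ne_zero.2 (hord.ne 3 j))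
  · refine Real.exp_injective (mul_right_cancel₀ (right_ne_zero_of_mul (hord.prod_pos j).ne') ?_)
    exact (hord.exp_eq j).trans (hcrit j).val.symm

theorem exists_straddled : ∃ u, Straddled u ∧
    logFun (u.1, u.2 0) < logFun (u.1, u.2 1) ∧ logFun (u.1, u.2 2) < logFun (u.1, u.2 3) := by
  have h : Straddled (![7, -7, 25, -25], ![5, 35, -5, -35]) := by
    refine ⟨⟨?_, ?_, ?_, ?_, ?_, ?_, ?_, ?_⟩, fun j => ?_⟩
    · simp; norm_num
    · simp; norm_num
    · simp; norm_num
    · simp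
    · simp
    · simp; norm_num
    · simp; norm_num
    · simp; norm_num
    · fin_cases j <;> simp [logFunDeriv, exponent, Fin.sum_univ_four] <;> norm_num
  have e : ∀ j, _ := h.exp_eq
  have e0 := e 0
  have e1 := e 1
  have e2 := e 2
  have e3 := e 3
  refine ⟨_, h, ?_, ?_⟩ <;> rw [← Real.exp_lt_exp] <;>
    simp only [Matrix.cons_val] at * <;> linarith

/-- All positive critical values for which the outer critical points have larger values occur. -/
theorem exists_straddled_of_lt {y : Fin 4 → ℝ} (h01 : y 0 < y 1) (h23 : y 2 < y 3) :
    ∃ u, Straddled u ∧ (fun j => logFun (u.1, u.2 j)) = y := by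
  have hY : IsPreconnected {y : Fin 4 → ℝ | y 0 < y 1 ∧ y 2 < y 3} := by
    have key : ∀ i j : Fin 4, Convex ℝ {y : Fin 4 → ℝ | y i < y j} := fun i j => by
      have := convex_halfSpace_lt (((LinearMap.proj i : (Fin 4 → ℝ) →ₗ[ℝ] ℝ) -
        LinearMap.proj j).isLinear) 0
      simpa [sub_neg] using this
    exact ((key 0 1).inter (key 2 3)).isPreconnected
  exact exists_solution_of_isPreconnected (sol := {u | Straddled u})
    (val := fun u j => logFun (u.1, u.2 j)) hY (fun u hu => Straddled.eventually_exists hu)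
    (fun u hu y hy hlim => exists_straddled_of_tendsto hu hy.1 hy.2 hlim) exists_straddled
    ⟨h01, h23⟩

end Straddling

theorem Straddled.wr_eq {s z : Fin 4 → ℝ} (h : Straddled (s, z)) :
    wr (X ^ 2 * ((X - C (s 0)) * (X - C (s 1)))) ((X - C (s 2)) * (X - C (s 3))) =
      C 2 * (X * ∏ i, (X - C (z i))) := by
  rw [mul_left_comm (C 2), ← h.logNumer_eq]
  simp only [wr, logNumer, derivative_mul, derivative_X_pow, derivative_sub, derivative_X,
    derivative_C]
  simp
  ring

/-- The third family of models, with two consecutive critical values joined by a chord. -/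
theorem exists_marked_of_sub_eq {c : Fin 6 → ℝ} (hc : StrictMono c) {l : Fin 6 → Fin 6}
    (hl : Function.Injective l) (h03 : l 0 - l 3 = 5) (h45 : l 4 - l 3 < l 5 - l 3)
    (h21 : l 2 - l 3 < l 1 - l 3) :
    ∃ (p q : ℝ[X]) (x : Fin 6 → ℝ) (κ : ℝ), Marked p q x (c ∘ l) κ ∧ 0 < κ := by
  obtain ⟨μ, hμ, hmono⟩ := exists_moebius_increasing hc (l 3)
  have h0 : l 3 + 5 = l 0 := by rw [← h03, add_sub_cancel]
  rw [h0] at hμ hmono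
  have hinj : ∀ i, i ≠ 0 → l i ≠ l 0 := fun i hi e => hi (hl e)
  set w : Fin 6 → ℝ := fun i => μ * (c (l 3) - c (l i)) / (c (l i) - c (l 0)) with hw
  have hpos : ∀ i, i ≠ 0 → i ≠ 3 → 0 < w i := fun i hi hi' => by
    have := hmono (l 3) (l i) ?_ (hinj i hi)
    · simpa [hw] using this
    · rw [sub_self]
      exact Fin.pos_of_ne_zero (sub_ne_zero.2 fun e => hi' (hl e))
  have hlt45 : w 4 < w 5 := hmono _ _ h45 (hinj 5 (by decide))
  have hlt21 : w 2 < w 1 := hmono _ _ h21 (hinj 1 (by decide))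
  obtain ⟨⟨s, z⟩, h, hval⟩ := exists_straddled_of_lt
    (y := ![Real.log (w 4), Real.log (w 5), Real.log (w 2), Real.log (w 1)])
    (Real.log_lt_log (hpos 4 (by decide) (by decide)) hlt45)
    (Real.log_lt_log (hpos 2 (by decide) (by decide)) hlt21)
  set P : ℝ[X] := X ^ 2 * ((X - C (s 0)) * (X - C (s 1))) with hP
  set Q : ℝ[X] := (X - C (s 2)) * (X - C (s 3)) with hQ
  have hQ0 : Q.eval 0 ≠ 0 := by
    have h1 := h.z0pos.trans (h.z0s0.trans h.s0s2)
    have h2 := h.s3s1.trans (h.s1z2.trans h.z2neg)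
    simpa [hQ] using ⟨h1.ne', h2.ne⟩
  have hQz : ∀ j, Q.eval (z j) ≠ 0 := fun j => by
    simpa [hQ] using right_ne_zero_of_mul (h.prod_pos j).ne'
  have hPz : ∀ j, P.eval (z j) =
      ![w 4, w 5, w 2, w 1] j * Q.eval (z j) := fun j => by
    have e := h.exp_eq j
    have e' : logFun (s, z j) = _ := congrFun hval j
    have e'' : Real.exp (logFun (s, z j)) = ![w 4, w 5, w 2, w 1] j := by
      rw [e']
      fin_cases j <;> exact Real.exp_log (hpos _ (by decide) (by decide))
    rw [e''] at e
    simpa [hP, hQ] using e.symm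
  have hcoeff : P.coeff 4 = 1 := by
    rw [hP]
    compute_degree!
  have hcoeffQ : Q.coeff 4 = 0 := by
    rw [hQ]
    exact coeff_eq_zero_of_natDegree_lt (lt_of_le_of_lt (by compute_degree) (by norm_num : 2 < 4))
  have hPdeg : P.natDegree ≤ 4 := by
    rw [hP]
    compute_degree
  have hQdeg : Q.natDegree ≤ 4 := by
    rw [hQ]
    exact (show natDegree _ ≤ 2 by compute_degree).trans (by norm_num)
  set v : Fin 5 → ℝ := fun i => c (l i.succ) with hv
  have hμ0 : μ ≠ 0 := left_ne_zero_of_mul hμ.ne'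
  have hba : c (l 3) - c (l 0) ≠ 0 := sub_ne_zero.2 fun e => hinj 3 (by decide) (hc.injective e)
  have hvw : ∀ {i : Fin 5} {t : ℝ}, P.eval t = w i.succ * Q.eval t → Q.eval t ≠ 0 →
      (C (c (l 0)) * P + C (μ * c (l 3)) * Q).eval t =
        v i * (C 1 * P + C μ * Q).eval t ∧ (C 1 * P + C μ * Q).eval t ≠ 0 := by
    intro i t e hQt
    have hca : c (l i.succ) - c (l 0) ≠ 0 :=
      sub_ne_zero.2 fun e => hinj _ i.succ_ne_zero (hc.injective e)
    have hwi : w i.succ * (c (l i.succ) - c (l 0)) = μ * (c (l 3) - c (l i.succ)) :=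
      div_mul_cancel₀ _ hca
    simp only [eval_add, eval_mul, eval_C, e, hv]
    refine ⟨?_, fun e0 => ?_⟩
    · linear_combination (-Q.eval t) * hwi
    · have e1 : w i.succ + μ = 0 := by
        refine (mul_eq_zero.1 ?_).resolve_right hQt
        linear_combination e0
      refine mul_ne_zero hμ0 hba ?_
      linear_combination (c (l i.succ) - c (l 0)) * e1 - hwi
  have hP0 : P.eval 0 = w 3 * Q.eval 0 := by simp [hP, hw]
  have hall : ∀ i : Fin 5, P.eval (![z 3, z 2, 0, z 0, z 1] i) =
      w i.succ * Q.eval (![z 3, z 2, 0, z 0, z 1] i) ∧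
        Q.eval (![z 3, z 2, 0, z 0, z 1] i) ≠ 0 := by
    intro i
    fin_cases i
    · exact ⟨hPz 3, hQz 3⟩
    · exact ⟨hPz 2, hQz 2⟩
    · exact ⟨hP0, hQ0⟩
    · exact ⟨hPz 0, hQz 0⟩
    · exact ⟨hPz 1, hQz 1⟩
  have hcons : c ∘ l = Fin.cons (c (l 0)) v := by
    refine _root_.funext fun i => ?_
    cases i using Fin.cases <;> rfl
  rw [hcons]
  refine exists_marked_cons (p := C (c (l 0)) * P + C (μ * c (l 3)) * Q)
    (q := C 1 * P + C μ * Q) (z := ![z 3, z 2, 0, z 0, z 1]) ?_ ?_ ?_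
    (K := 2 * (μ * (c (l 0) - c (l 3)))) (by linarith) ?_ (fun i => (hvw (hall i).1 (hall i).2).1)
    (fun i => (hvw (i := i) (hall i).1 (hall i).2).2) ?_ ?_
  · exact natDegree_add_le_of_degree_le ((natDegree_C_mul_le _ _).trans hPdeg)
      ((natDegree_C_mul_le _ _).trans hQdeg)
  · exact natDegree_add_le_of_degree_le ((natDegree_C_mul_le _ _).trans hPdeg)
      ((natDegree_C_mul_le _ _).trans hQdeg)
  · rw [Fin.strictMono_iff_lt_succ]
    have h1 := h.z3s3.trans (h.s3s1.trans h.s1z2)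
    have h2 := h.z0s0.trans (h.s0s2.trans h.s2z1)
    intro i
    fin_cases i
    · exact h1
    · exact h.z2neg
    · exact h.z0pos
    · exact h2
  · rw [wr_post, h.wr_eq, ← mul_assoc, ← C_mul, Fin.prod_univ_four, Fin.prod_univ_five]
    simp only [Matrix.cons_val, map_zero, sub_zero]
    rw [show (c (l 0) * μ - μ * c (l 3) * 1) * 2 = 2 * (μ * (c (l 0) - c (l 3))) by ring]
    ring
  · simp [coeff_C_mul, hcoeff, hcoeffQ, -map_mul]
  · simp [coeff_C_mul, hcoeff, hcoeffQ, -map_mul]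

theorem exists_marked_of_isModel {c : Fin 6 → ℝ} (hc : StrictMono c) {l : Fin 6 → Fin 6}
    (hl : Function.Injective l) (h : IsModel l) :
    ∃ (p q : ℝ[X]) (x : Fin 6 → ℝ) (κ : ℝ), Marked p q x (c ∘ l) κ ∧ 0 < κ := by
  rcases h with rfl | rfl | ⟨h03, h45, h21⟩
  · exact exists_marked_id hc
  · exact exists_marked_add_one hc
  · exact exists_marked_of_sub_eq hc hl h03 h45 h21

/-- For every set `C` of `6` distinct real numbers, the number of real
Möbius-equivalence classes of generic degree-`4` real rational M-functions with
critical value set `C` equals `20`. -/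
theorem count_real_rational_M_functions_degree_4
    (Cv : Set ℝ) (hC : Cv.ncard = 6) :
    Nat.card (Quot fun f g : {f : RatFunc ℝ // GenericDegR 4 Cv f} =>
        MobiusEquiv f.1 g.1) = 20 := by
  obtain ⟨c, hc, hcv⟩ := exists_strictMono_range_eq hC
  exact card_quot_mobiusEquiv hc hcv fun l hl h => exists_marked_of_isModel hc hl h
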